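/- Let Γ be a finitely generated free group and j, ρ : Γ → PSL(2,ℝ) homomorphisms such that the action γ·x = ρ(γ) x j(γ)⁻¹ of Γ on PSL(2,ℝ) is properly discontinuous and admits a fundamental domain bounded by pairwise disjoint right AdS crooked planes. Then j is injective, j(Γ) is a discrete subgroup of PSL(2,ℝ), λ(j(γ)) > 0 for every γ ≠ 1 (j is convex cocompact), and ρ is uniformly shorter than j: there exists c < 1 such that λ(ρ(γ)) ≤ c·λ(j(γ)) for all γ ∈ Γ. -/

import Mathlib

noncomputable section

open Filter Topology Pointwise
open scoped UpperHalfPlane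

/-- `SL(2,ℝ)`. -/
abbrev SL2 := Matrix.SpecialLinearGroup (Fin 2) ℝ

instance : TopologicalSpace SL2 :=
  TopologicalSpace.induced (fun A : SL2 => (A : Matrix (Fin 2) (Fin 2) ℝ)) inferInstance

/-- `PSL(2,ℝ) = SL(2,ℝ)/{±I}`. -/
abbrev PSL2 := SL2 ⧸ Subgroup.center SL2

/-- The Möbius action of an element of `PSL(2,ℝ)` on the upper half-plane,
computed via an (arbitrary) lift to `SL(2,ℝ)`; this is well defined since
`-I` acts trivially. -/
def pslSMul (g : PSL2) (z : ℍ) : ℍ := (Quotient.out g) • z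

/-- Image of a subset of `ℍ` under the Möbius action of `g ∈ PSL(2,ℝ)`. -/
def pslImg (g : PSL2) (s : Set ℍ) : Set ℍ := pslSMul g '' s

/-- A geodesic line of `ℍ`: the image of an isometric embedding of `ℝ` into `ℍ`. -/
def IsGeodesicLine (l : Set ℍ) : Prop := ∃ γ : ℝ → ℍ, Isometry γ ∧ Set.range γ = l

/-- The embedding of `ℍ` into the one-point compactification of `ℂ`. -/
def embH (z : ℍ) : OnePoint ℂ := ((z : ℂ) : OnePoint ℂ)

/-- The embedding of `∂∞ℍ = ℝ ∪ {∞}` into the one-point compactification of `ℂ`. -/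
def toC : OnePoint ℝ → OnePoint ℂ := OnePoint.map Complex.ofReal

/-- The vector `v(ξ) ∈ ℝ²` associated with a boundary point `ξ ∈ ℝ ∪ {∞}`:
`v(ξ) = (ξ, 1)` for `ξ ∈ ℝ` and `v(∞) = (1, 0)`. -/
def bvec (ξ : OnePoint ℝ) : Fin 2 → ℝ := Option.elim ξ ![1, 0] (fun r => ![r, 1])

/-- The extended Möbius action of `PSL(2,ℝ)` on `∂∞ℍ = ℝ ∪ {∞}`. -/
def bdSMul (g : PSL2) (ξ : OnePoint ℝ) : OnePoint ℝ :=
  let w := ((Quotient.out g : SL2) : Matrix (Fin 2) (Fin 2) ℝ).mulVec (bvec ξ)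
  if w 1 = 0 then OnePoint.infty else ((w 0 / w 1 : ℝ) : OnePoint ℝ)

/-- `ξ ∈ ℝ ∪ {∞}` is an endpoint of the geodesic line `l`: some isometric
parametrization of `l` tends to `ξ` (in the one-point compactification of `ℂ`). -/
def IsEndpoint (l : Set ℍ) (ξ : OnePoint ℝ) : Prop :=
  ∃ γ : ℝ → ℍ, Isometry γ ∧ Set.range γ = l ∧
    Tendsto (fun t => embH (γ t)) atTop (𝓝 (toC ξ))

/-- `h ∈ PSL(2,ℝ)` has a nonattracting fixed point at `ξ ∈ ℝ ∪ {∞}`. -/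
def HasNonattracting (h : PSL2) (ξ : OnePoint ℝ) : Prop :=
  ∃ A : SL2, (QuotientGroup.mk A : PSL2) = h ∧
    ∃ μ : ℝ, |μ| ≤ 1 ∧ (A : Matrix (Fin 2) (Fin 2) ℝ).mulVec (bvec ξ) = μ • bvec ξ

/-- `h ∈ PSL(2,ℝ)` has a nonrepelling fixed point at `ξ ∈ ℝ ∪ {∞}`. -/
def HasNonrepelling (h : PSL2) (ξ : OnePoint ℝ) : Prop :=
  ∃ A : SL2, (QuotientGroup.mk A : PSL2) = h ∧
    ∃ μ : ℝ, 1 ≤ |μ| ∧ (A : Matrix (Fin 2) (Fin 2) ℝ).mulVec (bvec ξ) = μ • bvec ξ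

/-- The right AdS crooked plane `C*(l)` centered at the identity. -/
def rightCrooked (l : Set ℍ) : Set PSL2 :=
  {h | (∃ x ∈ l, pslSMul h x = x) ∨ ∃ ξ, IsEndpoint l ξ ∧ HasNonattracting h ξ}

/-- The left AdS crooked plane `C(l)` centered at the identity. -/
def leftCrooked (l : Set ℍ) : Set PSL2 :=
  {h | (∃ x ∈ l, pslSMul h x = x) ∨ ∃ ξ, IsEndpoint l ξ ∧ HasNonrepelling h ξ}

/-- A general right AdS crooked plane: a set of the form `g·C*(l)`. -/
def IsRightCrookedPlane (S : Set PSL2) : Prop :=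
  ∃ (g : PSL2) (l : Set ℍ), IsGeodesicLine l ∧ S = (g * ·) '' rightCrooked l

/-- A general left AdS crooked plane: a set of the form `C(l)·g`. -/
def IsLeftCrookedPlane (S : Set PSL2) : Prop :=
  ∃ (g : PSL2) (l : Set ℍ), IsGeodesicLine l ∧ S = (· * g) '' leftCrooked l

variable {Γ : Type*} [Group Γ]

/-- The action `γ·x = ρ(γ) x j(γ)⁻¹` of `Γ` on `PSL(2,ℝ)`, applied to a set. -/
def actImg (j ρ : Γ →* PSL2) (γ : Γ) (S : Set PSL2) : Set PSL2 :=
  (fun x => ρ γ * x * (j γ)⁻¹) '' S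

/-- The action `γ·x = ρ(γ) x j(γ)⁻¹` is properly discontinuous. -/
def ProperlyDisc (j ρ : Γ →* PSL2) : Prop :=
  ∀ K : Set PSL2, IsCompact K → {γ : Γ | (actImg j ρ γ K ∩ K).Nonempty}.Finite

/-- `R` is a fundamental domain for the action `γ·x = ρ(γ) x j(γ)⁻¹`:
`R` is closed, its translates cover `PSL(2,ℝ)`, and the interiors of the
translates are pairwise disjoint. -/
def IsFundDom (j ρ : Γ →* PSL2) (R : Set PSL2) : Prop :=
  IsClosed R ∧ (⋃ γ : Γ, actImg j ρ γ R) = Set.univ ∧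
    Pairwise fun γ₁ γ₂ : Γ =>
      Disjoint (interior (actImg j ρ γ₁ R)) (interior (actImg j ρ γ₂ R))

/-- The action admits a fundamental domain bounded by pairwise disjoint
right AdS crooked planes. -/
def AdmitsRightCrookedFD (j ρ : Γ →* PSL2) : Prop :=
  ∃ (m : ℕ) (D : Fin m → Set PSL2), (∀ i, IsRightCrookedPlane (D i)) ∧
    (∀ (γ γ' : Γ) (i i' : Fin m),
      actImg j ρ γ (D i) = actImg j ρ γ' (D i') ∨
      Disjoint (actImg j ρ γ (D i)) (actImg j ρ γ' (D i'))) ∧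
    ∃ x ∈ (⋃ (γ : Γ) (i : Fin m), actImg j ρ γ (D i))ᶜ,
      IsFundDom j ρ
        (closure (connectedComponentIn (⋃ (γ : Γ) (i : Fin m), actImg j ρ γ (D i))ᶜ x))

/-- The action admits a fundamental domain bounded by pairwise disjoint
left AdS crooked planes. -/
def AdmitsLeftCrookedFD (j ρ : Γ →* PSL2) : Prop :=
  ∃ (m : ℕ) (D : Fin m → Set PSL2), (∀ i, IsLeftCrookedPlane (D i)) ∧
    (∀ (γ γ' : Γ) (i i' : Fin m),
      actImg j ρ γ (D i) = actImg j ρ γ' (D i') ∨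
      Disjoint (actImg j ρ γ (D i)) (actImg j ρ γ' (D i'))) ∧
    ∃ x ∈ (⋃ (γ : Γ) (i : Fin m), actImg j ρ γ (D i))ᶜ,
      IsFundDom j ρ
        (closure (connectedComponentIn (⋃ (γ : Γ) (i : Fin m), actImg j ρ γ (D i))ᶜ x))

/-- The translation length `λ(g) = inf_{p ∈ ℍ} d(p, g·p)`. -/
def transLength (g : PSL2) : ℝ := ⨅ p : ℍ, dist p (pslSMul g p)

/-- `U` is a connected component of `S`. -/
def IsCC (S U : Set ℍ) : Prop := ∃ x ∈ S, connectedComponentIn S x = U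

/-- `ξ ∈ ℝ ∪ {∞}` is an ideal point of `U ⊆ ℍ`: a limit of a sequence of points
of `U` in the one-point compactification of `ℂ`. -/
def IsIdealPoint (U : Set ℍ) (ξ : OnePoint ℝ) : Prop :=
  ∃ u : ℕ → ℍ, (∀ n, u n ∈ U) ∧ Tendsto (fun n => embH (u n)) atTop (𝓝 (toC ξ))

/-- The closed right crooked half-space `H̄*₊(l, U)`. -/
def closedRHS (l U : Set ℍ) : Set PSL2 :=
  {h | (∃ x ∈ l ∪ U, pslSMul h x = x) ∨ ∃ ξ, IsIdealPoint U ξ ∧ HasNonattracting h ξ}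

/-- The open right crooked half-space `H*₊(l, U)`. -/
def openRHS (l U : Set ℍ) : Set PSL2 :=
  {h | h ≠ 1 ∧ ((∃ x ∈ U, pslSMul h x = x) ∨
    ∃ ξ, IsIdealPoint U ξ ∧ ¬ IsEndpoint l ξ ∧ HasNonattracting h ξ)}

/-- The circle of (Euclidean) radius `c` in `ℍ` centered at `0`; for suitable `c`
this is a geodesic line of `ℍ`. -/
def circ (c : ℝ) : Set ℍ := {z : ℍ | ‖(z : ℂ)‖ = c}

/-- The stem quadrant `SQ(ℓ)` for `ℓ = {|z| = 1/R}` transversely oriented towards `0`. -/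
def SQell (R : ℝ) : Set PSL2 :=
  {h | ∃ (A : SL2) (α β v : ℝ), (QuotientGroup.mk A : PSL2) = h ∧
    (A : Matrix (Fin 2) (Fin 2) ℝ) = !![α, -v/R; v*R, β] ∧
    |α| < |β| ∧ 2*|v| < |α - β|}

/-- The inverse stem quadrant `SQ(ℓ')⁻¹` for `ℓ' = {|z| = R}` transversely
oriented towards `∞`. -/
def SQell'inv (R : ℝ) : Set PSL2 :=
  {h | ∃ (A : SL2) (α β v : ℝ), (QuotientGroup.mk A : PSL2) = h ∧
    (A : Matrix (Fin 2) (Fin 2) ℝ) = !![α, v*R; -v/R, β] ∧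
    |α| < |β| ∧ 2*|v| < |α - β|}

/-- The stem quadrant `SQ(ℓ')`. -/
def SQell' (R : ℝ) : Set PSL2 := {h | h⁻¹ ∈ SQell'inv R}

set_option linter.unusedSectionVars false
set_option linter.unusedVariables false
namespace CK
section words
variable {α : Type*} [DecidableEq α]
open FreeGroup

/-- first letter of a reduced word -/
def hd (g : FreeGroup α) : Option (α × Bool) := (toWord g).head?

lemma toWord_mk_of_red {L : List (α × Bool)} (h : IsReduced L) : toWord (FreeGroup.mk L) = L := by
  rw [toWord_mk, h.reduce_eq]

lemma nc {u v : FreeGroup α} (h : hd u ≠ hd v) :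
    toWord (u⁻¹ * v) = toWord u⁻¹ ++ toWord v := by
  rw [toWord_mul]
  apply IsReduced.reduce_eq
  unfold FreeGroup.IsReduced
  rw [List.isChain_append]
  refine ⟨isReduced_toWord, isReduced_toWord, ?_⟩
  intro x hx y hy hxy
  by_contra hne
  apply h
  unfold hd
  rw [Option.mem_def] at hy
  rw [hy]
  rw [toWord_inv, Option.mem_def, invRev, List.getLast?_reverse, List.head?_map] at hx
  cases hu : (toWord u).head? with
  | none => simp [hu] at hx
  | some z =>
    simp only [hu, Option.map_some, Option.some.injEq] at hx
    subst hx
    congr 1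
    obtain ⟨z1, z2⟩ := z
    obtain ⟨y1, y2⟩ := y
    simp at hxy hne ⊢
    refine ⟨hxy, ?_⟩
    cases z2 <;> cases y2 <;> simp_all

lemma nc_norm {u v : FreeGroup α} (h : hd u ≠ hd v) :
    norm (u⁻¹ * v) = norm u + norm v := by
  have := congrArg List.length (nc h)
  rw [List.length_append] at this
  rw [← norm_inv_eq (x := u)]
  exact this

lemma hd_eq_none {g : FreeGroup α} : hd g = none ↔ g = 1 := by
  unfold hd; rw [List.head?_eq_none_iff, toWord_eq_nil_iff]

lemma conv {u v : FreeGroup α} (h : norm (u⁻¹ * v) = norm u + norm v) (hu : u ≠ 1) :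
    hd u ≠ hd v := by
  intro he
  cases h1 : toWord u with
  | nil => exact hu (toWord_eq_nil_iff.1 h1)
  | cons x L =>
    cases h2 : toWord v with
    | nil =>
      unfold hd at he
      rw [h1, h2] at he
      simp at he
    | cons y L' =>
      unfold hd at he
      rw [h1, h2] at he
      simp at he
      subst he
      have e1 : u = FreeGroup.mk [x] * FreeGroup.mk L := by
        rw [FreeGroup.mul_mk, ← mk_toWord (x := u), h1]; rfl
      have e2 : v = FreeGroup.mk [x] * FreeGroup.mk L' := by
        rw [FreeGroup.mul_mk, ← mk_toWord (x := v), h2]; rfl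
      have e3 : u⁻¹ * v = (FreeGroup.mk L)⁻¹ * FreeGroup.mk L' := by
        rw [e1, e2]; group
      have l1 := norm_mul_le (FreeGroup.mk L)⁻¹ (FreeGroup.mk L')
      rw [← e3, norm_inv_eq] at l1
      have l2 := norm_mk_le (L₁ := L)
      have l3 := norm_mk_le (L₁ := L')
      have l4 : norm u = L.length + 1 := by unfold FreeGroup.norm; rw [h1]; rfl
      have l5 : norm v = L'.length + 1 := by unfold FreeGroup.norm; rw [h2]; rfl
      omega

lemma hd_pow (g : FreeGroup α) (i : ℕ) : hd (g ^ (i+1)) = hd g := by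
  unfold hd
  rw [toWord_pow, FreeGroup.reduceCyclically.reduce_flatten_replicate_succ isReduced_toWord]
  conv_rhs => rw [← FreeGroup.reduceCyclically.conj_conjugator_reduceCyclically (toWord g)]
  set c := FreeGroup.reduceCyclically.conjugator (toWord g)
  set m := FreeGroup.reduceCyclically (toWord g)
  cases hc : c with
  | cons x t => simp
  | nil =>
    cases hm : m with
    | nil => simp [List.flatten_replicate_nil]
    | cons x t => simp [List.replicate_succ]

lemma finite_ball [Finite α] (k : ℕ) : {g : FreeGroup α | norm g ≤ k}.Finite := by
  have := (List.finite_length_le (α × Bool) k).preimage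
    (f := (toWord : FreeGroup α → _)) (toWord_injective.injOn)
  exact this

lemma norm_pow_tendsto [Finite α] {g : FreeGroup α} (hg : g ≠ 1) :
    Tendsto (fun i : ℕ => norm (g ^ i)) atTop atTop := by
  rw [tendsto_atTop]
  intro k
  have hinj : Function.Injective (fun i : ℕ => g ^ i) := by
    apply injective_pow_iff_not_isOfFinOrder.2
    exact not_isOfFinOrder_of_isMulTorsionFree hg
  have hf : {i : ℕ | norm (g ^ i) ≤ k}.Finite := (finite_ball k).preimage hinj.injOn
  obtain ⟨N, hN⟩ := hf.bddAbove
  filter_upwards [eventually_gt_atTop N] with i hi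
  by_contra hlt
  have := hN (show i ∈ {i : ℕ | norm (g ^ i) ≤ k} by simp; omega)
  omega

/-- an edge of the Cayley graph inside a set -/
def E (S : Set (FreeGroup α)) (x y : FreeGroup α) : Prop :=
  x ∈ S ∧ y ∈ S ∧ ∃ s : α × Bool, y = x * FreeGroup.mk [s]

lemma E_path (S : Set (FreeGroup α)) (g : FreeGroup α) (L : List (α × Bool))
    (h : ∀ i, g * FreeGroup.mk (L.take i) ∈ S) :
    Relation.ReflTransGen (E S) g (g * FreeGroup.mk L) := by
  induction L generalizing g with
  | nil => 
    rw [← FreeGroup.one_eq_mk, mul_one]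
  | cons x L ih =>
    have e : ∀ L' : List (α × Bool), FreeGroup.mk (x :: L') = FreeGroup.mk [x] * FreeGroup.mk L' := by
      intro L'; rw [FreeGroup.mul_mk]; rfl
    refine Relation.ReflTransGen.head (b := g * FreeGroup.mk [x]) ⟨?_, ?_, x, rfl⟩ ?_
    · have := h 0
      simpa [← FreeGroup.one_eq_mk] using this
    · have := h 1
      simpa using this
    · rw [e L, ← mul_assoc]
      apply ih
      intro i
      have := h (i+1)
      rwa [List.take_succ_cons, e, ← mul_assoc] at this

end words
end CK

namespace CK
section linalg

abbrev V := ℝ × ℝ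

def dt (p q : V) : ℝ := p.1 * q.2 - p.2 * q.1
def dp (p q : V) : ℝ := p.1 * q.1 + p.2 * q.2
def nn (p : V) : ℝ := p.1 ^ 2 + p.2 ^ 2
def nr (p : V) : ℝ := √ (nn p)
def sn (p q : V) : ℝ := |dt p q| / (nr p * nr q)
def act (A : SL2) (p : V) : V := (A.1 0 0 * p.1 + A.1 0 1 * p.2, A.1 1 0 * p.1 + A.1 1 1 * p.2)
def SS (A : SL2) : ℝ := A.1 0 0 ^ 2 + A.1 0 1 ^ 2 + A.1 1 0 ^ 2 + A.1 1 1 ^ 2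
def XX (p q r s : V) : ℝ := dt p r * dt p s * (dt q r * dt q s)

lemma det_eq (A : SL2) : A.1 0 0 * A.1 1 1 - A.1 0 1 * A.1 1 0 = 1 := by
  have := A.2
  rwa [Matrix.det_fin_two] at this

lemma mul00 (A B : SL2) : (A * B).1 0 0 = A.1 0 0 * B.1 0 0 + A.1 0 1 * B.1 1 0 := by
  simp [Matrix.mul_apply, Fin.sum_univ_two]
lemma mul01 (A B : SL2) : (A * B).1 0 1 = A.1 0 0 * B.1 0 1 + A.1 0 1 * B.1 1 1 := by
  simp [Matrix.mul_apply, Fin.sum_univ_two]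
lemma mul10 (A B : SL2) : (A * B).1 1 0 = A.1 1 0 * B.1 0 0 + A.1 1 1 * B.1 1 0 := by
  simp [Matrix.mul_apply, Fin.sum_univ_two]
lemma mul11 (A B : SL2) : (A * B).1 1 1 = A.1 1 0 * B.1 0 1 + A.1 1 1 * B.1 1 1 := by
  simp [Matrix.mul_apply, Fin.sum_univ_two]
lemma inv00 (A : SL2) : (A⁻¹).1 0 0 = A.1 1 1 := by
  simp [Matrix.SpecialLinearGroup.coe_inv, Matrix.adjugate_fin_two]
lemma inv01 (A : SL2) : (A⁻¹).1 0 1 = -A.1 0 1 := by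
  simp [Matrix.SpecialLinearGroup.coe_inv, Matrix.adjugate_fin_two]
lemma inv10 (A : SL2) : (A⁻¹).1 1 0 = -A.1 1 0 := by
  simp [Matrix.SpecialLinearGroup.coe_inv, Matrix.adjugate_fin_two]
lemma inv11 (A : SL2) : (A⁻¹).1 1 1 = A.1 0 0 := by
  simp [Matrix.SpecialLinearGroup.coe_inv, Matrix.adjugate_fin_two]

lemma act_mul (A B : SL2) (p : V) : act (A * B) p = act A (act B p) := by
  unfold act
  rw [mul00, mul01, mul10, mul11]
  ext <;> simp <;> ring

lemma act_one (p : V) : act 1 p = p := by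
  unfold act; ext <;> simp

lemma dt_act (A : SL2) (p q : V) : dt (act A p) (act A q) = dt p q := by
  have := det_eq A
  unfold dt act
  linear_combination (p.1 * q.2 - p.2 * q.1) * this

lemma XX_act (A : SL2) (p q r s : V) :
    XX (act A p) (act A q) (act A r) (act A s) = XX p q r s := by
  unfold XX; simp only [dt_act]

lemma dt_swap (p q : V) : dt p q = - dt q p := by unfold dt; ring
lemma dt_self (p : V) : dt p p = 0 := by unfold dt; ring

lemma XX_symm (p q r s : V) : XX p q r s = XX r s p q := by unfold XX dt; ring
lemma XX_swap (p q r s : V) : XX p q r s = XX p q s r := by unfold XX dt; ring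

lemma XX_trans {p q r s t : V} (h1 : 0 < XX p q r s) (h2 : 0 < XX p q s t) : 0 < XX p q r t := by
  have h : XX p q r s * XX p q s t = XX p q r t * (dt p s * dt q s) ^ 2 := by
    unfold XX; ring
  have h3 : 0 < XX p q r t * (dt p s * dt q s) ^ 2 := by rw [← h]; positivity
  exact pos_of_mul_pos_left h3 (sq_nonneg _)

lemma nn_nonneg (p : V) : 0 ≤ nn p := by unfold nn; positivity
lemma nr_nonneg (p : V) : 0 ≤ nr p := Real.sqrt_nonneg _
lemma nr_sq (p : V) : nr p ^ 2 = nn p := Real.sq_sqrt (nn_nonneg p)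
lemma nn_pos {p : V} (h : p ≠ 0) : 0 < nn p := by
  unfold nn
  by_contra hc
  have h1 : p.1 ^ 2 = 0 := by nlinarith [sq_nonneg p.1, sq_nonneg p.2]
  have h2 : p.2 ^ 2 = 0 := by nlinarith [sq_nonneg p.1, sq_nonneg p.2]
  apply h
  ext
  · simpa using h1
  · simpa using h2
lemma nr_pos {p : V} (h : p ≠ 0) : 0 < nr p := Real.sqrt_pos.2 (nn_pos h)
lemma lagrange (p q : V) : dt p q ^ 2 + dp p q ^ 2 = nn p * nn q := by
  unfold dt dp nn; ring
lemma abs_dt_le (p q : V) : |dt p q| ≤ nr p * nr q := by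
  apply abs_le_of_sq_le_sq _ (mul_nonneg (nr_nonneg p) (nr_nonneg q))
  rw [mul_pow, nr_sq, nr_sq, ← lagrange]; nlinarith [sq_nonneg (dp p q)]
lemma abs_dp_le (p q : V) : |dp p q| ≤ nr p * nr q := by
  apply abs_le_of_sq_le_sq _ (mul_nonneg (nr_nonneg p) (nr_nonneg q))
  rw [mul_pow, nr_sq, nr_sq, ← lagrange]; nlinarith [sq_nonneg (dt p q)]

lemma nn_smul (c : ℝ) (p : V) : nn (c • p) = c ^ 2 * nn p := by
  unfold nn; simp; ring
lemma nr_smul (c : ℝ) (p : V) : nr (c • p) = |c| * nr p := by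
  unfold nr; rw [nn_smul, Real.sqrt_mul (sq_nonneg c), Real.sqrt_sq_eq_abs]
lemma nr_add (p q : V) : nr (p + q) ≤ nr p + nr q := by
  unfold nr
  rw [Real.sqrt_le_left (by positivity)]
  have h := abs_dp_le p q
  have h' := le_abs_self (dp p q)
  have h1 := nr_sq p
  have h2 := nr_sq q
  unfold nr at *
  have : nn (p + q) = nn p + nn q + 2 * dp p q := by unfold nn dp; simp; ring
  rw [this]; nlinarith

lemma sn_nonneg (p q : V) : 0 ≤ sn p q :=
  div_nonneg (abs_nonneg _) (mul_nonneg (nr_nonneg p) (nr_nonneg q))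
lemma sn_comm (p q : V) : sn p q = sn q p := by
  unfold sn; rw [dt_swap, abs_neg, mul_comm]
lemma sn_self (p : V) : sn p p = 0 := by unfold sn; rw [dt_self]; simp

lemma sn_mul {p q : V} (hp : p ≠ 0) (hq : q ≠ 0) : |dt p q| = sn p q * (nr p * nr q) := by
  unfold sn
  have := nr_pos hp
  have := nr_pos hq
  field_simp

lemma sn_tri (x y : V) {z : V} (hx : x ≠ 0) (hy : y ≠ 0) (hz : z ≠ 0) :
    sn x y ≤ sn x z + sn z y := by
  have px := nr_pos hx
  have py := nr_pos hy
  have pz := nr_pos hz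
  have key : |dt x y| * nr z ≤ |dt z y| * nr x + |dt x z| * nr y := by
    rw [← nr_smul, ← nr_smul, ← nr_smul]
    have : dt x y • z = dt z y • x + dt x z • y := by
      unfold dt; ext <;> simp <;> ring
    rw [this]; exact nr_add _ _
  rw [sn_mul hx hy, sn_mul hz hy, sn_mul hx hz] at key
  have h3 : 0 < nr x * nr y * nr z := by positivity
  by_contra hc
  push Not at hc
  nlinarith [mul_lt_mul_of_pos_right hc h3]

lemma SS_pos (A : SL2) : 2 ≤ SS A := by
  have := det_eq A
  unfold SS
  nlinarith [sq_nonneg (A.1 0 0 - A.1 1 1), sq_nonneg (A.1 0 1 + A.1 1 0)]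

lemma SS_inv (A : SL2) : SS A⁻¹ = SS A := by
  unfold SS; rw [inv00, inv01, inv10, inv11]; ring

lemma SS_mul (A B : SL2) : SS (A * B) ≤ SS A * SS B := by
  unfold SS; rw [mul00, mul01, mul10, mul11]
  nlinarith [sq_nonneg (A.1 0 0 * B.1 1 0 - A.1 0 1 * B.1 0 0),
    sq_nonneg (A.1 0 0 * B.1 1 1 - A.1 0 1 * B.1 0 1),
    sq_nonneg (A.1 1 0 * B.1 1 0 - A.1 1 1 * B.1 0 0),
    sq_nonneg (A.1 1 0 * B.1 1 1 - A.1 1 1 * B.1 0 1)]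

lemma nn_act_le (A : SL2) (p : V) : nn (act A p) ≤ SS A * nn p := by
  unfold nn act SS
  simp only
  nlinarith [sq_nonneg (A.1 0 0 * p.2 - A.1 0 1 * p.1), sq_nonneg (A.1 1 0 * p.2 - A.1 1 1 * p.1)]

lemma act_inv_act (A : SL2) (p : V) : act A⁻¹ (act A p) = p := by
  rw [← act_mul, inv_mul_cancel, act_one]

lemma nn_le_act (A : SL2) (p : V) : nn p ≤ SS A * nn (act A p) := by
  have := nn_act_le A⁻¹ (act A p)
  rwa [act_inv_act, SS_inv] at this

lemma act_ne {A : SL2} {p : V} (hp : p ≠ 0) : act A p ≠ 0 := by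
  intro h
  apply hp
  rw [← act_inv_act A p, h]
  unfold act; ext <;> simp

lemma act_smul (A : SL2) (c : ℝ) (p : V) : act A (c • p) = c • act A p := by
  unfold act; ext <;> simp <;> ring

lemma sn_act (A : SL2) {p q : V} (hp : p ≠ 0) (hq : q ≠ 0) :
    sn (act A p) (act A q) ≤ SS A * sn p q := by
  have h1 := nr_pos hp
  have h2 := nr_pos hq
  have h3 := nr_pos (act_ne (A := A) hp)
  have h4 := nr_pos (act_ne (A := A) hq)
  have hS := SS_pos A
  unfold sn
  rw [dt_act, ← mul_div_assoc, div_le_div_iff₀ (by positivity) (by positivity)]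
  have key : nr p * nr q ≤ SS A * (nr (act A p) * nr (act A q)) := by
    apply abs_le_of_sq_le_sq' _ (by positivity) |>.2
    rw [mul_pow, mul_pow, mul_pow, nr_sq, nr_sq, nr_sq, nr_sq]
    have := mul_le_mul (nn_le_act A p) (nn_le_act A q) (nn_nonneg q)
      (mul_nonneg (by linarith) (nn_nonneg _))
    nlinarith
  have := mul_le_mul_of_nonneg_left key (abs_nonneg (dt p q))
  linarith

/-- sign stability -/
lemma sign_stab {x y z : V} (h0 : 0 < dp x y)
    (h : |dt x y| * |dp z x| < dp x y * |dt z x|) : 0 < dt z y * dt z x := by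
  have id : nn x * dt z y = dp x y * dt z x + dt x y * dp z x := by
    unfold nn dt dp; ring
  have hx : 0 < nn x := by
    apply nn_pos; rintro rfl; simp [dp] at h0
  have h1 : |dt x y * dp z x| < |dp x y * dt z x| := by
    rw [abs_mul, abs_mul, abs_of_pos h0]; exact h
  have hp : 0 < nn x * (dt z y * dt z x) := by
    have : nn x * (dt z y * dt z x) = (dp x y * dt z x + dt x y * dp z x) * dt z x := by
      rw [← id]; ring
    rw [this]
    rcases lt_trichotomy (dt z x) 0 with h2 | h2 | h2
    · have : dp x y * dt z x < 0 := mul_neg_of_pos_of_neg h0 h2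
      rw [abs_of_neg this] at h1
      have := (abs_lt.1 h1).2
      apply mul_pos_of_neg_of_neg _ h2
      linarith
    · rw [h2] at h1; simp at h1
      exact absurd h1 (not_lt.2 (by positivity))
    · have : 0 < dp x y * dt z x := mul_pos h0 h2
      rw [abs_of_pos this] at h1
      have := (abs_lt.1 h1).1
      apply mul_pos _ h2
      linarith
  exact pos_of_mul_pos_right hp hx.le

end linalg
end CK

namespace CK
section Msec
variable {r : ℕ} (A : FreeGroup (Fin r) →* SL2)

def pe (g : FreeGroup (Fin r)) : V := act (A g) (1, 0)
def qe (g : FreeGroup (Fin r)) : V := act (A g) (0, 1)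
/-- the longer column -/
def lc (g : FreeGroup (Fin r)) : V := if nn (qe A g) ≤ nn (pe A g) then pe A g else qe A g

lemma pe_eq (g) : pe A g = ((A g).1 0 0, (A g).1 1 0) := by unfold pe act; simp
lemma qe_eq (g) : qe A g = ((A g).1 0 1, (A g).1 1 1) := by unfold qe act; simp
lemma pe_mul (g h) : pe A (g * h) = act (A g) (pe A h) := by unfold pe; rw [map_mul, act_mul]
lemma qe_mul (g h) : qe A (g * h) = act (A g) (qe A h) := by unfold qe; rw [map_mul, act_mul]
lemma pe_ne (g) : pe A g ≠ 0 := act_ne (by simp [Prod.ext_iff])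
lemma qe_ne (g) : qe A g ≠ 0 := act_ne (by simp [Prod.ext_iff])
lemma lc_ne (g) : lc A g ≠ 0 := by
  unfold lc; split_ifs
  · exact pe_ne A g
  · exact qe_ne A g
lemma SS_eq (g) : SS (A g) = nn (pe A g) + nn (qe A g) := by
  rw [pe_eq, qe_eq]; unfold SS nn; simp only; ring
lemma dt_pq (g) : dt (pe A g) (qe A g) = 1 := by
  unfold pe qe; rw [dt_act]; simp [dt]
lemma pe_one : pe A 1 = (1, 0) := by unfold pe; rw [map_one, act_one]
lemma nn_lc (g) : SS (A g) / 2 ≤ nn (lc A g) := by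
  rw [SS_eq]; unfold lc; split_ifs with h <;> linarith

lemma sn_pe_lc (g) : sn (pe A g) (lc A g) ≤ 1 / (nr (pe A g) * nr (qe A g)) := by
  have h1 := nr_pos (pe_ne A g)
  have h2 := nr_pos (qe_ne A g)
  unfold lc; split_ifs with h
  · rw [sn_self]; positivity
  · unfold sn; rw [dt_pq]; simp

lemma dt_cols (g h : FreeGroup (Fin r)) (p q : V) :
    dt (act (A g) p) (act (A h) q) = dt p (act (A (g⁻¹ * h)) q) := by
  rw [← dt_act (A g) p, ← act_mul, ← map_mul, mul_inv_cancel_left]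

lemma dt_lc_sq (g h) : dt (lc A g) (lc A h) ^ 2 ≤ SS (A (g⁻¹ * h)) := by
  have aux : ∀ p q : V, (p = (1,0) ∨ p = (0,1)) → (q = (1,0) ∨ q = (0,1)) →
      dt (act (A g) p) (act (A h) q) ^ 2 ≤ SS (A (g⁻¹ * h)) := by
    intro p q hp hq
    rw [dt_cols]
    unfold SS
    generalize (A (g⁻¹ * h)) = B
    rcases hp with rfl | rfl <;> rcases hq with rfl | rfl <;> simp [dt, act] <;> nlinarith [sq_nonneg (B.1 0 0), sq_nonneg (B.1 0 1), sq_nonneg (B.1 1 0), sq_nonneg (B.1 1 1)]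
  unfold lc
  split_ifs <;> exact aux _ _ (by simp) (by simp)

lemma sn_lc_sq (g h) : sn (lc A g) (lc A h) ^ 2 ≤ 4 * SS (A (g⁻¹ * h)) / (SS (A g) * SS (A h)) := by
  have h1 := SS_pos (A g)
  have h2 := SS_pos (A h)
  have h3 := nn_lc A g
  have h4 := nn_lc A h
  unfold sn
  rw [div_pow, sq_abs, mul_pow, nr_sq, nr_sq]
  rw [div_le_div_iff₀ (mul_pos (by linarith) (by linarith)) (mul_pos (by linarith) (by linarith))]
  have h5 := dt_lc_sq A g h
  have h6 : SS (A g) * SS (A h) ≤ 4 * (nn (lc A g) * nn (lc A h)) := by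
    have := mul_le_mul h3 h4 (by linarith) (by linarith)
    linarith
  have h7 := SS_pos (A (g⁻¹ * h))
  calc dt (lc A g) (lc A h) ^ 2 * (SS (A g) * SS (A h))
      ≤ SS (A (g⁻¹ * h)) * (SS (A g) * SS (A h)) := by
        apply mul_le_mul_of_nonneg_right h5; nlinarith
    _ ≤ SS (A (g⁻¹ * h)) * (4 * (nn (lc A g) * nn (lc A h))) := by
        apply mul_le_mul_of_nonneg_left h6; linarith
    _ = _ := by ring

/-- The three hypotheses. -/
structure Hyp : Prop where
  h2 : ∀ g, g ≠ 1 → 0 < (A g).1 0 0 * (A g).1 0 1 * ((A g).1 1 0 * (A g).1 1 1)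
  h3 : ∀ C : ℝ, {g | nn (pe A g) * nn (qe A g) ≤ C}.Finite
  h4 : ∀ g, g ≠ 1 → ((A g).1 0 0 + (A g).1 1 1) ^ 2 ≠ 4

variable {A}

lemma Hyp.dt_ne (H : Hyp A) {g h : FreeGroup (Fin r)} (hgh : g ≠ h) : dt (pe A g) (pe A h) ≠ 0 := by
  unfold pe
  rw [dt_cols]
  have h1 : g⁻¹ * h ≠ 1 := by rwa [ne_eq, inv_mul_eq_one]
  have h2 := H.h2 _ h1
  generalize A (g⁻¹ * h) = B at *
  simp [dt, act]
  intro h0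
  rw [h0] at h2; simp at h2

lemma nr_mul_gt {g : FreeGroup (Fin r)} {R : ℝ} (hR : 0 ≤ R) (h : ¬ nn (pe A g) * nn (qe A g) ≤ R ^ 2) :
    R < nr (pe A g) * nr (qe A g) := by
  push Not at h
  rw [← nr_sq, ← nr_sq, ← mul_pow] at h
  exact lt_of_pow_lt_pow_left₀ 2 (mul_nonneg (nr_nonneg _) (nr_nonneg _)) h

lemma Hyp.sn_pe_t (H : Hyp A) (t : FreeGroup (Fin r)) {η : ℝ} (hη : 0 < η) :
    {g | η ≤ sn (pe A g) (pe A (g * t))}.Finite := by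
  obtain ⟨K, hK⟩ : ∃ K : ℝ, K = √(SS (A t)) := ⟨_, rfl⟩
  have hK0 : 0 ≤ K := by rw [hK]; positivity
  have hK2 : K ^ 2 = SS (A t) := by rw [hK]; exact Real.sq_sqrt (by linarith [SS_pos (A t)])
  set R : ℝ := (2 + K) / η + 1 with hR
  have hR0 : 0 < R := by positivity
  have f1 := H.h3 (R ^ 2)
  have f2 : {g | nn (pe A (g * t)) * nn (qe A (g * t)) ≤ R ^ 2}.Finite :=
    f1.preimage (f := fun g => g * t) ((mul_left_injective t).injOn)
  apply (f1.union f2).subset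
  intro g hg
  by_contra hc
  rw [Set.mem_union, not_or] at hc
  have g1 := nr_mul_gt (A := A) hR0.le hc.1
  have g2 := nr_mul_gt (A := A) (g := g * t) hR0.le hc.2
  have hSS : ∀ x, R < nr (pe A x) * nr (qe A x) → 2 * R ≤ SS (A x) := by
    intro x hx
    rw [SS_eq, ← nr_sq, ← nr_sq]
    nlinarith [sq_nonneg (nr (pe A x) - nr (qe A x))]
  have s1 : sn (pe A g) (lc A g) ≤ 1 / R :=
    (sn_pe_lc A g).trans (one_div_le_one_div_of_le hR0 g1.le)
  have s2 : sn (lc A (g*t)) (pe A (g*t)) ≤ 1 / R := by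
    rw [sn_comm]
    exact (sn_pe_lc A _).trans (one_div_le_one_div_of_le hR0 g2.le)
  have s3 : sn (lc A g) (lc A (g*t)) ≤ K / R := by
    apply abs_le_of_sq_le_sq' _ (by positivity) |>.2
    refine (sn_lc_sq A g (g*t)).trans ?_
    rw [inv_mul_cancel_left, ← hK2, div_pow, div_le_div_iff₀ _ (by positivity)]
    · have h1 := mul_le_mul (hSS _ g1) (hSS _ g2) (by positivity) (by linarith [SS_pos (A g)])
      have := mul_le_mul_of_nonneg_left h1 (sq_nonneg K)
      nlinarith
    · exact mul_pos (by linarith [SS_pos (A g)]) (by linarith [SS_pos (A (g * t))])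
  have t1 := sn_tri (pe A g) (pe A (g*t)) (pe_ne A _) (pe_ne A _) (lc_ne A g)
  have t2 := sn_tri (lc A g) (pe A (g*t)) (lc_ne A _) (pe_ne A _) (lc_ne A (g*t))
  have hg' : η ≤ sn (pe A g) (pe A (g * t)) := hg
  have : η ≤ (2 + K) / R := by
    have : (2 + K) / R = 1 / R + (K / R + 1 / R) := by ring
    linarith
  rw [le_div_iff₀ hR0] at this
  have h5 : η * R = 2 + K + η := by rw [hR]; field_simp
  linarith


lemma cross_core {a b c d U V W τ : ℝ} (hdet : a * d - b * c = 1) (hUV : U * V - W ^ 2 = 1)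
    (hU : 0 < U) (hV : 0 < V) (h0 : 0 ≤ τ) (h1 : τ ≤ 1)
    (hz : (1 - τ) * (a * c + b * d) + τ * (a * c * U + (a * d + b * c) * W + b * d * V) = 0) :
    (a ^ 2 + b ^ 2) * (c ^ 2 + d ^ 2) ≤ (2 + U + V) ^ 4 := by
  obtain ⟨u, hu⟩ : ∃ u, u = (1 - τ) + τ * U := ⟨_, rfl⟩
  obtain ⟨v, hv⟩ : ∃ v, v = (1 - τ) + τ * V := ⟨_, rfl⟩
  obtain ⟨w, hw⟩ : ∃ w, w = τ * W := ⟨_, rfl⟩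
  have hbil : a * c * u + (a * d + b * c) * w + b * d * v = 0 := by
    rw [hu, hv, hw]; linear_combination hz
  have hUV2 : 2 ≤ U + V := by nlinarith [sq_nonneg (U - V), sq_nonneg W]
  have hΔ : 1 ≤ u * v - w ^ 2 := by
    have : u * v - w ^ 2 - 1 = τ * (1 - τ) * (U + V - 2) := by
      rw [hu, hv, hw]; linear_combination τ ^ 2 * hUV
    have : 0 ≤ τ * (1 - τ) * (U + V - 2) :=
      mul_nonneg (mul_nonneg h0 (by linarith)) (by linarith)
    linarith
  have hu0 : 0 ≤ u := by rw [hu]; nlinarith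
  have hv0 : 0 ≤ v := by rw [hv]; nlinarith
  have huv : u + v ≤ 2 + U + V := by rw [hu, hv]; nlinarith
  obtain ⟨Δ, hD⟩ : ∃ D, D = u * v - w ^ 2 := ⟨_, rfl⟩
  rw [← hD] at hΔ
  obtain ⟨f, hf⟩ : ∃ f, f = a ^ 2 * u + 2 * a * b * w + b ^ 2 * v := ⟨_, rfl⟩
  obtain ⟨g, hg⟩ : ∃ g, g = c ^ 2 * u + 2 * c * d * w + d ^ 2 * v := ⟨_, rfl⟩
  have hfg : f * g = Δ := by
    have e : f * g - (a * c * u + (a * d + b * c) * w + b * d * v) ^ 2 = Δ * (a * d - b * c) ^ 2 := by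
      rw [hf, hg, hD]; ring
    rw [hbil, hdet] at e; linarith
  have l1 : Δ * (a ^ 2 + b ^ 2) ≤ (u + v) * f := by
    have : (u + v) * f - Δ * (a ^ 2 + b ^ 2) = (a * u + b * w) ^ 2 + (a * w + b * v) ^ 2 := by
      rw [hf, hD]; ring
    nlinarith [sq_nonneg (a * u + b * w), sq_nonneg (a * w + b * v)]
  have l2 : Δ * (c ^ 2 + d ^ 2) ≤ (u + v) * g := by
    have : (u + v) * g - Δ * (c ^ 2 + d ^ 2) = (c * u + d * w) ^ 2 + (c * w + d * v) ^ 2 := by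
      rw [hg, hD]; ring
    nlinarith [sq_nonneg (c * u + d * w), sq_nonneg (c * w + d * v)]
  have l3 := mul_le_mul l1 l2 (mul_nonneg (by linarith) (by positivity))
    (le_trans (mul_nonneg (by linarith) (by positivity)) l1)
  have l4 : Δ * ((a ^ 2 + b ^ 2) * (c ^ 2 + d ^ 2)) ≤ (u + v) ^ 2 := by
    have : Δ * (Δ * ((a ^ 2 + b ^ 2) * (c ^ 2 + d ^ 2))) ≤ Δ * (u + v) ^ 2 := by
      have e : (u + v) * f * ((u + v) * g) = Δ * (u + v) ^ 2 := by rw [← hfg]; ring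
      linarith
    exact le_of_mul_le_mul_left this (by linarith)
  have l5 : (a ^ 2 + b ^ 2) * (c ^ 2 + d ^ 2) ≤ Δ * ((a ^ 2 + b ^ 2) * (c ^ 2 + d ^ 2)) :=
    le_mul_of_one_le_left (by positivity) hΔ
  have l6 : (u + v) ^ 2 ≤ (2 + U + V) ^ 2 := pow_le_pow_left₀ (by linarith) huv 2
  have l7 : (2 + U + V) ^ 2 ≤ (2 + U + V) ^ 4 := pow_le_pow_right₀ (by linarith) (by norm_num)
  linarith

lemma cross_tau {f0 f1 : ℝ} (h : f0 * f1 < 0) :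
    ∃ τ, 0 ≤ τ ∧ τ ≤ 1 ∧ (1 - τ) * f0 + τ * f1 = 0 := by
  rcases lt_trichotomy f0 0 with h0 | h0 | h0
  · have h1 : 0 < f1 := by by_contra hc; nlinarith
    refine ⟨f0 / (f0 - f1), div_nonneg_of_nonpos h0.le (by linarith), ?_, ?_⟩
    · rw [div_le_one_of_neg (by linarith)]; linarith
    · have : f0 - f1 ≠ 0 := by linarith
      field_simp; ring
  · simp [h0] at h
  · have h1 : f1 < 0 := by by_contra hc; nlinarith
    refine ⟨f0 / (f0 - f1), div_nonneg h0.le (by linarith), ?_, ?_⟩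
    · rw [div_le_one (by linarith)]; linarith
    · have : f0 - f1 ≠ 0 := by linarith
      field_simp; ring

lemma same_sign {a b c d : ℝ} (h : 0 < a * b * (c * d)) : 0 < (a * c) * (b * d) := by
  nlinarith

lemma opp_sum {x y x' y' : ℝ} (h : 0 < x * y) (h' : 0 < x' * y') (hx : x * x' < 0) :
    (x + y) * (x' + y') < 0 := by
  rcases lt_trichotomy x 0 with h0 | h0 | h0
  · have hy : y < 0 := by by_contra hc; nlinarith
    have hx' : 0 < x' := by by_contra hc; nlinarith
    have hy' : 0 < y' := by by_contra hc; nlinarith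
    nlinarith
  · simp [h0] at h
  · have hy : 0 < y := by by_contra hc; nlinarith
    have hx' : x' < 0 := by by_contra hc; nlinarith
    have hy' : y' < 0 := by by_contra hc; nlinarith
    nlinarith

lemma Hyp.F1 (H : Hyp A) (t : FreeGroup (Fin r)) :
    {g | XX (1, 0) (0, 1) (pe A g) (pe A (g * t)) < 0}.Finite := by
  set U := (A t).1 0 0 ^ 2 + (A t).1 0 1 ^ 2 with hU
  set V' := (A t).1 1 0 ^ 2 + (A t).1 1 1 ^ 2 with hV
  have f1 := (H.h3 ((2 + U + V') ^ 4)).preimage (f := fun g => g⁻¹) inv_injective.injOn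
  apply f1.subset
  intro g hg
  have hg' : XX (1, 0) (0, 1) (pe A g) (pe A (g * t)) < 0 := hg
  have g1 : g ≠ 1 := by
    rintro rfl
    rw [pe_one] at hg'
    simp [XX, dt] at hg'
  have g2 : g * t ≠ 1 := by
    intro h
    rw [h, pe_one] at hg'
    simp [XX, dt] at hg'
  have e1 := same_sign (H.h2 g g1)
  have e2 := same_sign (H.h2 _ g2)
  have hg3 : ((A g).1 0 0 * (A g).1 1 0) * ((A (g*t)).1 0 0 * (A (g*t)).1 1 0) < 0 := by
    rw [pe_eq, pe_eq] at hg'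
    simp only [XX, dt] at hg'
    nlinarith
  have e3 := opp_sum e1 e2 hg3
  obtain ⟨τ, h0, h1, hz⟩ := cross_tau e3
  have hd1 := det_eq (A g)
  have hd2 := det_eq (A t)
  have := cross_core (a := (A g).1 0 0) (b := (A g).1 0 1) (c := (A g).1 1 0) (d := (A g).1 1 1)
    (U := U) (V := V') (W := (A t).1 0 0 * (A t).1 1 0 + (A t).1 0 1 * (A t).1 1 1) (τ := τ)
    hd1 ?_ ?_ ?_ h0 h1 ?_
  · simp only [Set.mem_preimage, Set.mem_ofPred_eq]
    rw [pe_eq, qe_eq, map_inv, inv00, inv01, inv10, inv11]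
    simp only [nn]
    linarith
  · rw [hU, hV]; linear_combination ((A t).1 0 0 * (A t).1 1 1 - (A t).1 0 1 * (A t).1 1 0 + 1) * hd2
  · rw [hU]
    by_contra hc
    have q1 : (A t).1 0 0 = 0 := by nlinarith [sq_nonneg ((A t).1 0 0), sq_nonneg ((A t).1 0 1)]
    have q2 : (A t).1 0 1 = 0 := by nlinarith [sq_nonneg ((A t).1 0 0), sq_nonneg ((A t).1 0 1)]
    rw [q1, q2] at hd2; simp at hd2
  · rw [hV]
    by_contra hc
    have q1 : (A t).1 1 0 = 0 := by nlinarith [sq_nonneg ((A t).1 1 0), sq_nonneg ((A t).1 1 1)]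
    have q2 : (A t).1 1 1 = 0 := by nlinarith [sq_nonneg ((A t).1 1 0), sq_nonneg ((A t).1 1 1)]
    rw [q1, q2] at hd2; simp at hd2
  · rw [map_mul, mul00, mul01, mul10, mul11] at hz
    rw [hU, hV]
    linear_combination hz

lemma pos_dot {B : SL2} {x y : V} (h : 0 < dp x y) (h' : |dt x y| * SS B ^ 2 < dp x y) :
    0 < dp (act B x) (act B y) := by
  have hx0 : x ≠ 0 := by rintro rfl; simp [dp] at h
  have hx := nn_pos hx0
  have hS := SS_pos B
  set z : V := (-x.2, x.1) with hz
  have hnz : nn z = nn x := by unfold nn; simp [hz]; ring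
  have id : nn x * dp (act B x) (act B y) =
      dp x y * nn (act B x) + dt x y * dp (act B x) (act B z) := by
    unfold nn dp dt act; simp [hz]; ring
  have b1 : |dp (act B x) (act B z)| ≤ SS B * nn x := by
    refine (abs_dp_le _ _).trans ?_
    apply abs_le_of_sq_le_sq' _ (by positivity) |>.2
    rw [mul_pow, nr_sq, nr_sq]
    have := mul_le_mul (nn_act_le B x) (nn_act_le B z) (nn_nonneg _) (by positivity)
    rw [hnz] at this
    nlinarith
  have b2 := nn_le_act B x
  have b3 : -(|dt x y| * (SS B * nn x)) ≤ dt x y * dp (act B x) (act B z) := by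
    have := neg_abs_le (dt x y * dp (act B x) (act B z))
    rw [abs_mul] at this
    have := mul_le_mul_of_nonneg_left b1 (abs_nonneg (dt x y))
    linarith
  have key : 0 < SS B * (nn x * dp (act B x) (act B y)) := by
    rw [id]
    have c1 := mul_le_mul_of_nonneg_left b2 h.le
    have c2 := mul_le_mul_of_nonneg_left b3 (by linarith : 0 ≤ SS B)
    have c3 := mul_lt_mul_of_pos_right h' hx
    nlinarith
  have := pos_of_mul_pos_right key (by linarith)
  exact pos_of_mul_pos_right this hx.le

lemma XX_e {x y : V} (h : 0 < dp x y) (h2 : dt (1,0) x * dt (1,0) y < 0) :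
    XX (1,0) (0,1) x y < 0 := by
  simp only [XX, dt, dp] at *
  have : 0 < x.1 * y.1 := by nlinarith
  nlinarith

lemma XX_neg_right (p q r s : V) : XX p q r (-s) = XX p q r s := by
  simp only [XX, dt, Prod.fst_neg, Prod.snd_neg]; ring

lemma Hyp.FC (H : Hyp A) (s t : FreeGroup (Fin r)) (hs : s ≠ 1) (ht : t ≠ 1) :
    {g | ¬ 0 < XX (pe A 1) (pe A s) (pe A g) (pe A (g * t))}.Finite := by
  set Q := SS (A s⁻¹) ^ 2 with hQ
  have hQ0 : 0 < Q := by have := SS_pos (A s⁻¹); positivity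
  have f0 : ({1, s, t⁻¹, s * t⁻¹} : Set (FreeGroup (Fin r))).Finite := by simp
  have f1 := H.sn_pe_t t (η := 1 / (Q + 1)) (by positivity)
  have f2 := H.F1 t
  have f3 := f2.preimage (f := fun g => s⁻¹ * g) (mul_right_injective _).injOn
  apply (((f0.union f1).union f2).union f3).subset
  intro g hg
  by_contra hc
  simp only [Set.mem_union, not_or] at hc
  obtain ⟨⟨⟨c0, c1⟩, c2⟩, c3⟩ := hc
  simp only [Set.mem_insert_iff, Set.mem_singleton_iff, not_or] at c0
  obtain ⟨n1, n2, n3, n4⟩ := c0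
  have hlt : XX (pe A 1) (pe A s) (pe A g) (pe A (g * t)) < 0 := by
    have hg' : ¬ 0 < XX (pe A 1) (pe A s) (pe A g) (pe A (g * t)) := hg
    apply lt_of_le_of_ne (not_lt.1 hg')
    unfold XX
    refine mul_ne_zero (mul_ne_zero ?_ ?_) (mul_ne_zero ?_ ?_) <;> apply H.dt_ne
    · exact Ne.symm n1
    · intro h; exact n3 (eq_inv_of_mul_eq_one_left h.symm)
    · exact Ne.symm n2
    · intro h; exact n4 (eq_mul_inv_of_mul_eq h.symm)
  have c1' : sn (pe A g) (pe A (g * t)) < 1 / (Q + 1) := not_le.1 c1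
  have hx := pe_ne A g
  have hy := pe_ne A (g * t)
  have hdt : |dt (pe A g) (pe A (g*t))| * Q < |dp (pe A g) (pe A (g*t))| := by
    have px := nr_pos hx
    have py := nr_pos hy
    unfold sn at c1'
    rw [div_lt_div_iff₀ (by positivity) (by positivity)] at c1'
    have hl := lagrange (pe A g) (pe A (g*t))
    apply abs_lt_of_sq_lt_sq' _ (abs_nonneg _) |>.2
    rw [mul_pow, sq_abs, sq_abs]
    have c4 : (|dt (pe A g) (pe A (g*t))| * (Q + 1)) ^ 2 < (1 * (nr (pe A g) * nr (pe A (g*t)))) ^ 2 :=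
      pow_lt_pow_left₀ c1' (by positivity) (by norm_num)
    rw [one_mul, mul_pow, mul_pow, nr_sq, nr_sq, sq_abs, ← hl] at c4
    nlinarith [sq_nonneg (dt (pe A g) (pe A (g*t)))]
  -- general core
  have core : ∀ y : V, (y = pe A (g*t) ∨ y = - pe A (g*t)) → 0 < dp (pe A g) y → False := by
    intro y hy0 hpos
    have hXy : ∀ p q r : V, XX p q r y = XX p q r (pe A (g*t)) := by
      intro p q r
      rcases hy0 with rfl | rfl
      · rfl
      · rw [XX_neg_right]
    have hXy' : ∀ p q r : V, XX p q r (act (A s⁻¹) y) = XX p q r (pe A (s⁻¹ * (g * t))) := by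
      intro p q r
      rw [pe_mul]
      rcases hy0 with rfl | rfl
      · rfl
      · rw [← XX_neg_right]
        congr 1
        unfold act; ext <;> simp <;> ring
    have hdt' : |dt (pe A g) y| * Q < dp (pe A g) y := by
      rcases hy0 with rfl | rfl
      · rwa [abs_of_pos hpos] at hdt
      · have e1 : dt (pe A g) (-pe A (g*t)) = - dt (pe A g) (pe A (g*t)) := by simp [dt]; ring
        have e2 : dp (pe A g) (-pe A (g*t)) = - dp (pe A g) (pe A (g*t)) := by simp [dp]; ring
        rw [e1, e2, abs_neg]
        rw [e2] at hpos
        rwa [abs_of_neg (a := dp (pe A g) (pe A (g*t))) (by linarith)] at hdt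
    have hpos' := pos_dot (B := A s⁻¹) hpos hdt'
    rw [← hXy] at hlt
    have hX : XX (pe A 1) (pe A s) (pe A g) y = (dt (1,0) (pe A g) * dt (1,0) y) *
        (dt (1,0) (act (A s⁻¹) (pe A g)) * dt (1,0) (act (A s⁻¹) y)) := by
      have e : ∀ z, dt (pe A s) z = dt (1,0) (act (A s⁻¹) z) := by
        intro z
        rw [← dt_act (A s⁻¹) (pe A s) z, ← pe_mul, inv_mul_cancel, pe_one]
      unfold XX
      rw [pe_one, e, e]
    rw [hX] at hlt
    rcases mul_neg_iff.1 hlt with ⟨_, hh⟩ | ⟨hh, _⟩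
    · apply c3
      have := XX_e hpos' hh
      rw [hXy', ← pe_mul] at this
      simpa [mul_assoc] using this
    · apply c2
      have := XX_e hpos hh
      rwa [hXy] at this
  have hdp0 : dp (pe A g) (pe A (g*t)) ≠ 0 := by
    intro h0
    rw [h0, abs_zero] at hdt
    have := mul_nonneg (abs_nonneg (dt (pe A g) (pe A (g*t)))) hQ0.le
    linarith
  rcases lt_or_gt_of_ne hdp0 with h | h
  · apply core _ (Or.inr rfl)
    have e2 : dp (pe A g) (-pe A (g*t)) = - dp (pe A g) (pe A (g*t)) := by simp [dp]; ring
    rw [e2]; linarith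
  · exact core _ (Or.inl rfl) h

lemma mk_single_ne (s : Fin r × Bool) : FreeGroup.mk [s] ≠ 1 := by
  intro h
  have := congrArg FreeGroup.norm h
  rw [FreeGroup.norm_one] at this
  unfold FreeGroup.norm at this
  rw [toWord_mk_of_red FreeGroup.IsReduced.singleton] at this
  simp at this

/-- uniform separation constant -/
lemma Hyp.k0 (H : Hyp A) : ∃ k0 : ℕ, ∀ (s t : Fin r × Bool) (x y : FreeGroup (Fin r)),
    k0 < FreeGroup.norm (x⁻¹ * y) →
    0 < XX (pe A x) (pe A (x * FreeGroup.mk [s])) (pe A y) (pe A (y * FreeGroup.mk [t])) := by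
  have hf : (⋃ p : (Fin r × Bool) × (Fin r × Bool),
      {g | ¬ 0 < XX (pe A 1) (pe A (FreeGroup.mk [p.1])) (pe A g) (pe A (g * FreeGroup.mk [p.2]))}).Finite :=
    Set.finite_iUnion fun p => H.FC _ _ (mk_single_ne _) (mk_single_ne _)
  obtain ⟨k, hk⟩ := (hf.image FreeGroup.norm).bddAbove
  refine ⟨k, fun s t x y hxy => ?_⟩
  have : 0 < XX (pe A 1) (pe A (FreeGroup.mk [s])) (pe A (x⁻¹ * y)) (pe A ((x⁻¹ * y) * FreeGroup.mk [t])) := by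
    by_contra hc
    have := hk (Set.mem_image_of_mem _ (Set.mem_iUnion.2 ⟨(s, t), hc⟩))
    omega
  rw [← XX_act (A x), ← pe_mul, ← pe_mul, ← pe_mul, ← pe_mul] at this
  simpa [mul_assoc] using this

/-- chord lemma -/
lemma Hyp.chord (H : Hyp A) {k0 : ℕ} (hk : ∀ (s t : Fin r × Bool) (x y : FreeGroup (Fin r)),
    k0 < FreeGroup.norm (x⁻¹ * y) →
    0 < XX (pe A x) (pe A (x * FreeGroup.mk [s])) (pe A y) (pe A (y * FreeGroup.mk [t])))
    {SX SY : Set (FreeGroup (Fin r))} (hS : ∀ x ∈ SX, ∀ y ∈ SY, k0 < FreeGroup.norm (x⁻¹ * y))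
    {x x' y y' : FreeGroup (Fin r)} (hx : x ∈ SX) (hy : y ∈ SY)
    (px : Relation.ReflTransGen (E SX) x x')
    (py : Relation.ReflTransGen (E SY) y y') :
    0 < XX (pe A x) (pe A x') (pe A y) (pe A y') := by
  have hne : ∀ x ∈ SX, ∀ y ∈ SY, dt (pe A x) (pe A y) ≠ 0 := by
    intro x hx y hy
    apply H.dt_ne
    rintro rfl
    have := hS x hx x hy
    simp at this
  have hne' : ∀ x ∈ SX, ∀ y ∈ SY, dt (pe A y) (pe A x) ≠ 0 := by
    intro x hx y hy h
    rw [dt_swap] at h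
    exact hne x hx y hy (by linarith)
  have s1 : ∀ a b, E SX a b → 0 < XX (pe A a) (pe A b) (pe A y) (pe A y') := by
    rintro a b ⟨ha, hb, s, rfl⟩
    induction py with
    | refl =>
      have h1 := hne _ ha _ hy
      have h2 := hne _ hb _ hy
      unfold XX
      have e : ∀ u v : ℝ, u * u * (v * v) = (u * v) ^ 2 := by intros; ring
      rw [e]; positivity
    | tail _ hE ih =>
      obtain ⟨hc, _, t, rfl⟩ := hE
      exact XX_trans ih (hk s t _ _ (hS _ ha _ hc))
  have hy' : y' ∈ SY := by
    rcases Relation.ReflTransGen.cases_tail py with h | ⟨c, _, h⟩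
    · rwa [h]
    · exact h.2.1
  induction px with
  | refl =>
    have h1 := hne _ hx _ hy
    have h2 := hne _ hx _ hy'
    unfold XX
    have e : ∀ u v : ℝ, u * v * (u * v) = (u * v) ^ 2 := by intros; ring
    rw [e]; positivity
  | tail _ hE ih =>
    have := s1 _ _ hE
    rw [XX_symm] at this ih ⊢
    exact XX_trans ih this

end Msec
end CK

namespace CK
section Msec2
variable {r : ℕ} {A : FreeGroup (Fin r) →* SL2}

lemma E_symm {α : Type*} (S : Set (FreeGroup α)) {x y : FreeGroup α}
    (h : Relation.ReflTransGen (E S) x y) : Relation.ReflTransGen (E S) y x := by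
  have hs : Std.Symm (E S) := ⟨?_⟩
  · exact (Relation.ReflTransGen.stdSymm (r := E S)).symm _ _ h
  rintro x y ⟨hx, hy, s, rfl⟩
  refine ⟨hy, hx, (s.1, !s.2), ?_⟩
  have : FreeGroup.mk [s] * FreeGroup.mk [(s.1, !s.2)] = 1 := by
    have h : FreeGroup.mk [(s.1, !s.2)] = (FreeGroup.mk [s])⁻¹ := by
      rw [FreeGroup.inv_mk]; rfl
    rw [h, mul_inv_cancel]
  rw [mul_assoc, this, mul_one]

lemma vec_ext {ζ x y : V} (h : ζ ≠ 0) (h1 : dt ζ x = dt ζ y) (h2 : dp x ζ = dp y ζ) : x = y := by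
  have := (nn_pos h).ne'
  unfold nn at this
  simp only [dt, dp] at h1 h2
  ext
  · apply mul_left_cancel₀ this
    linear_combination ζ.1 * h2 - ζ.2 * h1
  · apply mul_left_cancel₀ this
    linear_combination ζ.2 * h2 + ζ.1 * h1

lemma exists_eta {B : SL2} {ζ : V} (hζ : ζ ≠ 0) {μ : ℝ} (hμ : 1 < |μ|) (h : act B ζ = μ • ζ) :
    ∃ η : V, dt ζ η ≠ 0 ∧ act B η = μ⁻¹ • η := by
  have hμ0 : μ ≠ 0 := by rintro rfl; simp at hμ; linarith
  have hnn := (nn_pos hζ).ne'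
  have hμ2 : μ⁻¹ - μ ≠ 0 := by
    intro h0
    have : μ * μ = 1 := by
      have : μ⁻¹ = μ := by linarith
      calc μ * μ = μ⁻¹ * μ := by rw [this]
        _ = 1 := inv_mul_cancel₀ hμ0
    have h3 : |μ| * |μ| = 1 := by rw [← abs_mul, this, abs_one]
    nlinarith
  set w : V := (-ζ.2, ζ.1) with hw
  set κ := dp (act B w) ζ / nn ζ with hκ
  have hdw : dt ζ w = nn ζ := by simp [dt, nn, hw]; ring
  have hpw : dp w ζ = 0 := by simp [dp, hw]; ring
  have e1 : act B w = μ⁻¹ • w + κ • ζ := by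
    apply vec_ext hζ
    · have h1 : dt (act B ζ) (act B w) = dt ζ w := dt_act _ _ _
      rw [h] at h1
      have h2 : dt (μ • ζ) (act B w) = μ * dt ζ (act B w) := by simp [dt]; ring
      have h3 : dt ζ (μ⁻¹ • w + κ • ζ) = μ⁻¹ * dt ζ w := by simp [dt]; ring
      rw [h3, ← h1, h2]; field_simp
    · have h3 : dp (μ⁻¹ • w + κ • ζ) ζ = μ⁻¹ * dp w ζ + κ * nn ζ := by simp [dp, nn]; ring
      rw [h3, hpw, hκ]; field_simp; ring
  refine ⟨w + (κ / (μ⁻¹ - μ)) • ζ, ?_, ?_⟩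
  · have : dt ζ (w + (κ / (μ⁻¹ - μ)) • ζ) = dt ζ w := by simp [dt]; ring
    rw [this, hdw]; exact hnn
  · have h1 : act B (w + (κ / (μ⁻¹ - μ)) • ζ) = act B w + (κ / (μ⁻¹ - μ)) • act B ζ := by
      unfold act; ext <;> simp <;> ring
    rw [h1, e1, h]
    have h2 : κ + κ / (μ⁻¹ - μ) * μ = μ⁻¹ * (κ / (μ⁻¹ - μ)) := by
      have := div_mul_cancel₀ κ hμ2
      linear_combination - this
    ext
    · simp; linear_combination ζ.1 * h2
    · simp; linear_combination ζ.2 * h2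

lemma sn_tendsto_lower {ι : Type*} {l : Filter ι} {x : ι → V} {ζ η : V} (hx : ∀ n, x n ≠ 0) (hζ : ζ ≠ 0)
    (hη : η ≠ 0) (hne : dt ζ η ≠ 0) (h : Tendsto (fun n => sn (x n) ζ) l (𝓝 0)) :
    ∀ᶠ n in l, sn ζ η / 2 ≤ sn (x n) η := by
  have hp : 0 < sn ζ η := by
    unfold sn
    have := nr_pos hζ
    have := nr_pos hη
    positivity
  filter_upwards [h.eventually_lt_const (half_pos hp)] with n hn
  have := sn_tri ζ η hζ hη (hx n)
  rw [sn_comm ζ (x n)] at this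
  linarith

def sg (ζ η x : V) : ℝ := dt x η / dt x ζ

lemma XX_sg {ζ η p q r s : V} (hD : dt ζ η ≠ 0) (hp : dt p ζ ≠ 0) (hq : dt q ζ ≠ 0) (hr : dt r ζ ≠ 0)
    (hs : dt s ζ ≠ 0) : XX p q r s = (dt p ζ * dt q ζ * dt r ζ * dt s ζ / dt ζ η ^ 2) ^ 2 *
      ((sg ζ η r - sg ζ η p) * (sg ζ η s - sg ζ η p) * (sg ζ η r - sg ζ η q) * (sg ζ η s - sg ζ η q)) := by
  have e : ∀ x y, dt x ζ ≠ 0 → dt y ζ ≠ 0 → dt x y = dt x ζ * dt y ζ * (sg ζ η y - sg ζ η x) / dt ζ η := by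
    intro x y hx hy
    unfold sg
    field_simp
    simp only [dt]; ring
  unfold XX
  rw [e p r hp hr, e p s hp hs, e q r hq hr, e q s hq hs]
  field_simp

lemma Hyp.hyp (H : Hyp A) {γ : FreeGroup (Fin r)} (hγ : γ ≠ 1) {ζ : V} (hζ : ζ ≠ 0) {μ : ℝ}
    (hμ : 1 < |μ|) (hfix : act (A γ) ζ = μ • ζ) (c : ℕ → FreeGroup (Fin r))
    (hc : ∀ n, hd (c n) ≠ hd γ) (hs : Tendsto (fun n => sn (pe A (c n)) ζ) atTop (𝓝 0)) : False := by
  obtain ⟨k0, hk⟩ := H.k0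
  obtain ⟨η, hD, hfix'⟩ := exists_eta hζ hμ hfix
  have hη : η ≠ 0 := by rintro rfl; simp [dt] at hD
  have hμ0 : μ ≠ 0 := by rintro rfl; simp at hμ; linarith
  have hM : 1 < μ ^ 2 := by rw [← sq_abs]; nlinarith
  set M := μ ^ 2 with hMdef
  have hM0 : 0 < M := by linarith
  -- nonparallel
  have hnz : ∀ g, dt (pe A g) ζ ≠ 0 := by
    intro g h0
    have h1 : dt (pe A (γ * g)) ζ = 0 := by
      rw [pe_mul]
      have : dt (act (A γ) (pe A g)) (act (A γ) ζ) = 0 := by rw [dt_act, h0]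
      rw [hfix] at this
      have e : dt (act (A γ) (pe A g)) (μ • ζ) = μ * dt (act (A γ) (pe A g)) ζ := by
        simp only [dt, Prod.smul_fst, Prod.smul_snd, smul_eq_mul]; ring
      rw [e] at this
      exact (mul_eq_zero.1 this).resolve_left hμ0
    have h2 : dt (pe A g) (pe A (γ * g)) ≠ 0 := H.dt_ne (by
      intro h; exact hγ (mul_eq_right.1 h.symm))
    apply h2
    have id : nn ζ * dt (pe A g) (pe A (γ * g)) = dt (pe A g) ζ * dp ζ (pe A (γ * g))
        - dp (pe A g) ζ * dt (pe A (γ * g)) ζ := by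
      unfold nn dt dp; ring
    rw [h0, h1] at id
    simpa [(nn_pos hζ).ne'] using id
  have hsg : ∀ g, sg ζ η (pe A (γ * g)) = M * sg ζ η (pe A g) := by
    intro g
    rw [pe_mul]
    have e1 : dt (act (A γ) (pe A g)) η = μ * dt (pe A g) η := by
      rw [← dt_act (A γ) (pe A g) η, hfix']
      simp only [dt, Prod.smul_fst, Prod.smul_snd, smul_eq_mul]; field_simp
    have e2 : dt (act (A γ) (pe A g)) ζ = μ⁻¹ * dt (pe A g) ζ := by
      rw [← dt_act (A γ) (pe A g) ζ, hfix]
      simp only [dt, Prod.smul_fst, Prod.smul_snd, smul_eq_mul]; field_simp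
    unfold sg
    rw [e1, e2, hMdef]
    have := hnz g
    field_simp
  have hsgp : ∀ (i : ℕ) g, sg ζ η (pe A (γ ^ i * g)) = M ^ i * sg ζ η (pe A g) := by
    intro i
    induction i with
    | zero => intro g; simp
    | succ i ih => intro g; rw [pow_succ, mul_assoc, ih, hsg]; ring
  have hinf : ∀ B : ℝ, ∀ᶠ n in atTop, B < |sg ζ η (pe A (c n))| := by
    intro B
    have hp : 0 < sn ζ η := by
      unfold sn
      have := nr_pos hζ
      have := nr_pos hη
      positivity
    have l1 := sn_tendsto_lower (fun n => pe_ne A (c n)) hζ hη hD hs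
    have hr : 0 < nr η / nr ζ := div_pos (nr_pos hη) (nr_pos hζ)
    have l2 := hs.eventually_lt_const (u := (sn ζ η / 2) * (nr η / nr ζ) / (|B| + 1)) (by positivity)
    filter_upwards [l1, l2] with n h1 h2
    unfold sg
    rw [abs_div, sn_mul (pe_ne A _) hη, sn_mul (pe_ne A _) hζ]
    have px := nr_pos (pe_ne A (c n))
    have pη := nr_pos hη
    have pζ := nr_pos hζ
    have ps : 0 < sn (pe A (c n)) ζ := by
      unfold sn
      have := hnz (c n)
      positivity
    rw [lt_div_iff₀ (by positivity)]
    rw [lt_div_iff₀ (by positivity)] at h2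
    have hB : B ≤ |B| := le_abs_self B
    have : sn (pe A (c n)) ζ * (|B| + 1) * nr ζ < (sn ζ η / 2) * nr η := by
      have := mul_lt_mul_of_pos_right h2 pζ
      have e : sn ζ η / 2 * (nr η / nr ζ) * nr ζ = sn ζ η / 2 * nr η := by field_simp
      linarith
    calc B * (sn (pe A (c n)) ζ * (nr (pe A (c n)) * nr ζ))
        ≤ (|B| + 1) * (sn (pe A (c n)) ζ * (nr (pe A (c n)) * nr ζ)) := by
          apply mul_le_mul_of_nonneg_right _ (by positivity); linarith
      _ = nr (pe A (c n)) * (sn (pe A (c n)) ζ * (|B| + 1) * nr ζ) := by ring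
      _ < nr (pe A (c n)) * ((sn ζ η / 2) * nr η) := mul_lt_mul_of_pos_left this px
      _ ≤ nr (pe A (c n)) * (sn (pe A (c n)) η * nr η) := by gcongr
      _ = _ := by ring
  -- choose sign
  obtain ⟨ε, hε, hfreq⟩ : ∃ ε : ℝ, ε ^ 2 = 1 ∧ ∃ᶠ n in atTop, ε * sg ζ η (pe A (c n)) = |sg ζ η (pe A (c n))| := by
    by_cases hf : ∃ᶠ n in atTop, 0 ≤ sg ζ η (pe A (c n))
    · exact ⟨1, by norm_num, hf.mono fun n hn => by rw [one_mul, abs_of_nonneg hn]⟩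
    · refine ⟨-1, by norm_num, ?_⟩
      rw [not_frequently] at hf
      apply Eventually.frequently
      filter_upwards [hf] with n hn
      rw [abs_of_neg (not_le.1 hn)]; ring
  have claim : ∀ K : ℕ, ∃ n, ∃ i, K ≤ i ∧ 1 ≤ ε * sg ζ η (pe A ((γ ^ i)⁻¹ * c n)) ∧
      ε * sg ζ η (pe A ((γ ^ i)⁻¹ * c n)) < M := by
    intro K
    obtain ⟨n, h1, h2⟩ := (hfreq.and_eventually (hinf (M ^ K))).exists
    obtain ⟨i, hi1, hi2⟩ := exists_nat_pow_near (x := |sg ζ η (pe A (c n))|) (y := M)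
      ((one_le_pow₀ hM.le).trans h2.le) hM
    refine ⟨n, i, ?_, ?_⟩
    · have : M ^ K < M ^ (i+1) := h2.trans hi2
      have := (pow_lt_pow_iff_right₀ hM).1 this
      omega
    · have e := hsgp i ((γ ^ i)⁻¹ * c n)
      rw [mul_inv_cancel_left] at e
      rw [← h1, e] at hi1 hi2
      have pM : 0 < M ^ i := by positivity
      constructor
      · by_contra hcon
        nlinarith
      · rw [pow_succ] at hi2
        by_contra hcon
        nlinarith
  obtain ⟨n1, i1, -, hl1, hu1⟩ := claim 0
  set d1 := (γ ^ i1)⁻¹ * c n1 with hd1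
  set h := γ * d1 with hh
  set h' := γ ^ 3 * d1 with hh'
  set L := FreeGroup.toWord (h⁻¹ * h') with hL
  set K1 := FreeGroup.norm h + L.length with hK1
  obtain ⟨J, hJ⟩ := ((norm_pow_tendsto hγ).eventually_gt_atTop (K1 + k0 + FreeGroup.norm (γ ^ 2))).exists_forall_of_atTop
  obtain ⟨n, i, hi, hl, hu⟩ := claim (J + 3)
  obtain ⟨m, rfl⟩ : ∃ m, i = m + 2 := ⟨i - 2, by omega⟩
  have hSS : ∀ x ∈ {g : FreeGroup (Fin r) | FreeGroup.norm g ≤ K1}, ∀ y ∈ {g : FreeGroup (Fin r) | K1 + k0 < FreeGroup.norm g},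
      k0 < FreeGroup.norm (x⁻¹ * y) := by
    intro x hx y hy
    have := FreeGroup.norm_mul_le x (x⁻¹ * y)
    rw [mul_inv_cancel_left] at this
    simp only [Set.mem_ofPred_eq] at hx hy
    omega
  have px : Relation.ReflTransGen (E {g : FreeGroup (Fin r) | FreeGroup.norm g ≤ K1}) h h' := by
    have := E_path {g : FreeGroup (Fin r) | FreeGroup.norm g ≤ K1} h L ?_
    · rwa [hL, FreeGroup.mk_toWord, mul_inv_cancel_left] at this
    · intro i
      have h1 := FreeGroup.norm_mul_le h (FreeGroup.mk (L.take i))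
      have h2 := FreeGroup.norm_mk_le (L₁ := L.take i)
      have h3 := List.length_take_le i L
      have h4 : (L.take i).length ≤ L.length := by rw [List.length_take]; exact min_le_right _ _
      simp only [Set.mem_ofPred_eq]
      omega
  have pow_path : ∀ m', J < m' → Relation.ReflTransGen (E {g : FreeGroup (Fin r) | K1 + k0 < FreeGroup.norm g})
      ((γ ^ m')⁻¹) ((γ ^ m')⁻¹ * c n) := by
    intro m' hm'
    have := E_path {g : FreeGroup (Fin r) | K1 + k0 < FreeGroup.norm g} ((γ ^ m')⁻¹) (FreeGroup.toWord (c n)) ?_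
    · rwa [FreeGroup.mk_toWord] at this
    · intro i
      have hhd : hd (γ ^ m') ≠ hd (FreeGroup.mk ((FreeGroup.toWord (c n)).take i)) := by
        obtain ⟨m'', rfl⟩ : ∃ m'', m' = m'' + 1 := ⟨m' - 1, by omega⟩
        rw [hd_pow]
        cases i with
        | zero =>
          intro h0
          rw [List.take_zero, ← FreeGroup.one_eq_mk] at h0
          apply hγ
          apply hd_eq_none.1
          rw [h0]; exact hd_eq_none.2 rfl
        | succ i =>
          intro h0
          apply hc n
          rw [h0]
          conv_rhs => unfold hd
          rw [toWord_mk_of_red]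
          · unfold hd; cases FreeGroup.toWord (c n) <;> simp
          · exact FreeGroup.isReduced_toWord.infix (List.take_prefix _ _).isInfix
      have e := nc_norm hhd
      have := hJ m' (by omega)
      simp only [Set.mem_ofPred_eq]
      omega
  have p1 := pow_path (m+2) (by omega)
  have p3 := pow_path m (by omega)
  have p2 : Relation.ReflTransGen (E {g : FreeGroup (Fin r) | K1 + k0 < FreeGroup.norm g})
      ((γ ^ (m+2))⁻¹) ((γ ^ m)⁻¹) := by
    have := E_path {g : FreeGroup (Fin r) | K1 + k0 < FreeGroup.norm g} ((γ ^ (m+2))⁻¹) (FreeGroup.toWord (γ ^ 2)) ?_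
    · rw [FreeGroup.mk_toWord] at this
      have e : (γ ^ (m+2))⁻¹ * γ ^ 2 = (γ ^ m)⁻¹ := by rw [pow_add, pow_two]; group
      rwa [e] at this
    · intro i
      set z := FreeGroup.mk ((FreeGroup.toWord (γ ^ 2)).take i) with hz
      have h1 := FreeGroup.norm_mul_le ((γ ^ (m+2))⁻¹ * z) z⁻¹
      rw [mul_inv_cancel_right, FreeGroup.norm_inv_eq, FreeGroup.norm_inv_eq] at h1
      have h2 := FreeGroup.norm_mk_le (L₁ := (FreeGroup.toWord (γ ^ 2)).take i)
      rw [← hz] at h2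
      have h4 : ((FreeGroup.toWord (γ ^ 2)).take i).length ≤ FreeGroup.norm (γ ^ 2) := by
        rw [List.length_take]; exact min_le_right _ _
      have := hJ (m+2) (by omega)
      simp only [Set.mem_ofPred_eq]
      omega
  have py := ((E_symm _ p1).trans p2).trans p3
  have hy : (γ ^ (m+2))⁻¹ * c n ∈ {g : FreeGroup (Fin r) | K1 + k0 < FreeGroup.norm g} := by
    rcases Relation.ReflTransGen.cases_tail p1 with h | ⟨c, _, h⟩
    · have hq : hd (γ ^ (m+2)) ≠ hd (c n) := by rw [hd_pow]; exact (hc n).symm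
      have e := nc_norm hq
      have := hJ (m+2) (by omega)
      simp only [Set.mem_ofPred_eq]
      omega
    · exact h.2.1
  have hpos := H.chord hk hSS (x := h) (y := (γ ^ (m+2))⁻¹ * c n) (by simp only [Set.mem_ofPred_eq]; omega) hy px py
  rw [XX_sg hD (hnz _) (hnz _) (hnz _) (hnz _)] at hpos
  have hneg := pos_of_mul_pos_right hpos (sq_nonneg _)
  have e4 : (γ ^ m)⁻¹ * c n = γ ^ 2 * ((γ ^ (m+2))⁻¹ * c n) := by rw [pow_add, pow_two]; group
  rw [e4, hsgp, hh', hsgp, hh, hsg] at hneg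
  generalize sg ζ η (pe A ((γ ^ (m+2))⁻¹ * c n)) = u at *
  generalize sg ζ η (pe A d1) = v at *
  have h5 : 0 < (ε * u - M * (ε * v)) * (M ^ 2 * (ε * u) - M * (ε * v)) *
      (ε * u - M ^ 3 * (ε * v)) * (M ^ 2 * (ε * u) - M ^ 3 * (ε * v)) := by
    have : (ε * u - M * (ε * v)) * (M ^ 2 * (ε * u) - M * (ε * v)) *
      (ε * u - M ^ 3 * (ε * v)) * (M ^ 2 * (ε * u) - M ^ 3 * (ε * v)) =
      (ε ^ 2) ^ 2 * ((u - M * v) * (M ^ 2 * u - M * v) * (u - M ^ 3 * v) * (M ^ 2 * u - M ^ 3 * v)) := by ring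
    rw [this, hε]; linarith
  generalize ε * u = u' at *
  generalize ε * v = v' at *
  have q1 : u' - M * v' < 0 := by nlinarith
  have q2 : 0 < M ^ 2 * u' - M * v' := by nlinarith
  have q3 : u' - M ^ 3 * v' < 0 := by
    have : M * v' ≤ M ^ 3 * v' := by
      have : M ^ 1 ≤ M ^ 3 := pow_le_pow_right₀ hM.le (by norm_num)
      nlinarith
    linarith
  have q4 : M ^ 2 * u' - M ^ 3 * v' < 0 := by
    have : M ^ 2 * u' - M ^ 3 * v' = M ^ 2 * (u' - M * v') := by ring
    rw [this]; exact mul_neg_of_pos_of_neg (by positivity) q1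
  have := mul_neg_of_pos_of_neg (mul_pos_of_neg_of_neg (mul_neg_of_neg_of_pos q1 q2) q3) q4
  linarith

end Msec2
end CK

namespace CK
section mthm

lemma pair_aux {x z y : V} (hx : x ≠ 0) (hz : z ≠ 0) (hy : y ≠ 0) (h0 : 0 < dp x y)
    (h1 : sn x y ≤ 1 / 2) (h2 : sn x y < sn z x / 2) : 0 < dt z y * dt z x := by
  have px := nr_pos hx
  have py := nr_pos hy
  have pz := nr_pos hz
  apply sign_stab h0
  rw [sn_mul hx hy, sn_mul hz hx]
  have hd : (nr x * nr y) / 2 ≤ dp x y := by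
    have l := lagrange x y
    rw [← sq_abs (dt x y), sn_mul hx hy, ← nr_sq, ← nr_sq] at l
    have h3 := sn_nonneg x y
    have h4 : sn x y ^ 2 ≤ 1 / 4 := by nlinarith
    apply abs_le_of_sq_le_sq' _ h0.le |>.2
    have : 0 < (nr x * nr y) ^ 2 := by positivity
    nlinarith
  have h3 := abs_dp_le z x
  have h5 : sn x y * (nr x * nr y) * |dp z x| ≤ sn x y * (nr x * nr y) * (nr z * nr x) :=
    mul_le_mul_of_nonneg_left h3 (mul_nonneg (sn_nonneg _ _) (by positivity))
  have hs : 0 ≤ sn z x := sn_nonneg _ _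
  have h6 : nr x * nr y / 2 * (sn z x * (nr z * nr x)) ≤ dp x y * (sn z x * (nr z * nr x)) :=
    mul_le_mul_of_nonneg_right hd (by positivity)
  have h7 : sn x y * (nr x * nr y) * (nr z * nr x) < nr x * nr y / 2 * (sn z x * (nr z * nr x)) := by
    have : 0 < (nr x * nr y) * (nr z * nr x) := by positivity
    nlinarith
  linarith

lemma pair_core {x1 x2 y1 y2 : V} (hx1 : x1 ≠ 0) (hx2 : x2 ≠ 0) (hy1 : y1 ≠ 0) (hy2 : y2 ≠ 0)
    (p1 : 0 < dp x1 y1) (p2 : 0 < dp x2 y2)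
    (a1 : sn x1 y1 ≤ 1 / 2) (a2 : sn x2 y2 ≤ 1 / 2) (b1 : sn x1 y1 < sn x1 x2 / 2)
    (b2 : sn x2 y2 < sn x1 x2 / 2) (hd : 0 < dt x1 y1 * dt x2 y2) : XX x1 x2 y1 y2 < 0 := by
  have e1 := pair_aux hx1 hx2 hy1 p1 a1 (by rwa [sn_comm x2])
  have e2 := pair_aux hx2 hx1 hy2 p2 a2 b2
  rw [dt_swap x2 x1] at e1
  have e3 : (dt x2 y1 * dt x1 y2) * (dt x1 x2) ^ 2 < 0 := by nlinarith
  have e4 : dt x2 y1 * dt x1 y2 < 0 := by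
    by_contra hc
    push Not at hc
    nlinarith [mul_nonneg hc (sq_nonneg (dt x1 x2))]
  unfold XX
  nlinarith

lemma sn_neg (x y : V) : sn x (-y) = sn x y := by
  have : (-y) = (-1 : ℝ) • y := by simp
  unfold sn
  rw [this, nr_smul]
  have : dt x ((-1 : ℝ) • y) = - dt x y := by simp [dt]; ring
  rw [this]; simp

lemma dp_neg (x y : V) : dp x (-y) = - dp x y := by simp [dp]; ring
lemma dt_neg (x y : V) : dt x (-y) = - dt x y := by simp [dt]; ring

lemma pair_neg {x1 x2 y1 y2 : V} (hx1 : x1 ≠ 0) (hx2 : x2 ≠ 0) (hy1 : y1 ≠ 0) (hy2 : y2 ≠ 0)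
    (a1 : sn x1 y1 ≤ 1 / 2) (a2 : sn x2 y2 ≤ 1 / 2) (b1 : sn x1 y1 < sn x1 x2 / 2)
    (b2 : sn x2 y2 < sn x1 x2 / 2) (hd : 0 < (dt x1 y1 * dp x1 y1) * (dt x2 y2 * dp x2 y2)) :
    XX x1 x2 y1 y2 < 0 := by
  have p1 : dp x1 y1 ≠ 0 := by intro h; rw [h] at hd; simp at hd
  have p2 : dp x2 y2 ≠ 0 := by intro h; rw [h] at hd; simp at hd
  rcases lt_or_gt_of_ne p1 with p1 | p1 <;> rcases lt_or_gt_of_ne p2 with p2 | p2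
  · have := pair_core hx1 hx2 (neg_ne_zero.2 hy1) (neg_ne_zero.2 hy2)
      (by rw [dp_neg]; linarith) (by rw [dp_neg]; linarith) (by rwa [sn_neg]) (by rwa [sn_neg])
      (by rwa [sn_neg]) (by rwa [sn_neg])
      (by rw [dt_neg, dt_neg]
          have : 0 < dp x1 y1 * dp x2 y2 := mul_pos_of_neg_of_neg p1 p2
          refine pos_of_mul_pos_left (b := dp x1 y1 * dp x2 y2) ?_ this.le
          nlinarith)
    rwa [XX_neg_right, XX_swap, XX_neg_right, XX_swap] at this
  · have := pair_core hx1 hx2 (neg_ne_zero.2 hy1) hy2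
      (by rw [dp_neg]; linarith) p2 (by rwa [sn_neg]) a2
      (by rwa [sn_neg]) b2
      (by rw [dt_neg]
          have : 0 < -dp x1 y1 * dp x2 y2 := mul_pos (by linarith) p2
          refine pos_of_mul_pos_left (b := -dp x1 y1 * dp x2 y2) ?_ this.le
          nlinarith)
    rwa [XX_swap, XX_neg_right, XX_swap] at this
  · have := pair_core hx1 hx2 hy1 (neg_ne_zero.2 hy2) p1
      (by rw [dp_neg]; linarith) a1 (by rwa [sn_neg]) b1
      (by rwa [sn_neg])
      (by rw [dt_neg]
          have : 0 < -dp x2 y2 * dp x1 y1 := mul_pos (by linarith) p1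
          refine pos_of_mul_pos_left (b := -dp x2 y2 * dp x1 y1) ?_ this.le
          nlinarith)
    rwa [XX_neg_right] at this
  · exact pair_core hx1 hx2 hy1 hy2 p1 p2 a1 a2 b1 b2
      (by have : 0 < dp x2 y2 * dp x1 y1 := mul_pos p2 p1
          refine pos_of_mul_pos_left (b := dp x2 y2 * dp x1 y1) ?_ this.le
          nlinarith)

variable {r : ℕ} 
abbrev W (r : ℕ) := List (Fin r × Bool)
def SX (P : W r) : Set (FreeGroup (Fin r)) := {g | P <+: g.toWord}
def SY (P : W r) : Set (FreeGroup (Fin r)) := {g | hd g ≠ P.head?}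

lemma SXY {k0 : ℕ} {P : W r} (hP : P.length = k0 + 1) : ∀ x ∈ SX P, ∀ y ∈ SY P, k0 < FreeGroup.norm (x⁻¹ * y) := by
  rintro x ⟨Q, hQ⟩ y hy
  have hx : hd x = P.head? := by
    unfold hd; rw [← hQ]
    cases P with
    | nil => simp at hP
    | cons a t => simp
  rw [nc_norm (by rw [hx]; exact fun h => hy h.symm)]
  have : FreeGroup.norm x = P.length + Q.length := by
    unfold FreeGroup.norm; rw [← hQ]; simp
  omega

lemma SX_path {P : W r} {x : FreeGroup (Fin r)} (hx : x ∈ SX P) :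
    Relation.ReflTransGen (E (SX P)) (FreeGroup.mk P) x := by
  obtain ⟨Q, hQ⟩ := hx
  have e : x = FreeGroup.mk P * FreeGroup.mk Q := by
    rw [FreeGroup.mul_mk, hQ, FreeGroup.mk_toWord]
  have := E_path (SX P) (FreeGroup.mk P) Q (by
    intro i
    rw [FreeGroup.mul_mk]
    unfold SX
    have hr : FreeGroup.IsReduced (P ++ Q.take i) := by
      have h0 : FreeGroup.IsReduced (P ++ Q) := by rw [hQ]; exact FreeGroup.isReduced_toWord
      have hp : P ++ Q.take i <:+: P ++ Q := by
        apply List.IsPrefix.isInfix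
        rw [List.prefix_append_right_inj]
        exact List.take_prefix _ _
      exact h0.infix hp
    simp only [Set.mem_ofPred_eq]
    rw [toWord_mk_of_red hr]
    exact List.prefix_append _ _)
  rwa [← e] at this

lemma SY_path {P : W r} (hP : P ≠ []) {y : FreeGroup (Fin r)} (hy : y ∈ SY P) :
    Relation.ReflTransGen (E (SY P)) 1 y := by
  have e : y = 1 * FreeGroup.mk y.toWord := by
    rw [one_mul, FreeGroup.mk_toWord]
  have := E_path (SY P) 1 y.toWord (by
    intro i
    rw [one_mul]
    have hr : FreeGroup.IsReduced (y.toWord.take i) := by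
      exact FreeGroup.isReduced_toWord.infix (List.take_prefix _ _).isInfix
    simp only [SY, Set.mem_ofPred_eq, hd]
    rw [toWord_mk_of_red hr]
    cases i with
    | zero => 
      cases P with
      | nil => simp at hP
      | cons a t => simp
    | succ i =>
      rw [List.head?_take]
      simpa [SY, hd] using hy)
  rwa [← e] at this

lemma hd_shift {a b v : FreeGroup (Fin r)} (h : FreeGroup.norm (a⁻¹ * b) = FreeGroup.norm a + FreeGroup.norm b)
    (hv : FreeGroup.norm a = FreeGroup.norm v + FreeGroup.norm (v⁻¹ * a)) (hx : v⁻¹ * a ≠ 1) :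
    hd (v⁻¹ * a) ≠ hd (v⁻¹ * b) := by
  apply conv _ hx
  have e : (v⁻¹ * a)⁻¹ * (v⁻¹ * b) = a⁻¹ * b := by group
  have h1 := FreeGroup.norm_mul_le (v⁻¹ * a)⁻¹ (v⁻¹ * b)
  have h2 := FreeGroup.norm_mul_le v⁻¹ b
  rw [FreeGroup.norm_inv_eq] at h1 h2
  rw [e] at h1 ⊢
  omega

lemma toWord_shift (a : FreeGroup (Fin r)) (k : ℕ) :
    ((FreeGroup.mk (a.toWord.take k))⁻¹ * a).toWord = a.toWord.drop k := by
  have h : (FreeGroup.mk (a.toWord.take k))⁻¹ * a = FreeGroup.mk (a.toWord.drop k) := by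
    rw [inv_mul_eq_iff_eq_mul, FreeGroup.mul_mk, List.take_append_drop, FreeGroup.mk_toWord]
  rw [h, toWord_mk_of_red]
  exact FreeGroup.isReduced_toWord.infix (List.drop_suffix _ _).isInfix

lemma norm_take (a : FreeGroup (Fin r)) (k : ℕ) :
    FreeGroup.norm (FreeGroup.mk (a.toWord.take k)) = min k (FreeGroup.norm a) := by
  unfold FreeGroup.norm
  rw [toWord_mk_of_red (FreeGroup.isReduced_toWord.infix (List.take_prefix _ _).isInfix)]
  simp

end mthm
end CK

namespace CK
section mthm2
variable {r : ℕ} {A : FreeGroup (Fin r) →* SL2}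

lemma tends_act {x : ℕ → FreeGroup (Fin r)} {ζ : V} (hζ : ζ ≠ 0)
    (h : Tendsto (fun n => sn (pe A (x n)) ζ) atTop (𝓝 0)) (v : FreeGroup (Fin r)) :
    Tendsto (fun n => sn (pe A (v * x n)) (act (A v) ζ)) atTop (𝓝 0) := by
  refine squeeze_zero (fun n => sn_nonneg _ _) (fun n => ?_) (by simpa using h.const_mul (SS (A v)))
  rw [pe_mul]
  exact sn_act _ (pe_ne A _) hζ

lemma act_zero (B : SL2) : act B 0 = 0 := by unfold act; ext <;> simp

/-- parallel vectors -/
lemma par {x y : V} (hx : x ≠ 0) (h : dt x y = 0) : ∃ μ : ℝ, y = μ • x := by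
  refine ⟨dp y x / nn x, ?_⟩
  have hn := (nn_pos hx).ne'
  apply vec_ext hx
  · rw [h]; simp [dt]; ring
  · have : dp ((dp y x / nn x) • x) x = (dp y x / nn x) * nn x := by simp [dp, nn]; ring
    rw [this]; field_simp

lemma eig_trace {B : SL2} {ζ : V} {μ : ℝ} (hζ : ζ ≠ 0) (h : act B ζ = μ • ζ) :
    1 - μ * (B.1 0 0 + B.1 1 1) + μ ^ 2 = 0 := by
  have hd := det_eq B
  have h1 := congrArg Prod.fst h
  have h2 := congrArg Prod.snd h
  simp only [act, Prod.smul_fst, Prod.smul_snd, smul_eq_mul] at h1 h2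
  have hn := (nn_pos hζ).ne'
  have e1 : (1 - μ * (B.1 0 0 + B.1 1 1) + μ ^ 2) * ζ.1 = 0 := by
    linear_combination  (B.1 1 1 - μ) * h1 - B.1 0 1 * h2 - ζ.1 * hd
  have e2 : (1 - μ * (B.1 0 0 + B.1 1 1) + μ ^ 2) * ζ.2 = 0 := by
    linear_combination  (B.1 0 0 - μ) * h2 - B.1 1 0 * h1 - ζ.2 * hd
  by_contra hc
  apply hζ
  ext
  · simpa [hc] using e1
  · simpa [hc] using e2

lemma Hyp.nopar (H : Hyp A) {γ : FreeGroup (Fin r)} (hγ : γ ≠ 1) {ζ : V} (hζ : ζ ≠ 0) {μ : ℝ}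
    (hfix : act (A γ) ζ = μ • ζ) (a b : ℕ → FreeGroup (Fin r))
    (hab : ∀ n, hd (a n) ≠ hd (b n)) (ha : Tendsto (fun n => sn (pe A (a n)) ζ) atTop (𝓝 0))
    (hb : Tendsto (fun n => sn (pe A (b n)) ζ) atTop (𝓝 0)) : False := by
  have ht := eig_trace hζ hfix
  have hμ0 : μ ≠ 0 := by rintro rfl; simp at ht
  have key : ∀ γ : FreeGroup (Fin r), γ ≠ 1 → ∀ μ : ℝ, 1 < |μ| → act (A γ) ζ = μ • ζ → False := by
    intro γ hγ μ hμ hfix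
    classical
    refine H.hyp hγ hζ hμ hfix (fun n => if hd (a n) = hd γ then b n else a n) ?_ ?_
    · intro n
      by_cases h : hd (a n) = hd γ
      · simp only [h, if_true]; rw [← h]; exact (hab n).symm
      · simp only [h, if_false]; exact h
    · have : Tendsto (fun n => sn (pe A (a n)) ζ + sn (pe A (b n)) ζ) atTop (𝓝 0) := by
        simpa using ha.add hb
      refine squeeze_zero (fun n => sn_nonneg _ _) (fun n => ?_) this
      have := sn_nonneg (pe A (a n)) ζ
      have := sn_nonneg (pe A (b n)) ζ
      split_ifs <;> linarith
  rcases lt_trichotomy |μ| 1 with h | h | h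
  · refine key γ⁻¹ (inv_ne_one.2 hγ) μ⁻¹ ?_ ?_
    · rw [abs_inv]; exact (one_lt_inv₀ (abs_pos.2 hμ0)).2 h
    · rw [map_inv]
      have : act (A γ)⁻¹ (μ • ζ) = ζ := by rw [← hfix, act_inv_act]
      rw [act_smul] at this
      rw [eq_inv_smul_iff₀ hμ0]; exact this
  · apply H.h4 γ hγ
    have h2 : μ ^ 2 = 1 := by rw [← sq_abs, h]; norm_num
    have h3 : (μ * ((A γ).1 0 0 + (A γ).1 1 1)) ^ 2 = 4 := by
      have : μ * ((A γ).1 0 0 + (A γ).1 1 1) = 2 := by linarith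
      rw [this]; norm_num
    rwa [mul_pow, h2, one_mul] at h3
  · exact key γ hγ μ h hfix

lemma three_sign {t : Fin 3 → ℝ} (h : ∀ i, t i ≠ 0) : ∃ i k, i ≠ k ∧ 0 < t i * t k := by
  have h0 := h 0
  have h1 := h 1
  have h2 := h 2
  rcases lt_or_gt_of_ne h0 with h0 | h0 <;> rcases lt_or_gt_of_ne h1 with h1 | h1 <;>
  rcases lt_or_gt_of_ne h2 with h2 | h2 <;>
  first
  | exact ⟨0, 1, by decide, by nlinarith⟩
  | exact ⟨0, 2, by decide, by nlinarith⟩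
  | exact ⟨1, 2, by decide, by nlinarith⟩

lemma Hyp.core (H : Hyp A) {k0 : ℕ} (hk : ∀ (s t : Fin r × Bool) (x y : FreeGroup (Fin r)),
    k0 < FreeGroup.norm (x⁻¹ * y) →
    0 < XX (pe A x) (pe A (x * FreeGroup.mk [s])) (pe A y) (pe A (y * FreeGroup.mk [t])))
    {P : W r} (hP : P.length = k0 + 1) (v : Fin 3 → FreeGroup (Fin r)) (hv : Function.Injective v)
    (a b : ℕ → FreeGroup (Fin r)) (hX : ∀ i n, (v i)⁻¹ * a n ∈ SX P)
    (hY : ∀ i n, (v i)⁻¹ * b n ∈ SY P) {ζ : V} (hζ : ζ ≠ 0)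
    (hab : ∀ n, hd (a n) ≠ hd (b n)) (ha : Tendsto (fun n => sn (pe A (a n)) ζ) atTop (𝓝 0))
    (hb : Tendsto (fun n => sn (pe A (b n)) ζ) atTop (𝓝 0)) : False := by
  have hP0 : P ≠ [] := by rintro rfl; simp at hP
  set Z : Fin 3 → V := fun i => act (A (v i)⁻¹) ζ with hZ
  have hZ0 : ∀ i, Z i ≠ 0 := fun i => act_ne hζ
  have hta : ∀ i, Tendsto (fun n => sn (pe A ((v i)⁻¹ * a n)) (Z i)) atTop (𝓝 0) := fun i => tends_act hζ ha _
  have htb : ∀ i, Tendsto (fun n => sn (pe A ((v i)⁻¹ * b n)) (Z i)) atTop (𝓝 0) := fun i => tends_act hζ hb _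
  have hZZ : ∀ i k, i ≠ k → dt (Z i) (Z k) ≠ 0 := by
    intro i k hik h0
    obtain ⟨μ, hμ⟩ := par (hZ0 i) h0
    refine H.nopar (γ := v i * (v k)⁻¹) ?_ hζ (μ := μ) ?_ a b hab ha hb
    · rw [ne_eq, mul_inv_eq_one]; exact fun h => hik (hv h)
    · rw [map_mul, act_mul]
      have e : act (A (v k)⁻¹) ζ = Z k := rfl
      rw [e, hμ, act_smul]
      have : act (A (v i)) (Z i) = ζ := by
        simp only [hZ]; rw [← act_mul, ← map_mul, mul_inv_cancel, map_one, act_one]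
      rw [this]
  have hxy : ∀ i, Tendsto (fun n => sn (pe A ((v i)⁻¹ * a n)) (pe A ((v i)⁻¹ * b n))) atTop (𝓝 0) := by
    intro i
    refine squeeze_zero (fun n => sn_nonneg _ _) (fun n => ?_) (by simpa using (hta i).add (htb i))
    rw [sn_comm (pe A ((v i)⁻¹ * b n))]
    exact sn_tri _ _ (pe_ne A _) (pe_ne A _) (hZ0 i)
  have hlow : ∀ i k, i ≠ k → ∃ η > 0, ∀ᶠ n in atTop, η ≤ sn (pe A ((v i)⁻¹ * a n)) (pe A ((v k)⁻¹ * a n)) := by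
    intro i k hik
    have hp : 0 < sn (Z i) (Z k) := by
      unfold sn
      have := nr_pos (hZ0 i)
      have := nr_pos (hZ0 k)
      have := hZZ i k hik
      positivity
    refine ⟨sn (Z i) (Z k) / 2, by positivity, ?_⟩
    filter_upwards [(hta i).eventually_lt_const (show 0 < sn (Z i) (Z k) / 4 by positivity), (hta k).eventually_lt_const (show 0 < sn (Z i) (Z k) / 4 by positivity)] with n h1 h2
    have t1 := sn_tri (Z i) (Z k) (hZ0 i) (hZ0 k) (pe_ne A ((v i)⁻¹ * a n))
    have t2 := sn_tri (pe A ((v i)⁻¹ * a n)) (Z k) (pe_ne A _) (hZ0 k) (pe_ne A ((v k)⁻¹ * a n))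
    rw [sn_comm (Z i) (pe A _)] at t1
    linarith
  have hall : ∀ᶠ n in atTop, ∀ i k : Fin 3, i ≠ k →
      sn (pe A ((v i)⁻¹ * a n)) (pe A ((v i)⁻¹ * b n)) ≤ 1 / 2 ∧
      sn (pe A ((v i)⁻¹ * a n)) (pe A ((v i)⁻¹ * b n)) < sn (pe A ((v i)⁻¹ * a n)) (pe A ((v k)⁻¹ * a n)) / 2 := by
    rw [eventually_all]; intro i
    rw [eventually_all]; intro k
    by_cases hik : i = k
    · simp [hik]
    obtain ⟨η, hη, h⟩ := hlow i k hik
    filter_upwards [h, (hxy i).eventually_lt_const (show (0:ℝ) < 1 / 2 by norm_num), (hxy i).eventually_lt_const (show (0:ℝ) < η / 2 by linarith)] with n h1 h2 h3 _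
    exact ⟨h2.le, by linarith⟩
  obtain ⟨n, hn⟩ := hall.exists
  have hdt : ∀ i, dt (pe A ((v i)⁻¹ * a n)) (pe A ((v i)⁻¹ * b n)) ≠ 0 := by
    intro i
    apply H.dt_ne
    intro h
    have := SXY hP _ (hX i n) _ (hY i n)
    rw [h] at this; simp at this
  have hdp : ∀ i, dp (pe A ((v i)⁻¹ * a n)) (pe A ((v i)⁻¹ * b n)) ≠ 0 := by
    intro i h
    obtain ⟨k, hk⟩ : ∃ k : Fin 3, i ≠ k := ⟨i + 1, (by decide : ∀ i : Fin 3, i ≠ i + 1) i⟩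
    have h1 := (hn i k hk).1
    have l := lagrange (pe A ((v i)⁻¹ * a n)) (pe A ((v i)⁻¹ * b n))
    rw [h, ← sq_abs (dt _ _), sn_mul (pe_ne A _) (pe_ne A _), ← nr_sq, ← nr_sq] at l
    have p1 := nr_pos (pe_ne A ((v i)⁻¹ * a n))
    have p2 := nr_pos (pe_ne A ((v i)⁻¹ * b n))
    have h3 := sn_nonneg (pe A ((v i)⁻¹ * a n)) (pe A ((v i)⁻¹ * b n))
    have h4 : sn (pe A ((v i)⁻¹ * a n)) (pe A ((v i)⁻¹ * b n)) ^ 2 ≤ 1 / 4 := by nlinarith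
    have : 0 < (nr (pe A ((v i)⁻¹ * a n)) * nr (pe A ((v i)⁻¹ * b n))) ^ 2 := by positivity
    nlinarith
  obtain ⟨i, k, hik, hpos⟩ := three_sign (t := fun i => dt (pe A ((v i)⁻¹ * a n)) (pe A ((v i)⁻¹ * b n)) * dp (pe A ((v i)⁻¹ * a n)) (pe A ((v i)⁻¹ * b n))) (fun i => mul_ne_zero (hdt i) (hdp i))
  have h1 := pair_neg (pe_ne A _) (pe_ne A _) (pe_ne A _) (pe_ne A _) (hn i k hik).1 (hn k i hik.symm).1 (hn i k hik).2
    (by rw [sn_comm (pe A ((v i)⁻¹ * a n))]; exact (hn k i hik.symm).2) hpos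
  have h2 := H.chord hk (SXY hP) (hX i n) (hY i n)
    ((E_symm _ (SX_path (hX i n))).trans (SX_path (hX k n)))
    ((E_symm _ (SY_path hP0 (hY i n))).trans (SY_path hP0 (hY k n)))
  linarith

end mthm2
end CK

namespace CK
section mthm3
variable {r : ℕ} {A : FreeGroup (Fin r) →* SL2}

lemma Hyp.seq (H : Hyp A) (a b : ℕ → FreeGroup (Fin r))
    (hn : ∀ n, FreeGroup.norm ((a n)⁻¹ * b n) = FreeGroup.norm (a n) + FreeGroup.norm (b n))
    (hinf : Tendsto (fun n => FreeGroup.norm (a n)) atTop atTop) {ζ : V} (hζ : ζ ≠ 0)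
    (ha : Tendsto (fun n => sn (pe A (a n)) ζ) atTop (𝓝 0))
    (hb : Tendsto (fun n => sn (pe A (b n)) ζ) atTop (𝓝 0)) : False := by
  classical
  obtain ⟨k0, hk⟩ := H.k0
  have fT : ∀ k : ℕ, Finite {l : W r // l.length ≤ k} := fun k =>
    (List.finite_length_le (Fin r × Bool) k).to_subtype
  have : Fintype {l : W r // l.length ≤ k0 + 1} := @Fintype.ofFinite _ (fT _)
  obtain ⟨N, hN⟩ : ∃ N, N = Fintype.card {l : W r // l.length ≤ k0 + 1} * 2 + 1 := ⟨_, rfl⟩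
  obtain ⟨N0, hN0⟩ : ∃ N0, N0 = N + (k0 + 1) := ⟨_, rfl⟩
  have := fT N0
  let f : ℕ → {l : W r // l.length ≤ N0} := fun n => ⟨(a n).toWord.take N0, by simp⟩
  obtain ⟨⟨w, hw⟩, hfib⟩ := Finite.exists_infinite_fiber f
  have hfib' : (f ⁻¹' {⟨w, hw⟩}).Infinite := Set.infinite_coe_iff.1 hfib
  have hfreq : ∃ᶠ n in atTop, (a n).toWord.take N0 = w ∧ N0 ≤ FreeGroup.norm (a n) := by
    apply Frequently.and_eventually _ (hinf.eventually_ge_atTop N0)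
    rw [Nat.frequently_atTop_iff_infinite]
    apply hfib'.mono
    intro n hn
    simp only [f, Set.mem_preimage, Set.mem_singleton_iff, Subtype.mk.injEq] at hn
    exact hn
  obtain ⟨φ, hφ, hφw⟩ := extraction_of_frequently_atTop hfreq
  have hlen : w.length = N0 := by
    rw [← (hφw 0).1]
    have := (hφw 0).2
    unfold FreeGroup.norm at this
    simp; omega
  let g : Fin N → {l : W r // l.length ≤ k0 + 1} := fun k => ⟨(w.drop k).take (k0 + 1), by simp⟩
  obtain ⟨⟨P, hPl⟩, hcard⟩ := Fintype.exists_lt_card_fiber_of_mul_lt_card g (n := 2) (by simp; omega)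
  have hcard' : 3 ≤ (Finset.univ.filter (fun x => g x = ⟨P, hPl⟩)).card := hcard
  let κ := Finset.orderEmbOfCardLe _ hcard'
  have hκ : ∀ i, (w.drop (κ i)).take (k0 + 1) = P := by
    intro i
    have := (Finset.mem_filter.1 (Finset.orderEmbOfCardLe_mem _ hcard' i)).2
    exact congrArg Subtype.val this
  have hκN : ∀ i, ((κ i : Fin N) : ℕ) + (k0 + 1) ≤ N0 := by intro i; have := (κ i).2; omega
  have hP : P.length = k0 + 1 := by
    rw [← hκ 0]; simp [hlen]; have := hκN 0; omega
  have htake : ∀ n i, FreeGroup.mk (w.take (κ i)) = FreeGroup.mk ((a (φ n)).toWord.take (κ i)) := by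
    intro n i
    rw [← (hφw n).1, List.take_take]
    congr 2
    have := hκN i; omega
  have hnv : ∀ i, FreeGroup.norm (FreeGroup.mk (w.take (κ i))) = κ i := by
    intro i
    rw [htake 0 i, norm_take]
    have := hκN i
    have := (hφw 0).2
    omega
  have hX : ∀ i n, (FreeGroup.mk (w.take (κ i)))⁻¹ * a (φ n) ∈ SX P := by
    intro i n
    unfold SX
    simp only [Set.mem_ofPred_eq]
    rw [htake n i, toWord_shift, ← hκ i, ← (hφw n).1, List.drop_take]
    exact (List.take_prefix _ _).trans (List.take_prefix _ _)
  have hdX : ∀ x ∈ SX P, hd x = P.head? := by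
    rintro x ⟨Q, hQ⟩
    unfold hd; rw [← hQ]
    cases P with
    | nil => simp at hP
    | cons a t => simp
  have hP0 : P.head? ≠ none := by
    cases P with
    | nil => simp at hP
    | cons a t => simp
  have hane : ∀ n, a (φ n) ≠ 1 := by
    intro n h
    have := (hφw n).2
    rw [h, FreeGroup.norm_one] at this; omega
  have hY : ∀ i n, (FreeGroup.mk (w.take (κ i)))⁻¹ * b (φ n) ∈ SY P := by
    intro i n
    unfold SY
    simp only [Set.mem_ofPred_eq]
    rw [← hdX _ (hX i n)]
    apply Ne.symm
    apply hd_shift (hn _)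
    · rw [hnv]
      conv_rhs => rw [htake n i]; unfold FreeGroup.norm; rw [toWord_shift]
      have h1 := hκN i
      have h2 := (hφw n).2
      unfold FreeGroup.norm at h2 ⊢
      simp; omega
    · intro h
      have := hdX _ (hX i n)
      rw [hd_eq_none.2 h] at this
      exact hP0 this.symm
  refine H.core hk hP (fun i => FreeGroup.mk (w.take (κ i))) ?_ (fun n => a (φ n)) (fun n => b (φ n)) hX hY hζ
    (fun n => conv (hn _) (hane n)) (ha.comp hφ.tendsto_atTop) (hb.comp hφ.tendsto_atTop)
  intro i k hik
  have := congrArg FreeGroup.norm hik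
  simp only [hnv] at this
  exact κ.injective (Fin.ext this)

lemma exists_limit_dir (x : ℕ → V) (hx : ∀ n, x n ≠ 0) : ∃ ζ : V, ζ ≠ 0 ∧ ∃ φ : ℕ → ℕ, StrictMono φ ∧
    Tendsto (fun n => sn (x (φ n)) ζ) atTop (𝓝 0) := by
  let u : ℕ → V := fun n => (nr (x n))⁻¹ • x n
  have hu : ∀ n, nn (u n) = 1 := by
    intro n
    have := nr_pos (hx n)
    simp only [u]; rw [nn_smul, ← nr_sq]; field_simp
  have hsn : ∀ n ζ, sn (x n) ζ = sn (u n) ζ := by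
    intro n ζ
    have := nr_pos (hx n)
    have e : dt (u n) ζ = (nr (x n))⁻¹ * dt (x n) ζ := by simp [u, dt]; ring
    have e2 : nr (u n) = 1 := by unfold nr; rw [hu]; simp
    unfold sn
    rw [e, e2, abs_mul, abs_of_pos (inv_pos.2 this)]
    field_simp
  have hb : ∀ n, u n ∈ Metric.closedBall (0 : V) 1 := by
    intro n
    have := hu n
    unfold nn at this
    rw [mem_closedBall_zero_iff, Prod.norm_def]
    simp only [Real.norm_eq_abs, sup_le_iff]
    constructor
    · apply abs_le_of_sq_le_sq _ (by norm_num); nlinarith [sq_nonneg (u n).2]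
    · apply abs_le_of_sq_le_sq _ (by norm_num); nlinarith [sq_nonneg (u n).1]
  obtain ⟨ζ, _, φ, hφ, hlim⟩ := (isCompact_closedBall (0:V) 1).tendsto_subseq hb
  have cnn : Continuous nn := by unfold nn; fun_prop
  have h1 : nn ζ = 1 := by
    have := (cnn.tendsto ζ).comp hlim
    have h2 : (nn ∘ (u ∘ φ)) = fun _ => (1:ℝ) := by funext n; exact hu _
    rw [h2] at this
    exact tendsto_nhds_unique this tendsto_const_nhds |>.symm ▸ rfl
  refine ⟨ζ, by rintro rfl; simp [nn] at h1, φ, hφ, ?_⟩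
  have e : ∀ n, sn (x (φ n)) ζ = |dt (u (φ n)) ζ| := by
    intro n
    rw [hsn]; unfold sn nr; rw [hu, h1]; simp
  simp_rw [e]
  have cd : Continuous (fun x : V => |dt x ζ|) := by unfold dt; fun_prop
  have := (cd.tendsto ζ).comp hlim
  rw [dt_self, abs_zero] at this
  exact this

lemma Hyp.sn_pe_lc_tendsto (H : Hyp A) (a : ℕ → FreeGroup (Fin r))
    (ha : Tendsto (fun n => SS (A (a n))) atTop atTop) :
    Tendsto (fun n => sn (pe A (a n)) (lc A (a n))) atTop (𝓝 0) := by
  rw [Metric.tendsto_atTop]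
  intro ε hε
  have hf := H.h3 ((2 / ε) ^ 2)
  obtain ⟨C, hC⟩ := (hf.image (fun g => SS (A g))).bddAbove
  obtain ⟨N, hN⟩ := eventually_atTop.1 (ha.eventually_gt_atTop C)
  refine ⟨N, fun n hn => ?_⟩
  rw [dist_zero_right, Real.norm_of_nonneg (sn_nonneg _ _)]
  have h1 : ¬ nn (pe A (a n)) * nn (qe A (a n)) ≤ (2 / ε) ^ 2 := by
    intro h
    have := hC (Set.mem_image_of_mem (fun g => SS (A g)) (show a n ∈ {g | _} from h))
    have := hN n hn
    simp at *
    linarith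
  have h2 := nr_mul_gt (by positivity) h1
  refine (sn_pe_lc A (a n)).trans_lt ?_
  have h3 : 0 < 2 / ε := by positivity
  rw [div_lt_iff₀ (h3.trans h2)]
  have : ε * (2 / ε) = 2 := by field_simp
  nlinarith

/-- coarse additivity along reduced products -/
theorem Hyp.main (H : Hyp A) : ∃ ε > 0, ∀ u v : FreeGroup (Fin r),
    FreeGroup.norm (u * v) = FreeGroup.norm u + FreeGroup.norm v →
    ε * (SS (A u) * SS (A v)) ≤ SS (A (u * v)) := by
  by_contra hcon
  push Not at hcon
  have h0 : ∀ n : ℕ, ∃ a b : FreeGroup (Fin r), FreeGroup.norm (a⁻¹ * b) = FreeGroup.norm a + FreeGroup.norm b ∧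
      SS (A (a⁻¹ * b)) * (n + 1) < SS (A a) * SS (A b) := by
    intro n
    obtain ⟨u, v, h1, h2⟩ := hcon (1 / (n + 1)) (by positivity)
    refine ⟨u⁻¹, v, by rw [inv_inv, FreeGroup.norm_inv_eq]; exact h1, ?_⟩
    rw [inv_inv, map_inv, SS_inv]
    rw [one_div, inv_mul_eq_div] at h2
    rwa [lt_div_iff₀ (by positivity)] at h2
  choose a b hab hS using h0
  have hSa : ∀ n : ℕ, (n : ℝ) + 1 ≤ SS (A (a n)) ^ 2 := by
    intro n
    have h1 := SS_mul (A (a n)) (A ((a n)⁻¹ * b n))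
    rw [← map_mul, mul_inv_cancel_left] at h1
    have h2 := hS n
    have p1 := SS_pos (A (a n))
    have p2 := SS_pos (A ((a n)⁻¹ * b n))
    by_contra hc
    push Not at hc
    nlinarith [mul_le_mul_of_nonneg_left h1 (show 0 ≤ SS (A (a n)) by linarith)]
  have hSb : ∀ n : ℕ, (n : ℝ) + 1 ≤ SS (A (b n)) ^ 2 := by
    intro n
    have h1 := SS_mul (A (b n)) (A ((b n)⁻¹ * a n))
    rw [← map_mul, mul_inv_cancel_left] at h1
    have e : (b n)⁻¹ * a n = ((a n)⁻¹ * b n)⁻¹ := by group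
    rw [e, map_inv, SS_inv] at h1
    have h2 := hS n
    have p1 := SS_pos (A (b n))
    have p2 := SS_pos (A ((a n)⁻¹ * b n))
    by_contra hc
    push Not at hc
    nlinarith [mul_le_mul_of_nonneg_left h1 (show 0 ≤ SS (A (b n)) by linarith)]
  have tt : ∀ c : ℕ → FreeGroup (Fin r), (∀ n : ℕ, (n : ℝ) + 1 ≤ SS (A (c n)) ^ 2) →
      Tendsto (fun n => SS (A (c n))) atTop atTop := by
    intro c hc
    rw [tendsto_atTop]
    intro C
    have : Tendsto (fun n : ℕ => (n : ℝ)) atTop atTop := tendsto_natCast_atTop_atTop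
    filter_upwards [this.eventually_gt_atTop (C ^ 2)] with n hn
    have h1 := hc n
    have h2 := SS_pos (A (c n))
    apply abs_le_of_sq_le_sq' _ (by linarith) |>.2
    linarith
  have ta := tt a hSa
  have tb := tt b hSb
  have la := H.sn_pe_lc_tendsto a ta
  have lb := H.sn_pe_lc_tendsto b tb
  have lab : Tendsto (fun n => sn (lc A (a n)) (lc A (b n))) atTop (𝓝 0) := by
    have h1 : ∀ n : ℕ, sn (lc A (a n)) (lc A (b n)) ≤ √ (4 / ((n:ℝ) + 1)) := by
      intro n
      apply Real.le_sqrt_of_sq_le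
      refine (sn_lc_sq A _ _).trans ?_
      have := hS n
      have p1 := SS_pos (A (a n))
      have p2 := SS_pos (A (b n))
      rw [div_le_div_iff₀ (by positivity) (by positivity)]
      nlinarith
    refine squeeze_zero (fun n => sn_nonneg _ _) h1 ?_
    have : Tendsto (fun n : ℕ => (4:ℝ) / ((n:ℝ) + 1)) atTop (𝓝 0) :=
      Tendsto.div_atTop tendsto_const_nhds (tendsto_natCast_atTop_atTop.atTop_add tendsto_const_nhds)
    have h2 := (Real.continuous_sqrt.tendsto 0).comp this
    rw [Real.sqrt_zero] at h2
    exact h2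
  have hinf : Tendsto (fun n => FreeGroup.norm (a n)) atTop atTop := by
    rw [tendsto_atTop]
    intro k
    obtain ⟨C, hC⟩ := ((finite_ball (α := Fin r) k).image (fun g => SS (A g))).bddAbove
    filter_upwards [ta.eventually_gt_atTop C] with n hn
    by_contra hlt
    have := hC (Set.mem_image_of_mem (fun g => SS (A g)) (show a n ∈ {g | FreeGroup.norm g ≤ k} by simp; omega))
    exact absurd hn (not_lt.2 this)
  obtain ⟨ζ, hζ, φ, hφ, hlim⟩ := exists_limit_dir (fun n => pe A (a n)) (fun n => pe_ne A _)
  refine H.seq (fun n => a (φ n)) (fun n => b (φ n)) (fun n => hab _) (hinf.comp hφ.tendsto_atTop) hζ hlim ?_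
  have l1 := (la.comp hφ.tendsto_atTop).add ((lab.comp hφ.tendsto_atTop).add ((lb.comp hφ.tendsto_atTop).add hlim))
  refine squeeze_zero (fun n => sn_nonneg _ _) (fun n => ?_) (by simpa using l1)
  have t1 := sn_tri (pe A (b (φ n))) ζ (pe_ne A _) hζ (lc_ne A (b (φ n)))
  have t2 := sn_tri (lc A (b (φ n))) ζ (lc_ne A _) hζ (lc_ne A (a (φ n)))
  have t3 := sn_tri (lc A (a (φ n))) ζ (lc_ne A _) hζ (pe_ne A (a (φ n)))
  rw [sn_comm (lc A (b (φ n))) (lc A (a (φ n)))] at t2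
  rw [sn_comm (lc A (a (φ n))) (pe A (a (φ n)))] at t3
  linarith

end mthm3
end CK

namespace CK
section geom1
open UpperHalfPlane (I)

lemma den_pos (B : SL2) : 0 < B.1 1 0 ^ 2 + B.1 1 1 ^ 2 := by
  have := det_eq B
  by_contra h
  have h1 : B.1 1 0 = 0 := by nlinarith [sq_nonneg (B.1 1 0), sq_nonneg (B.1 1 1)]
  have h2 : B.1 1 1 = 0 := by nlinarith [sq_nonneg (B.1 1 0), sq_nonneg (B.1 1 1)]
  rw [h1, h2] at this; simp at this

lemma coe_smul_I (B : SL2) : ((B • I : ℍ) : ℂ) =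
    ⟨(B.1 0 0 * B.1 1 0 + B.1 0 1 * B.1 1 1) / (B.1 1 0 ^ 2 + B.1 1 1 ^ 2), 1 / (B.1 1 0 ^ 2 + B.1 1 1 ^ 2)⟩ := by
  rw [UpperHalfPlane.coe_specialLinearGroup_apply]
  have hp := den_pos B
  have hd := det_eq B
  have hne : (B.1 1 0 : ℂ) * Complex.I + B.1 1 1 ≠ 0 := by
    intro h
    have h1 := congrArg Complex.re h
    have h2 := congrArg Complex.im h
    simp at h1 h2
    rw [h1, h2] at hp; simp at hp
  rw [UpperHalfPlane.coe_I]
  show ((B.1 0 0 : ℂ) * Complex.I + B.1 0 1) / ((B.1 1 0 : ℂ) * Complex.I + B.1 1 1) = _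
  rw [div_eq_iff hne]
  apply Complex.ext
  · simp
    field_simp
    linear_combination (-B.1 1 0) * hd
  · simp
    field_simp
    linear_combination (B.1 1 1) * hd

lemma im_smul_I (B : SL2) : (B • I : ℍ).im = 1 / (B.1 1 0 ^ 2 + B.1 1 1 ^ 2) := by
  rw [← UpperHalfPlane.coe_im, coe_smul_I]
lemma re_smul_I (B : SL2) : (B • I : ℍ).re = (B.1 0 0 * B.1 1 0 + B.1 0 1 * B.1 1 1) / (B.1 1 0 ^ 2 + B.1 1 1 ^ 2) := by
  rw [← UpperHalfPlane.coe_re, coe_smul_I]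

lemma two_cosh_I (B : SL2) : 2 * Real.cosh (dist I (B • I)) = SS B := by
  rw [UpperHalfPlane.cosh_dist, im_smul_I, Complex.dist_eq, ← Complex.normSq_eq_norm_sq, coe_smul_I]
  have hp := den_pos B
  have hd := det_eq B
  simp [Complex.normSq_apply]
  unfold SS
  field_simp
  linear_combination (-B.1 0 0 * B.1 1 1 + B.1 0 1 * B.1 1 0 - 1) * hd

lemma two_cosh (A B : SL2) : 2 * Real.cosh (dist (A • I) (B • I)) = SS (A⁻¹ * B) := by
  rw [← two_cosh_I, mul_smul, ← dist_smul A⁻¹ (A • I), inv_smul_smul]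

lemma exists_smul_I (z : ℍ) : ∃ B : SL2, B • I = z := by
  exact ⟨_, UpperHalfPlane.toSL2R_smul_I z⟩

/-- diagonal matrices -/
def aa (s : ℝ) : SL2 := ⟨!![Real.exp (s / 2), 0; 0, Real.exp (-s / 2)], by
  rw [Matrix.det_fin_two_of, ← Real.exp_add]; ring_nf; simp⟩

lemma aa00 (s) : (aa s).1 0 0 = Real.exp (s / 2) := rfl
lemma aa01 (s) : (aa s).1 0 1 = 0 := rfl
lemma aa10 (s) : (aa s).1 1 0 = 0 := rfl
lemma aa11 (s) : (aa s).1 1 1 = Real.exp (-s / 2) := rfl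

lemma exp_half_sq (s : ℝ) : Real.exp (s / 2) ^ 2 = Real.exp s := by
  rw [← Real.exp_nat_mul]; congr 1; push_cast; ring

/-- the points `i e^s` -/
def pt (s : ℝ) : ℍ := aa s • I

lemma pt_im (s) : (pt s).im = Real.exp s := by
  unfold pt
  rw [im_smul_I, aa10, aa11, exp_half_sq, Real.exp_neg]; simp
lemma pt_re (s) : (pt s).re = 0 := by
  unfold pt
  rw [re_smul_I, aa10, aa01]; simp
lemma pt_zero : pt 0 = I := by
  apply UpperHalfPlane.ext
  apply Complex.ext
  · rw [UpperHalfPlane.coe_re, pt_re]; simp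
  · rw [UpperHalfPlane.coe_im, pt_im]; simp

lemma ext_iff_re_im {z w : ℍ} : z = w ↔ z.re = w.re ∧ z.im = w.im := by
  constructor
  · rintro rfl; exact ⟨rfl, rfl⟩
  · rintro ⟨h1, h2⟩
    apply UpperHalfPlane.ext
    exact Complex.ext h1 h2

lemma dist_pt (s t : ℝ) : dist (pt s) (pt t) = |s - t| := by
  rw [UpperHalfPlane.dist_of_re_eq (by rw [pt_re, pt_re]), pt_im, pt_im, Real.log_exp, Real.log_exp, Real.dist_eq]

/-- squared column formula -/
lemma SS_mul_aa (B : SL2) (s : ℝ) : SS (B * aa s) =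
    Real.exp s * (B.1 0 0 ^ 2 + B.1 1 0 ^ 2) + Real.exp (-s) * (B.1 0 1 ^ 2 + B.1 1 1 ^ 2) := by
  unfold SS
  rw [mul00, mul01, mul10, mul11, aa00, aa01, aa10, aa11, ← exp_half_sq s, ← exp_half_sq (-s)]
  ring

lemma SS_aa_mul (B : SL2) (s : ℝ) : SS (aa s * B) =
    Real.exp s * (B.1 0 0 ^ 2 + B.1 0 1 ^ 2) + Real.exp (-s) * (B.1 1 0 ^ 2 + B.1 1 1 ^ 2) := by
  unfold SS
  rw [mul00, mul01, mul10, mul11, aa00, aa01, aa10, aa11, ← exp_half_sq s, ← exp_half_sq (-s)]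
  ring

lemma sl_ext {A B : SL2} (h0 : A.1 0 0 = B.1 0 0) (h1 : A.1 0 1 = B.1 0 1) (h2 : A.1 1 0 = B.1 1 0)
    (h3 : A.1 1 1 = B.1 1 1) : A = B := by
  apply Subtype.ext
  rw [Matrix.eta_fin_two A.1, Matrix.eta_fin_two B.1, h0, h1, h2, h3]

lemma aa_inv (s) : (aa s)⁻¹ = aa (-s) := by
  apply sl_ext
  · rw [inv00, aa00, aa11]
  · rw [inv01, aa01, aa01]; simp
  · rw [inv10, aa10, aa10]; simp
  · rw [inv11, aa11, aa00]; simp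

lemma fix_of_SS {B : SL2} (h : SS B = 2) : B • I = I := by
  have h1 := two_cosh_I B
  rw [h] at h1
  have h2 : Real.cosh (dist I (B • I)) = 1 := by linarith
  have h3 : dist I (B • I) = 0 := by
    by_contra hc
    exact absurd h2 (Real.one_lt_cosh.2 hc).ne'
  exact (dist_eq_zero.1 h3).symm

/-- rotations -/
def rr (θ : ℝ) : SL2 := ⟨!![Real.cos θ, -Real.sin θ; Real.sin θ, Real.cos θ], by
  rw [Matrix.det_fin_two_of]; nlinarith [Real.sin_sq_add_cos_sq θ]⟩
lemma rr00 (s) : (rr s).1 0 0 = Real.cos s := rfl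
lemma rr01 (s) : (rr s).1 0 1 = -Real.sin s := rfl
lemma rr10 (s) : (rr s).1 1 0 = Real.sin s := rfl
lemma rr11 (s) : (rr s).1 1 1 = Real.cos s := rfl

lemma rr_I (θ) : rr θ • I = I := by
  apply fix_of_SS
  unfold SS; rw [rr00, rr01, rr10, rr11]; nlinarith [Real.sin_sq_add_cos_sq θ]

/-- polar decomposition -/
lemma exists_rot (w : ℍ) : ∃ θ, rr θ • pt (dist I w) = w := by
  obtain ⟨B, rfl⟩ := exists_smul_I w
  set d := dist I (B • I) with hd
  have hc := two_cosh_I B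
  rw [← hd] at hc
  have hd0 : 0 ≤ d := dist_nonneg
  obtain ⟨p, hp⟩ : ∃ p, p = B.1 0 0 ^ 2 + B.1 0 1 ^ 2 := ⟨_, rfl⟩
  obtain ⟨t, ht⟩ : ∃ p, p = B.1 1 0 ^ 2 + B.1 1 1 ^ 2 := ⟨_, rfl⟩
  obtain ⟨q, hq⟩ : ∃ p, p = B.1 0 0 * B.1 1 0 + B.1 0 1 * B.1 1 1 := ⟨_, rfl⟩
  have hdet : p * t - q ^ 2 = 1 := by
    have := det_eq B
    rw [hp, hq, ht]
    linear_combination (B.1 0 0 * B.1 1 1 - B.1 0 1 * B.1 1 0 + 1) * this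
  have hsum : p + t = 2 * Real.cosh d := by rw [hc]; unfold SS; rw [hp, ht]; ring
  set z : ℂ := ⟨(p - t) / 2, q⟩ with hz
  have hnz : ‖z‖ = Real.sinh d := by
    have h1 : ‖z‖ ^ 2 = Real.sinh d ^ 2 := by
      rw [← Complex.normSq_eq_norm_sq, Complex.normSq_apply, hz]
      have := Real.cosh_sq d
      simp only
      have h2 : (p + t) ^ 2 = 4 * Real.cosh d ^ 2 := by rw [hsum]; ring
      linarith
    exact (sq_eq_sq₀ (norm_nonneg _) (Real.sinh_nonneg_iff.2 hd0)).1 h1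
  have hre : Real.sinh d * Real.cos z.arg = (p - t) / 2 := by
    rw [← hnz]; exact Complex.norm_mul_cos_arg z
  have him : Real.sinh d * Real.sin z.arg = q := by
    rw [← hnz]; exact Complex.norm_mul_sin_arg z
  refine ⟨z.arg / 2, ?_⟩
  set θ := z.arg / 2 with hθ
  have e2 : z.arg = 2 * θ := by rw [hθ]; ring
  rw [e2] at hre him
  have hS : SS ((rr θ * aa d)⁻¹ * B) = 2 := by
    rw [mul_inv_rev, aa_inv, mul_assoc, SS_aa_mul, neg_neg, mul00, mul01, mul10, mul11, inv00, inv01, inv10, inv11,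
      rr00, rr01, rr10, rr11]
    have hs := Real.sin_sq_add_cos_sq θ
    rw [Real.cos_two_mul] at hre
    rw [Real.sin_two_mul] at him
    have l1 : (Real.cos θ * B.1 0 0 + - -Real.sin θ * B.1 1 0) ^ 2 + (Real.cos θ * B.1 0 1 + - -Real.sin θ * B.1 1 1) ^ 2
        = Real.exp d := by
      rw [← Real.cosh_add_sinh]
      have : (Real.cos θ * B.1 0 0 + - -Real.sin θ * B.1 1 0) ^ 2 + (Real.cos θ * B.1 0 1 + - -Real.sin θ * B.1 1 1) ^ 2
        = p * Real.cos θ ^ 2 + 2 * q * (Real.sin θ * Real.cos θ) + t * Real.sin θ ^ 2 := by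
        rw [hp, hq, ht]; ring
      rw [this, ← him]
      have hs' : Real.sin θ ^ 2 = 1 - Real.cos θ ^ 2 := by linarith
      have ep : p = Real.cosh d + Real.sinh d * (2 * Real.cos θ ^ 2 - 1) := by linarith
      have et : t = Real.cosh d - Real.sinh d * (2 * Real.cos θ ^ 2 - 1) := by linarith
      rw [ep, et]
      linear_combination (Real.cosh d - Real.sinh d * (2 * Real.cos θ ^ 2 - 1) + 4 * Real.sinh d * Real.cos θ ^ 2) * hs
    have l2 : (-Real.sin θ * B.1 0 0 + Real.cos θ * B.1 1 0) ^ 2 + (-Real.sin θ * B.1 0 1 + Real.cos θ * B.1 1 1) ^ 2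
        = Real.exp (-d) := by
      have l3 : Real.exp d + Real.exp (-d) = p + t := by
        rw [hsum, Real.cosh_eq]; ring
      have : Real.exp (-d) = p + t - Real.exp d := by linarith
      rw [this, ← l1, hp, ht]
      linear_combination (B.1 0 0 ^ 2 + B.1 0 1 ^ 2 + B.1 1 0 ^ 2 + B.1 1 1 ^ 2) * hs
    rw [l1, l2, ← Real.exp_add, ← Real.exp_add]
    norm_num
  have := fix_of_SS hS
  rw [mul_smul, inv_smul_eq_iff, mul_smul] at this
  exact this.symm

lemma exists_frame (u w : ℍ) : ∃ B : SL2, B • I = u ∧ B • pt (dist u w) = w := by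
  obtain ⟨A, rfl⟩ := exists_smul_I u
  obtain ⟨θ, h⟩ := exists_rot (A⁻¹ • w)
  rw [← dist_smul A I, smul_inv_smul] at h
  refine ⟨A * rr θ, by rw [mul_smul, rr_I], ?_⟩
  rw [mul_smul, h, smul_inv_smul]

lemma two_point {u w u' w' : ℍ} (h : dist u w = dist u' w') : ∃ B : SL2, B • u = u' ∧ B • w = w' := by
  obtain ⟨A, h1, h2⟩ := exists_frame u w
  obtain ⟨A', h1', h2'⟩ := exists_frame u' w'
  refine ⟨A' * A⁻¹, ?_, ?_⟩
  · rw [mul_smul, ← h1, inv_smul_smul, h1']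
  · rw [mul_smul]; nth_rewrite 1 [← h2]; rw [inv_smul_smul, h, h2']

end geom1
end CK

namespace CK
section geom2
open UpperHalfPlane (I)

lemma mem_center {Z : SL2} : Z ∈ Subgroup.center SL2 ↔ ∃ ε : ℝ, ε ^ 2 = 1 ∧
    Z.1 0 0 = ε ∧ Z.1 0 1 = 0 ∧ Z.1 1 0 = 0 ∧ Z.1 1 1 = ε := by
  rw [Matrix.SpecialLinearGroup.mem_center_iff]
  constructor
  · rintro ⟨ε, h1, h2⟩
    refine ⟨ε, by simpa using h1, ?_, ?_, ?_, ?_⟩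
    all_goals
      have : Z.1 = _ := h2.symm
      rw [this]; simp
  · rintro ⟨ε, h1, h2, h3, h4, h5⟩
    refine ⟨ε, by simpa using h1, ?_⟩
    rw [Matrix.eta_fin_two Z.1, h2, h3, h4, h5]
    ext i k
    fin_cases i <;> fin_cases k <;> simp

lemma mk_eq_iff {A B : SL2} : (QuotientGroup.mk A : PSL2) = QuotientGroup.mk B ↔
    ∃ ε : ℝ, ε ^ 2 = 1 ∧ B.1 0 0 = ε * A.1 0 0 ∧ B.1 0 1 = ε * A.1 0 1 ∧ B.1 1 0 = ε * A.1 1 0 ∧ B.1 1 1 = ε * A.1 1 1 := by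
  rw [QuotientGroup.eq, mem_center]
  have e : B = A * (A⁻¹ * B) := by group
  constructor
  · rintro ⟨ε, h1, h2, h3, h4, h5⟩
    refine ⟨ε, h1, ?_, ?_, ?_, ?_⟩ <;> rw [e]
    · rw [mul00, h2, h4]; ring
    · rw [mul01, h3, h5]; ring
    · rw [mul10, h2, h4]; ring
    · rw [mul11, h3, h5]; ring
  · rintro ⟨ε, h1, h2, h3, h4, h5⟩
    have hd := det_eq A
    refine ⟨ε, h1, ?_, ?_, ?_, ?_⟩
    · rw [mul00, inv00, inv01, h2, h4]; linear_combination ε * hd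
    · rw [mul01, inv00, inv01, h3, h5]; ring
    · rw [mul10, inv10, inv11, h2, h4]; ring
    · rw [mul11, inv10, inv11, h3, h5]; linear_combination ε * hd

lemma smul_eq_of_mk {A B : SL2} (h : (QuotientGroup.mk A : PSL2) = QuotientGroup.mk B) (z : ℍ) : A • z = B • z := by
  obtain ⟨C, rfl⟩ := exists_smul_I z
  rw [← mul_smul, ← mul_smul]
  have h' : (QuotientGroup.mk (A * C) : PSL2) = QuotientGroup.mk (B * C) := by
    rw [QuotientGroup.mk_mul, QuotientGroup.mk_mul, h]
  obtain ⟨ε, h1, h2, h3, h4, h5⟩ := mk_eq_iff.1 h'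
  rw [ext_iff_re_im, re_smul_I, re_smul_I, im_smul_I, im_smul_I, h2, h3, h4, h5]
  have e1 : (ε * (A * C).1 1 0) ^ 2 + (ε * (A * C).1 1 1) ^ 2 = (A * C).1 1 0 ^ 2 + (A * C).1 1 1 ^ 2 := by
    linear_combination ((A * C).1 1 0 ^ 2 + (A * C).1 1 1 ^ 2) * h1
  rw [e1]
  refine ⟨?_, rfl⟩
  congr 1
  linear_combination (-((A * C).1 0 0 * (A * C).1 1 0 + (A * C).1 0 1 * (A * C).1 1 1)) * h1

lemma psl_mk (A : SL2) (z : ℍ) : pslSMul (QuotientGroup.mk A) z = A • z := by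
  unfold pslSMul
  exact smul_eq_of_mk (QuotientGroup.out_eq' _) z

lemma exists_mk (g : PSL2) : ∃ A : SL2, (QuotientGroup.mk A : PSL2) = g := QuotientGroup.mk_surjective g

lemma psl_mul (g h : PSL2) (z : ℍ) : pslSMul (g * h) z = pslSMul g (pslSMul h z) := by
  obtain ⟨A, rfl⟩ := exists_mk g
  obtain ⟨B, rfl⟩ := exists_mk h
  rw [← QuotientGroup.mk_mul, psl_mk, psl_mk, psl_mk, mul_smul]

lemma psl_one (z : ℍ) : pslSMul 1 z = z := by
  rw [← QuotientGroup.mk_one, psl_mk, one_smul]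

lemma psl_inv_smul (g : PSL2) (z : ℍ) : pslSMul g⁻¹ (pslSMul g z) = z := by
  rw [← psl_mul, inv_mul_cancel, psl_one]
lemma psl_smul_inv (g : PSL2) (z : ℍ) : pslSMul g (pslSMul g⁻¹ z) = z := by
  rw [← psl_mul, mul_inv_cancel, psl_one]

lemma psl_dist (g : PSL2) (z w : ℍ) : dist (pslSMul g z) (pslSMul g w) = dist z w := by
  obtain ⟨A, rfl⟩ := exists_mk g
  rw [psl_mk, psl_mk, dist_smul]

/-- isometries of the line into ℍ are given by frames -/
lemma geo {γ : ℝ → ℍ} (h : Isometry γ) : ∃ M : SL2, ∀ s, γ s = M • pt s := by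
  obtain ⟨M, h0, h1⟩ := exists_frame (γ 0) (γ 1)
  refine ⟨M, fun s => ?_⟩
  rw [h.dist_eq] at h1
  have e1 : dist (0:ℝ) 1 = 1 := by simp
  rw [e1] at h1
  obtain ⟨z, hz⟩ : ∃ z, z = M⁻¹ • γ s := ⟨_, rfl⟩
  have hz' : γ s = M • z := by rw [hz, smul_inv_smul]
  rw [hz']
  congr 1
  have d0 : dist z (pt 0) = |s| := by
    rw [pt_zero, ← dist_smul M, ← hz', h0, h.dist_eq, Real.dist_eq, sub_zero]
  have d1 : dist z (pt 1) = |s - 1| := by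
    rw [← dist_smul M, ← hz', h1, h.dist_eq, Real.dist_eq]
  have c0 := congrArg Real.cosh d0
  have c1 := congrArg Real.cosh d1
  rw [Real.cosh_abs, UpperHalfPlane.cosh_dist, Complex.dist_eq, ← Complex.normSq_eq_norm_sq, Complex.normSq_apply, Real.cosh_eq] at c0 c1
  simp only [Complex.sub_re, Complex.sub_im, UpperHalfPlane.coe_re, UpperHalfPlane.coe_im, pt_im, pt_re] at c0 c1
  have hy := z.im_pos
  have he := Real.exp_pos 1
  rw [Real.exp_zero] at c0
  field_simp at c0 c1
  have f1 : Real.exp (s - 1) = Real.exp s / Real.exp 1 := Real.exp_sub _ _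
  have f2 : Real.exp (-(s - 1)) = Real.exp 1 * Real.exp (-s) := by
    rw [← Real.exp_add]; congr 1; ring
  rw [f1, f2] at c1
  have e3 : Real.exp s * Real.exp (-s) = 1 := by rw [← Real.exp_add]; simp
  have g1 : 1 < Real.exp 1 := Real.one_lt_exp_iff.2 (by norm_num)
  obtain ⟨E, hE⟩ : ∃ E, E = Real.exp 1 := ⟨_, rfl⟩
  rw [← hE] at c1 g1 he
  field_simp at c1
  have hy2 : z.im * Real.exp (-s) = 1 := by
    have : (E ^ 2 - 1) * (z.im * Real.exp (-s) - 1) = 0 := by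
      nlinarith
    rcases mul_eq_zero.1 this with h | h
    · nlinarith
    · linarith
  have hyy : z.im = Real.exp s := by
    have := congrArg (· * Real.exp s) hy2
    rw [mul_assoc, mul_comm (Real.exp (-s)), e3] at this
    linarith
  have hx : z.re = 0 := by
    rw [hyy] at c0
    have : z.re ^ 2 = 0 := by nlinarith
    simpa using this
  rw [ext_iff_re_im, pt_re, pt_im]
  exact ⟨hx, hyy⟩

lemma isometry_frame (M : SL2) : Isometry (fun s => M • pt s) := by
  apply Isometry.of_dist_eq
  intro s t
  rw [dist_smul, dist_pt, Real.dist_eq]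

lemma real_iso {σ : ℝ → ℝ} (h : ∀ s t, |σ s - σ t| = |s - t|) :
    ∃ ε c : ℝ, (ε = 1 ∨ ε = -1) ∧ ∀ s, σ s = ε * s + c := by
  have sq : ∀ s t, (σ s - σ t) ^ 2 = (s - t) ^ 2 := fun s t => by rw [← sq_abs, h, sq_abs]
  refine ⟨σ 1 - σ 0, σ 0, ?_, fun s => ?_⟩
  · have := sq 1 0
    have h1 : (σ 1 - σ 0 - 1) * (σ 1 - σ 0 + 1) = 0 := by nlinarith
    rcases mul_eq_zero.1 h1 with h | h
    · left; linarith
    · right; linarith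
  · have h1 := sq s 0
    have h2 := sq s 1
    have h3 := sq 1 0
    have h4 : (σ s - σ 0) * (σ 1 - σ 0) = s := by nlinarith
    have h5 : (σ 1 - σ 0) * (σ 1 - σ 0) = 1 := by nlinarith
    linear_combination (-(σ s - σ 0)) * h5 + (σ 1 - σ 0) * h4

/-- columns -/
def c1 (M : SL2) : V := (M.1 0 0, M.1 1 0)
def c2 (M : SL2) : V := (M.1 0 1, M.1 1 1)

/-- the flip -/
def jj : SL2 := ⟨!![0, -1; 1, 0], by rw [Matrix.det_fin_two_of]; norm_num⟩
lemma jj00 : jj.1 0 0 = 0 := rfl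
lemma jj01 : jj.1 0 1 = -1 := rfl
lemma jj10 : jj.1 1 0 = 1 := rfl
lemma jj11 : jj.1 1 1 = 0 := rfl

lemma jj_pt (s : ℝ) : jj • pt s = pt (-s) := by
  unfold pt
  rw [← mul_smul, ext_iff_re_im]
  refine ⟨?_, ?_⟩
  · rw [re_smul_I, re_smul_I, mul00, mul01, mul10, mul11, jj00, jj01, jj10, jj11, aa00, aa01, aa10, aa11, aa10, aa01]; simp
  · rw [im_smul_I, im_smul_I, mul10, mul11, jj10, jj11, aa10, aa11, aa00, aa01, aa10, aa11]; simp
lemma c1_jj (M) : c1 (M * jj) = c2 M := by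
  unfold c1 c2; rw [mul00, mul10, jj00, jj10]; ext <;> simp
lemma c2_jj (M) : c2 (M * jj) = - c1 M := by
  unfold c1 c2; rw [mul01, mul11, jj01, jj11]; ext <;> simp

lemma c1_mul (X M : SL2) : c1 (X * M) = act X (c1 M) := by
  unfold c1 act; rw [mul00, mul10]
lemma c2_mul (X M : SL2) : c2 (X * M) = act X (c2 M) := by
  unfold c2 act; rw [mul01, mul11]
lemma dt_c (M : SL2) : dt (c1 M) (c2 M) = 1 := by
  have := det_eq M
  simp only [dt, c1, c2]; linarith
lemma c1_ne (M : SL2) : c1 M ≠ 0 := by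
  intro h; have := dt_c M; rw [h] at this; simp [dt] at this
lemma c2_ne (M : SL2) : c2 M ≠ 0 := by
  intro h; have := dt_c M; rw [h] at this; simp [dt] at this

/-- boundary point of a direction -/
def dirn (v : V) : OnePoint ℝ := if v.2 = 0 then OnePoint.infty else ((v.1 / v.2 : ℝ) : OnePoint ℝ)
def bv (ξ : OnePoint ℝ) : V := (bvec ξ 0, bvec ξ 1)

lemma bv_dirn {v : V} (hv : v ≠ 0) : ∃ c : ℝ, c ≠ 0 ∧ bv (dirn v) = c • v := by
  unfold dirn
  by_cases h : v.2 = 0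
  · have h1 : v.1 ≠ 0 := fun h1 => hv (Prod.ext h1 h)
    refine ⟨v.1⁻¹, inv_ne_zero h1, ?_⟩
    rw [if_pos h]
    show ((1 : ℝ), (0:ℝ)) = _
    ext <;> simp [h, h1]
  · refine ⟨v.2⁻¹, inv_ne_zero h, ?_⟩
    rw [if_neg h]
    show ((v.1 / v.2 : ℝ), (1:ℝ)) = _
    ext
    · simp; ring
    · simp [h]

def NA (X : SL2) (v : V) : Prop := ∃ μ : ℝ, |μ| ≤ 1 ∧ act X v = μ • v

lemma NA_smul {X : SL2} {v : V} {c : ℝ} (hc : c ≠ 0) : NA X (c • v) ↔ NA X v := by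
  unfold NA
  constructor
  · rintro ⟨μ, h1, h2⟩
    refine ⟨μ, h1, ?_⟩
    rw [act_smul, smul_comm] at h2
    exact smul_right_injective _ hc h2
  · rintro ⟨μ, h1, h2⟩
    exact ⟨μ, h1, by rw [act_smul, h2, smul_comm]⟩

lemma act_of_entries {A B : SL2} {ε : ℝ} (h2 : B.1 0 0 = ε * A.1 0 0) (h3 : B.1 0 1 = ε * A.1 0 1)
    (h4 : B.1 1 0 = ε * A.1 1 0) (h5 : B.1 1 1 = ε * A.1 1 1) (v : V) : act B v = ε • act A v := by
  unfold act; rw [h2, h3, h4, h5]; ext <;> simp <;> ring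

lemma nonattr_iff (X : SL2) (ξ : OnePoint ℝ) : HasNonattracting (QuotientGroup.mk X) ξ ↔ NA X (bv ξ) := by
  have hmv : ∀ (A : SL2) (μ : ℝ), A.1.mulVec (bvec ξ) = μ • bvec ξ ↔ act A (bv ξ) = μ • bv ξ := by
    intro A μ
    constructor
    · intro h
      have h0 := congrFun h 0
      have h1 := congrFun h 1
      simp [Matrix.mulVec, dotProduct, Fin.sum_univ_two] at h0 h1
      unfold act bv
      ext
      · simpa using h0
      · simpa using h1
    · intro h
      have h0 := congrArg Prod.fst h
      have h1 := congrArg Prod.snd h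
      simp only [act, bv, Prod.smul_fst, Prod.smul_snd, smul_eq_mul] at h0 h1
      funext i
      fin_cases i
      · simpa [Matrix.mulVec, dotProduct, Fin.sum_univ_two] using h0
      · simpa [Matrix.mulVec, dotProduct, Fin.sum_univ_two] using h1
  unfold HasNonattracting NA
  constructor
  · rintro ⟨A, hA, μ, hμ, h⟩
    obtain ⟨ε, h1, h2, h3, h4, h5⟩ := mk_eq_iff.1 hA
    refine ⟨ε * μ, ?_, ?_⟩
    · have : |ε| = 1 := by rw [← sq_eq_sq₀ (abs_nonneg _) (by norm_num), sq_abs, h1]; norm_num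
      rw [abs_mul, this, one_mul]; exact hμ
    · rw [act_of_entries h2 h3 h4 h5, (hmv A μ).1 h, smul_smul]
  · rintro ⟨μ, hμ, h⟩
    exact ⟨X, rfl, μ, hμ, (hmv X μ).2 h⟩

end geom2
end CK

namespace CK
section geom3
open UpperHalfPlane (I)

lemma frame_im (M : SL2) (s : ℝ) : (M • pt s).im = 1 / (M.1 1 0 ^ 2 * Real.exp s + M.1 1 1 ^ 2 * Real.exp (-s)) := by
  unfold pt
  rw [← mul_smul, im_smul_I, mul10, mul11, aa00, aa01, aa10, aa11]
  congr 1
  have h1 := exp_half_sq s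
  have h2 := exp_half_sq (-s)
  simp only [mul_zero, add_zero, zero_add, mul_pow]
  rw [h1, h2]

lemma frame_re (M : SL2) (s : ℝ) : (M • pt s).re = (M.1 0 0 * M.1 1 0 * Real.exp s + M.1 0 1 * M.1 1 1 * Real.exp (-s)) / (M.1 1 0 ^ 2 * Real.exp s + M.1 1 1 ^ 2 * Real.exp (-s)) := by
  unfold pt
  rw [← mul_smul, re_smul_I, mul10, mul11, mul00, mul01, aa00, aa01, aa10, aa11]
  have h1 := exp_half_sq s
  have h2 := exp_half_sq (-s)
  simp only [mul_zero, add_zero, zero_add, mul_pow]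
  rw [h1, h2]
  congr 1
  linear_combination (M.1 0 0 * M.1 1 0) * h1 + (M.1 0 1 * M.1 1 1) * h2

lemma tendsto_exp_neg2 : Tendsto (fun s : ℝ => Real.exp (-(2 * s))) atTop (𝓝 0) :=
  Real.tendsto_exp_neg_atTop_nhds_zero.comp (tendsto_id.const_mul_atTop (by norm_num : (0:ℝ) < 2))

lemma frame_tendsto (M : SL2) : Tendsto (fun s => embH (M • pt s)) atTop (𝓝 (toC (dirn (c1 M)))) := by
  have e0 : ∀ s : ℝ, Real.exp s * Real.exp (-s) = 1 := fun s => by rw [← Real.exp_add]; simp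
  have e1 : ∀ s : ℝ, Real.exp (-(2*s)) = Real.exp (-s) * Real.exp (-s) := fun s => by rw [← Real.exp_add]; congr 1; ring
  by_cases hc : M.1 1 0 = 0
  · have : toC (dirn (c1 M)) = OnePoint.infty := by
      unfold dirn; rw [if_pos (show (c1 M).2 = 0 from hc)]; rfl
    rw [this]
    have hd : M.1 1 1 ≠ 0 := by
      intro h; have := det_eq M; rw [hc, h] at this; simp at this
    have h2 : Tendsto (fun s => ((M • pt s : ℍ) : ℂ)) atTop (cocompact ℂ) := by
      rw [← Metric.cobounded_eq_cocompact, ← comap_norm_atTop, tendsto_comap_iff]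
      have h3 : Tendsto (fun s : ℝ => (M.1 1 1 ^ 2)⁻¹ * Real.exp s) atTop atTop :=
        Real.tendsto_exp_atTop.const_mul_atTop (by positivity)
      refine tendsto_atTop_mono (fun s => ?_) h3
      have h4 : (M • pt s).im = (M.1 1 1 ^ 2)⁻¹ * Real.exp s := by
        rw [frame_im, hc, Real.exp_neg]; field_simp; simp
      rw [← h4]
      exact (le_abs_self _).trans (Complex.abs_im_le_norm _)
    exact (OnePoint.tendsto_coe_infty (X := ℂ)).comp (by simpa using h2)
  · have : toC (dirn (c1 M)) = (((M.1 0 0 / M.1 1 0 : ℝ) : ℂ) : OnePoint ℂ) := by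
      unfold dirn; rw [if_neg (show ¬ (c1 M).2 = 0 from hc)]; rfl
    rw [this]
    have hre : Tendsto (fun s => (M • pt s).re) atTop (𝓝 (M.1 0 0 / M.1 1 0)) := by
      have : ∀ s, (M • pt s).re = (M.1 0 0 * M.1 1 0 + M.1 0 1 * M.1 1 1 * Real.exp (-(2*s))) / (M.1 1 0 ^ 2 + M.1 1 1 ^ 2 * Real.exp (-(2*s))) := by
        intro s
        have p1 : M.1 1 0 ^ 2 * Real.exp s + M.1 1 1 ^ 2 * Real.exp (-s) ≠ 0 := by positivity
        have p2 : M.1 1 0 ^ 2 + M.1 1 1 ^ 2 * Real.exp (-(2*s)) ≠ 0 := by positivity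
        rw [frame_re, div_eq_div_iff p1 p2, e1]
        have := e0 s
        linear_combination (M.1 0 0 * M.1 1 0 * M.1 1 1 ^2 * Real.exp (-s) - M.1 0 1 * M.1 1 1 * M.1 1 0 ^ 2 * Real.exp (-s)) * this
      simp_rw [this]
      have h := ((tendsto_exp_neg2.const_mul (M.1 0 1 * M.1 1 1)).const_add (M.1 0 0 * M.1 1 0)).div ((tendsto_exp_neg2.const_mul (M.1 1 1 ^ 2)).const_add (M.1 1 0 ^ 2)) (by simpa using hc)
      convert h using 2
      simp; field_simp; ring
    have him : Tendsto (fun s => (M • pt s).im) atTop (𝓝 0) := by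
      have h3 : Tendsto (fun s : ℝ => (M.1 1 0 ^ 2)⁻¹ * Real.exp (-s)) atTop (𝓝 0) := by
        simpa using Real.tendsto_exp_neg_atTop_nhds_zero.const_mul ((M.1 1 0 ^ 2)⁻¹)
      refine squeeze_zero (fun s => (M • pt s).im_pos.le) (fun s => ?_) h3
      rw [frame_im, div_le_iff₀ (by positivity), mul_add]
      have := e0 s
      have h5 : 0 ≤ (M.1 1 0 ^ 2)⁻¹ * Real.exp (-s) * (M.1 1 1 ^ 2 * Real.exp (-s)) := by positivity
      have h6 : (M.1 1 0 ^ 2)⁻¹ * Real.exp (-s) * (M.1 1 0 ^ 2 * Real.exp s) = 1 := by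
        field_simp; linarith
      linarith
    have h1 : Tendsto (fun s => (((M • pt s).re : ℝ) : ℂ) + (((M • pt s).im : ℝ) : ℂ) * Complex.I) atTop (𝓝 ((M.1 0 0 / M.1 1 0 : ℝ) : ℂ)) := by
      have := ((Complex.continuous_ofReal.tendsto _).comp hre).add (((Complex.continuous_ofReal.tendsto _).comp him).mul_const Complex.I)
      simpa using this
    have h2 : Tendsto (fun s => ((M • pt s : ℍ) : ℂ)) atTop (𝓝 ((M.1 0 0 / M.1 1 0 : ℝ) : ℂ)) := by
      refine h1.congr (fun s => ?_)
      exact Complex.re_add_im _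
    exact (OnePoint.continuous_coe.tendsto _).comp h2

lemma toC_inj : Function.Injective toC := by
  intro x y h
  unfold toC at h
  induction x using OnePoint.rec with
  | infty =>
    induction y using OnePoint.rec with
    | infty => rfl
    | coe y => rw [OnePoint.map_infty, OnePoint.map_some] at h; exact absurd h (OnePoint.infty_ne_coe _)
  | coe x =>
    induction y using OnePoint.rec with
    | infty => rw [OnePoint.map_infty, OnePoint.map_some] at h; exact absurd h (OnePoint.coe_ne_infty _)
    | coe y =>
      rw [OnePoint.map_some, OnePoint.map_some] at h
      rw [Complex.ofReal_injective (OnePoint.coe_injective h)]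

def line (M : SL2) : Set ℍ := Set.range (fun s => M • pt s)

lemma line_jj (M : SL2) : line (M * jj) = line M := by
  ext z
  constructor
  · rintro ⟨s, rfl⟩
    exact ⟨-s, by simp only [mul_smul, jj_pt]⟩
  · rintro ⟨s, rfl⟩
    exact ⟨-s, by simp only [mul_smul, jj_pt, neg_neg]⟩

lemma smul_pt_add (s c : ℝ) : aa c • pt s = pt (s + c) := by
  unfold pt
  rw [← mul_smul, ext_iff_re_im]
  rw [re_smul_I, re_smul_I, im_smul_I, im_smul_I, mul00, mul01, mul10, mul11]
  simp only [aa00, aa01, aa10, aa11, mul_zero, zero_mul, add_zero, zero_add]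
  refine ⟨by simp, ?_⟩
  rw [← Real.exp_add]; congr 4; ring

lemma line_frames {M M' : SL2} (h : line M' = line M) :
    (∃ c, ∀ s, M' • pt s = M • pt (s + c)) ∨ (∃ c, ∀ s, M' • pt s = (M * jj) • pt (s + c)) := by
  have : ∀ s, ∃ t, M • pt t = M' • pt s := fun s => by
    have : M' • pt s ∈ line M := h ▸ ⟨s, rfl⟩
    exact this
  choose σ hσ using this
  obtain ⟨ε, c, hε, hs⟩ := real_iso (σ := σ) (fun s t => by
    rw [← dist_pt, ← dist_smul M, hσ, hσ, dist_smul, dist_pt])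
  rcases hε with rfl | rfl
  · left; exact ⟨c, fun s => by rw [← hσ, hs]; congr 2; ring⟩
  · right; exact ⟨-c, fun s => by rw [← hσ, hs, mul_smul, jj_pt]; congr 2; ring⟩

lemma endpoint_iff (M : SL2) (ξ : OnePoint ℝ) : IsEndpoint (line M) ξ ↔ ξ = dirn (c1 M) ∨ ξ = dirn (c2 M) := by
  constructor
  · rintro ⟨γ, h1, h2, h3⟩
    obtain ⟨M', hM'⟩ := geo h1
    have hl : line M' = line M := by
      rw [← h2]; unfold line; congr 1; funext s; exact (hM' s).symm
    have key : ∀ N : SL2, (∃ c, ∀ s, M' • pt s = N • pt (s + c)) → ξ = dirn (c1 N) := by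
      rintro N ⟨c, hc⟩
      have : Tendsto (fun s => embH (γ s)) atTop (𝓝 (toC (dirn (c1 N)))) := by
        have := (frame_tendsto N).comp (tendsto_atTop_add_const_right atTop c tendsto_id)
        refine this.congr (fun s => ?_)
        simp only [Function.comp, id]
        rw [hM', hc]
      exact toC_inj (tendsto_nhds_unique h3 this)
    rcases line_frames hl with h | h
    · left; exact key _ h
    · right; rw [← c1_jj]; exact key _ h
  · rintro (rfl | rfl)
    · exact ⟨_, isometry_frame M, rfl, frame_tendsto M⟩
    · refine ⟨_, isometry_frame (M * jj), line_jj M, ?_⟩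
      rw [← c1_jj]
      exact frame_tendsto _

def Cr (M X : SL2) : Prop := (∃ s, X • (M • pt s) = M • pt s) ∨ NA X (c1 M) ∨ NA X (c2 M)

lemma NA_dirn (X : SL2) {v : V} (hv : v ≠ 0) : NA X (bv (dirn v)) ↔ NA X v := by
  obtain ⟨c, hc, h⟩ := bv_dirn hv
  rw [h, NA_smul hc]

lemma mem_crooked (M X : SL2) : (QuotientGroup.mk X : PSL2) ∈ rightCrooked (line M) ↔ Cr M X := by
  unfold rightCrooked Cr
  rw [Set.mem_ofPred_eq]
  apply or_congr
  · constructor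
    · rintro ⟨x, ⟨s, rfl⟩, h⟩
      rw [psl_mk] at h
      exact ⟨s, h⟩
    · rintro ⟨s, h⟩
      exact ⟨_, ⟨s, rfl⟩, by rw [psl_mk]; exact h⟩
  · constructor
    · rintro ⟨ξ, h1, h2⟩
      rw [nonattr_iff] at h2
      rcases (endpoint_iff M ξ).1 h1 with rfl | rfl
      · left; exact (NA_dirn X (c1_ne M)).1 h2
      · right; exact (NA_dirn X (c2_ne M)).1 h2
    · rintro (h | h)
      · exact ⟨_, (endpoint_iff M _).2 (Or.inl rfl), by rw [nonattr_iff]; exact (NA_dirn X (c1_ne M)).2 h⟩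
      · exact ⟨_, (endpoint_iff M _).2 (Or.inr rfl), by rw [nonattr_iff]; exact (NA_dirn X (c2_ne M)).2 h⟩

lemma NA_neg {X : SL2} {v : V} : NA X (-v) ↔ NA X v := by
  have := NA_smul (X := X) (v := v) (c := -1) (by norm_num)
  simpa using this

lemma Cr_jj (M X : SL2) : Cr (M * jj) X ↔ Cr M X := by
  rw [← mem_crooked, ← mem_crooked, line_jj]

lemma plane_frame {S : Set PSL2} (h : IsRightCrookedPlane S) :
    ∃ G M : SL2, ∀ X : SL2, (QuotientGroup.mk X : PSL2) ∈ S ↔ Cr M (G⁻¹ * X) := by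
  obtain ⟨g, l, ⟨γ, h1, h2⟩, rfl⟩ := h
  obtain ⟨G, rfl⟩ := exists_mk g
  obtain ⟨M, hM⟩ := geo h1
  have hl : l = line M := by rw [← h2]; unfold line; congr 1; funext s; exact hM s
  refine ⟨G, M, fun X => ?_⟩
  rw [← mem_crooked, hl, QuotientGroup.mk_mul, QuotientGroup.mk_inv]
  simp

end geom3
end CK

namespace CK
section geom4
open UpperHalfPlane (I)

lemma smul_left' (c : ℝ) (p q : V) : dt (c • p) q = c * dt p q := by
  unfold dt; simp; ring
lemma smul_right' (c : ℝ) (p q : V) : dt p (c • q) = c * dt p q := by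
  unfold dt; simp; ring
lemma dt_neg_right (p q : V) : dt p (-q) = - dt p q := by
  unfold dt; simp; ring
lemma dt_neg_left (p q : V) : dt (-p) q = - dt p q := by
  unfold dt; simp; ring

lemma cosh_frames (M M' : SL2) (s s' : ℝ) : 2 * Real.cosh (dist (M • pt s) (M' • pt s')) =
    Real.exp (s + s') * dt (c1 M) (c1 M') ^ 2 + Real.exp (s - s') * dt (c1 M) (c2 M') ^ 2
    + Real.exp (-s + s') * dt (c2 M) (c1 M') ^ 2 + Real.exp (-s - s') * dt (c2 M) (c2 M') ^ 2 := by
  have e1 : Real.exp (s + s') = (Real.exp (s/2) * Real.exp (s'/2))^2 := by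
    rw [mul_pow, exp_half_sq, exp_half_sq, Real.exp_add]
  have e2 : Real.exp (s - s') = (Real.exp (s/2) * Real.exp (-s'/2))^2 := by
    rw [mul_pow, exp_half_sq, exp_half_sq, ← Real.exp_add]; rfl
  have e3 : Real.exp (-s + s') = (Real.exp (-s/2) * Real.exp (s'/2))^2 := by
    rw [mul_pow, exp_half_sq, exp_half_sq, Real.exp_add]
  have e4 : Real.exp (-s - s') = (Real.exp (-s/2) * Real.exp (-s'/2))^2 := by
    rw [mul_pow, exp_half_sq, exp_half_sq, ← Real.exp_add]; rfl
  rw [e1, e2, e3, e4]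
  unfold pt
  rw [← mul_smul, ← mul_smul, two_cosh]
  unfold SS
  simp only [mul00, mul01, mul10, mul11, inv00, inv01, inv10, inv11, aa00, aa01, aa10, aa11, dt, c1, c2]
  ring

lemma lead_le {α α' C : ℝ} (h : ∀ T : ℝ, 0 ≤ T → Real.exp (T + T) * α ≤ Real.exp (T + T) * α' + C) : α ≤ α' := by
  by_contra hc
  push Not at hc
  have hp : 0 < α - α' := by linarith
  obtain ⟨T, hT⟩ : ∃ T, T = |C| / (α - α') := ⟨_, rfl⟩
  have hT0 : 0 ≤ T := by rw [hT]; positivity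
  have h1 := h T hT0
  have h2 : T * (α - α') = |C| := by rw [hT]; field_simp
  have h3 := Real.add_one_le_exp (T + T)
  have h4 := le_abs_self C
  have h5 : (T + T + 1) * (α - α') ≤ Real.exp (T+T) * (α - α') := mul_le_mul_of_nonneg_right h3 hp.le
  have h6 := abs_nonneg C
  nlinarith

lemma lead_cosh {M M' N N' : SL2} (h : ∀ T : ℝ, 0 ≤ T → dist (M • pt T) (M' • pt T) ≤ dist (N • pt T) (N' • pt T)) :
    dt (c1 M) (c1 M') ^ 2 ≤ dt (c1 N) (c1 N') ^ 2 := by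
  apply lead_le (C := dt (c1 N) (c2 N') ^ 2 + dt (c2 N) (c1 N') ^ 2 + dt (c2 N) (c2 N') ^ 2)
  intro T hT
  have h1 : Real.cosh (dist (M • pt T) (M' • pt T)) ≤ Real.cosh (dist (N • pt T) (N' • pt T)) :=
    Real.cosh_le_cosh.2 (by rw [abs_of_nonneg dist_nonneg, abs_of_nonneg dist_nonneg]; exact h T hT)
  have h2 := cosh_frames M M' T T
  have h3 := cosh_frames N N' T T
  rw [sub_self, neg_add_cancel, Real.exp_zero] at h2 h3
  have h4 : Real.exp (-T - T) ≤ 1 := Real.exp_le_one_iff.2 (by linarith)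
  have h5 := Real.exp_pos (-T - T)
  have h6 : Real.exp (-T - T) * dt (c2 N) (c2 N') ^ 2 ≤ dt (c2 N) (c2 N') ^ 2 := mul_le_of_le_one_left (sq_nonneg _) h4
  have h7 : 0 ≤ Real.exp (-T - T) * dt (c2 M) (c2 M') ^ 2 := by positivity
  nlinarith [sq_nonneg (dt (c1 M) (c2 M')), sq_nonneg (dt (c2 M) (c1 M'))]

lemma exists_map {u w u' w' : V} (h : dt u w = dt u' w') (h0 : dt u w ≠ 0) : ∃ X : SL2, act X u = u' ∧ act X w = w' := by
  have h0' : dt u' w' ≠ 0 := h ▸ h0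
  have hd : (u'.1 * w.2 - w'.1 * u.2) / dt u w * ((w'.2 * u.1 - u'.2 * w.1) / dt u w) -
    (w'.1 * u.1 - u'.1 * w.1) / dt u w * ((u'.2 * w.2 - w'.2 * u.2) / dt u w) = 1 := by
    have : (u'.1 * w.2 - w'.1 * u.2) * (w'.2 * u.1 - u'.2 * w.1) - (w'.1 * u.1 - u'.1 * w.1) * (u'.2 * w.2 - w'.2 * u.2) = dt u w * dt u' w' := by
      unfold dt; ring
    rw [← h] at this
    field_simp
    linarith
  refine ⟨⟨!![(u'.1 * w.2 - w'.1 * u.2) / dt u w, (w'.1 * u.1 - u'.1 * w.1) / dt u w;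
    (u'.2 * w.2 - w'.2 * u.2) / dt u w, (w'.2 * u.1 - u'.2 * w.1) / dt u w], by
      rw [Matrix.det_fin_two_of]; exact hd⟩, ?_, ?_⟩
  · unfold act
    ext
    · simp; field_simp; unfold dt; ring
    · simp; field_simp; unfold dt; ring
  · unfold act
    ext
    · simp; field_simp; unfold dt; ring
    · simp; field_simp; unfold dt; ring

def Dj (G M G' M' : SL2) : Prop := ∀ X : SL2, Cr M (G⁻¹ * X) → Cr M' (G'⁻¹ * X) → False

lemma Dj.symm {G M G' M' : SL2} (h : Dj G M G' M') : Dj G' M' G M := fun X a b => h X b a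
lemma Dj.jr {G M G' M' : SL2} (h : Dj G M G' M') : Dj G M G' (M' * jj) := fun X a b => h X a ((Cr_jj _ _).1 b)
lemma Dj.jl {G M G' M' : SL2} (h : Dj G M G' M') : Dj G (M * jj) G' M' := fun X a b => h X ((Cr_jj _ _).1 a) b

lemma Cr_stem {G M X : SL2} {s : ℝ} (h : X • M • pt s = G • M • pt s) : Cr M (G⁻¹ * X) :=
  Or.inl ⟨s, by rw [mul_smul, h, inv_smul_smul]⟩
lemma Cr_wing1 {G M X : SL2} {μ : ℝ} (hμ : |μ| ≤ 1) (h : act X (c1 M) = μ • act G (c1 M)) : Cr M (G⁻¹ * X) :=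
  Or.inr (Or.inl ⟨μ, hμ, by rw [act_mul, h, act_smul, act_inv_act]⟩)

lemma Dj.ne {G M G' M' : SL2} (h : Dj G M G' M') (s s' : ℝ) :
    dist (G • M • pt s) (G' • M' • pt s') ≠ dist (M • pt s) (M' • pt s') := by
  intro he
  obtain ⟨X, h1, h2⟩ := two_point he.symm
  exact h X (Cr_stem h1) (Cr_stem h2)

lemma Dj.not_ge {G M G' M' : SL2} (h : Dj G M G' M') (h0 : dt (c1 M) (c1 M') ≠ 0)
    (hd : ∀ s s', dist (M • pt s) (M' • pt s') ≤ dist (G • M • pt s) (G' • M' • pt s')) : False := by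
  have h1 : dt (c1 M) (c1 M') ^ 2 ≤ dt (c1 (G * M)) (c1 (G' * M')) ^ 2 := by
    apply lead_cosh
    intro T _
    rw [mul_smul, mul_smul]; exact hd T T
  rw [c1_mul, c1_mul] at h1
  obtain ⟨a, ha⟩ : ∃ a, a = dt (c1 M) (c1 M') := ⟨_, rfl⟩
  obtain ⟨b, hb⟩ : ∃ b, b = dt (act G (c1 M)) (act G' (c1 M')) := ⟨_, rfl⟩
  rw [← ha, ← hb] at h1
  rw [← ha] at h0
  have hb0 : b ≠ 0 := by
    rintro rfl
    have : 0 < a ^ 2 := by positivity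
    nlinarith
  obtain ⟨X, hX1, hX2⟩ := exists_map (u := c1 M) (w := c1 M') (u' := (a / b) • act G (c1 M)) (w' := act G' (c1 M')) (by
    rw [smul_left', ← hb, ← ha]; field_simp) (by rw [← ha]; exact h0)
  refine h X (Cr_wing1 (μ := a / b) ?_ hX1) (Cr_wing1 (μ := 1) (by simp) (by rw [one_smul]; exact hX2))
  rw [abs_div, div_le_one (abs_pos.2 hb0)]
  exact sq_le_sq.1 h1

lemma dt_ne_or {v : V} (hv : v ≠ 0) (M : SL2) : dt v (c1 M) ≠ 0 ∨ dt v (c2 M) ≠ 0 := by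
  by_contra hc
  push Not at hc
  obtain ⟨h1, h2⟩ := hc
  have h3 := dt_c M
  apply hv
  have : v = (dt v (c2 M)) • c1 M - (dt v (c1 M)) • c2 M := by
    unfold dt at h3 ⊢
    ext
    · simp; linear_combination (-v.1) * h3
    · simp; linear_combination (-v.2) * h3
  rw [this, h1, h2]; simp

lemma continuous_frame (M : SL2) : Continuous (fun s => M • pt s) := (isometry_frame M).continuous

/-- disjoint crooked planes: the assigned isometries contract distances strictly -/
lemma Dj.lt {G M G' M' : SL2} (h : Dj G M G' M') (s s' : ℝ) :
    dist (G • M • pt s) (G' • M' • pt s') < dist (M • pt s) (M' • pt s') := by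
  have hc : Continuous (fun p : ℝ × ℝ => dist (G • M • pt p.1) (G' • M' • pt p.2) - dist (M • pt p.1) (M' • pt p.2)) := by
    have k : ∀ N : SL2, Continuous (fun p : ℝ × ℝ => N • pt p.1) := fun N => (continuous_frame N).comp continuous_fst
    have k' : ∀ N : SL2, Continuous (fun p : ℝ × ℝ => N • pt p.2) := fun N => (continuous_frame N).comp continuous_snd
    have := ((k (G * M)).dist (k' (G' * M'))).sub ((k M).dist (k' M'))
    simp only [mul_smul] at this
    exact this
  by_contra hge
  push Not at hge
  have hpos : ∀ t t', dist (M • pt t) (M' • pt t') ≤ dist (G • M • pt t) (G' • M' • pt t') := by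
    intro t t'
    by_contra hlt
    push Not at hlt
    have hp : IsPreconnected (Set.univ : Set (ℝ × ℝ)) := isPreconnected_univ
    obtain ⟨p, _, hp0⟩ := hp.intermediate_value (Set.mem_univ (t, t')) (Set.mem_univ (s, s')) hc.continuousOn
      (show (0:ℝ) ∈ Set.Icc _ _ from ⟨by simp; linarith, by simp; linarith⟩)
    exact h.ne p.1 p.2 (by linarith)
  rcases dt_ne_or (c1_ne M) M' with h1 | h1
  · exact h.not_ge h1 hpos
  · refine h.jr.not_ge (by rw [c1_jj]; exact h1) (fun t t' => ?_)
    rw [mul_smul, jj_pt]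
    exact hpos _ _

lemma Dj.dt11 {G M G' M' : SL2} (h : Dj G M G' M') : dt (c1 M) (c1 M') ≠ 0 := by
  intro h0
  have h1 : dt (c1 (G * M)) (c1 (G' * M')) ^ 2 ≤ dt (c1 M) (c1 M') ^ 2 := by
    apply lead_cosh
    intro T _
    rw [mul_smul, mul_smul]; exact (h.lt T T).le
  rw [h0] at h1
  have h2 : dt (c1 (G * M)) (c1 (G' * M')) = 0 := by nlinarith [sq_nonneg (dt (c1 (G * M)) (c1 (G' * M')))]
  obtain ⟨κ, hκ⟩ := par (c1_ne M) h0
  obtain ⟨ν, hν⟩ := par (c1_ne _) h2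
  rw [c1_mul, c1_mul] at hν
  have hκ0 : κ ≠ 0 := by rintro rfl; rw [zero_smul] at hκ; exact c1_ne _ hκ
  have hν0 : ν ≠ 0 := by rintro rfl; rw [zero_smul, ← c1_mul] at hν; exact c1_ne _ hν
  obtain ⟨μ, hμ⟩ : ∃ μ, μ = min 1 (|ν| / |κ|) := ⟨_, rfl⟩
  have hμ0 : 0 < μ := by rw [hμ]; exact lt_min one_pos (by positivity)
  have hμ1 : μ ≤ 1 := by rw [hμ]; exact min_le_left _ _
  have hμ2 : μ ≤ |ν| / |κ| := by rw [hμ]; exact min_le_right _ _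
  obtain ⟨X, hX1, hX2⟩ := exists_map (u := c1 M) (w := c2 M) (u' := μ • act G (c1 M)) (w' := μ⁻¹ • act G (c2 M)) (by
    rw [smul_left', smul_right', dt_act]; field_simp) (by rw [dt_c]; norm_num)
  refine h X (Cr_wing1 (μ := μ) (by rw [abs_of_pos hμ0]; exact hμ1) hX1) (Cr_wing1 (μ := κ * μ / ν) ?_ ?_)
  · rw [abs_div, abs_mul, abs_of_pos hμ0, div_le_one (abs_pos.2 hν0)]
    rwa [le_div_iff₀ (abs_pos.2 hκ0), mul_comm] at hμ2
  · rw [hν, hκ, act_smul, hX1, smul_smul, smul_smul]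
    congr 1; field_simp

lemma Dj.dt12 {G M G' M' : SL2} (h : Dj G M G' M') : dt (c1 M) (c2 M') ≠ 0 := by
  rw [← c1_jj]; exact h.jr.dt11
lemma Dj.dt21 {G M G' M' : SL2} (h : Dj G M G' M') : dt (c2 M) (c1 M') ≠ 0 := by
  rw [← c1_jj]; exact h.jl.dt11
lemma Dj.dt22 {G M G' M' : SL2} (h : Dj G M G' M') : dt (c2 M) (c2 M') ≠ 0 := by
  rw [← c1_jj]; exact h.jl.dt12

end geom4
end CK

namespace CK
section geom5
open UpperHalfPlane (I)

lemma fix_I {B : SL2} (h : B • I = I) : B.1 0 0 = B.1 1 1 ∧ B.1 0 1 = - B.1 1 0 := by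
  have h1 := two_cosh_I B
  rw [h, dist_self, Real.cosh_zero] at h1
  unfold SS at h1
  have h2 := det_eq B
  have h3 : (B.1 0 0 - B.1 1 1) ^ 2 + (B.1 0 1 + B.1 1 0) ^ 2 = 0 := by nlinarith
  have h4 : (B.1 0 0 - B.1 1 1) ^ 2 = 0 := by nlinarith [sq_nonneg (B.1 0 0 - B.1 1 1), sq_nonneg (B.1 0 1 + B.1 1 0)]
  have h5 : (B.1 0 1 + B.1 1 0) ^ 2 = 0 := by nlinarith [sq_nonneg (B.1 0 0 - B.1 1 1), sq_nonneg (B.1 0 1 + B.1 1 0)]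
  rw [sq_eq_zero_iff] at h4 h5
  exact ⟨by linarith, by linarith⟩

lemma fix_pt {B : SL2} {s : ℝ} (h : B • pt s = pt s) :
    B.1 0 0 = B.1 1 1 ∧ Real.exp (-s) * B.1 0 1 = - (Real.exp s * B.1 1 0) := by
  have h1 : (aa (-s) * B * aa s) • I = I := by
    rw [mul_smul, mul_smul]
    show aa (-s) • B • pt s = I
    rw [h, smul_pt_add, add_neg_cancel, pt_zero]
  obtain ⟨h2, h3⟩ := fix_I h1
  simp only [mul00, mul01, mul10, mul11, aa00, aa01, aa10, aa11] at h2 h3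
  have e1 := exp_half_sq s
  have e2 := exp_half_sq (-s)
  have e3 : Real.exp (s/2) * Real.exp (-s/2) = 1 := by rw [← Real.exp_add]; ring_nf; simp
  rw [neg_neg] at h2 h3
  constructor
  · linear_combination h2 + (B.1 1 1 - B.1 0 0) * e3
  · linear_combination h3 - B.1 0 1 * e2 - B.1 1 0 * e1

lemma conj_smul (M Y : SL2) (z : ℍ) : Y • M • z = M • z ↔ (M⁻¹ * Y * M) • z = z := by
  rw [mul_smul, mul_smul, inv_smul_eq_iff]

lemma NA_c1 {M Y : SL2} (h : NA Y (c1 M)) : (M⁻¹ * Y * M).1 1 0 = 0 := by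
  obtain ⟨μ, _, h⟩ := h
  have h1 : c1 (M⁻¹ * Y * M) = μ • c1 1 := by
    rw [c1_mul, act_mul, h, act_smul, ← c1_mul, inv_mul_cancel]
  have := congrArg Prod.snd h1
  simpa [c1] using this
lemma NA_c2 {M Y : SL2} (h : NA Y (c2 M)) : (M⁻¹ * Y * M).1 0 1 = 0 := by
  obtain ⟨μ, _, h⟩ := h
  have h1 : c2 (M⁻¹ * Y * M) = μ • c2 1 := by
    rw [c2_mul, act_mul, h, act_smul, ← c2_mul, inv_mul_cancel]
  have := congrArg Prod.fst h1
  simpa [c2] using this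

lemma Cr_coords {M Y : SL2} (h : Cr M Y) : ((M⁻¹ * Y * M).1 0 0 + (M⁻¹ * Y * M).1 1 1) ^ 2 ≤ 4 ∨
    (M⁻¹ * Y * M).1 0 1 = 0 ∨ (M⁻¹ * Y * M).1 1 0 = 0 := by
  rcases h with ⟨s, h⟩ | h | h
  · left
    rw [conj_smul] at h
    obtain ⟨h1, h2⟩ := fix_pt h
    have h3 := det_eq (M⁻¹ * Y * M)
    obtain ⟨B, hB⟩ : ∃ B, B = M⁻¹ * Y * M := ⟨_, rfl⟩
    rw [← hB] at h h1 h2 h3 ⊢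
    have h4 : B.1 0 1 = - (Real.exp s * Real.exp s) * B.1 1 0 := by
      have e : Real.exp s * Real.exp (-s) = 1 := by rw [← Real.exp_add]; simp
      linear_combination (-B.1 0 1) * e + Real.exp s * h2
    rw [h4] at h3
    have h5 : 0 ≤ (Real.exp s * B.1 1 0) ^ 2 := sq_nonneg _
    rw [← h1] at h3 ⊢
    nlinarith
  · right; right; exact NA_c1 h
  · right; left; exact NA_c2 h

lemma form_ne {x y α β : ℝ} (h : x ≠ 0 ∨ y ≠ 0) (h1 : x * Real.cos α + y * Real.sin α = 0)
    (h2 : x * Real.cos β + y * Real.sin β = 0) (hs : Real.sin (β - α) ≠ 0) : False := by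
  rw [Real.sin_sub] at hs
  have hx : x * (Real.sin β * Real.cos α - Real.cos β * Real.sin α) = 0 := by
    linear_combination Real.sin β * h1 - Real.sin α * h2
  have hy : y * (Real.sin β * Real.cos α - Real.cos β * Real.sin α) = 0 := by
    linear_combination Real.cos α * h2 - Real.cos β * h1
  rcases h with h | h
  · exact (mul_ne_zero h hs) hx
  · exact (mul_ne_zero h hs) hy

lemma avoid {x y x' y' η : ℝ} (h : x ≠ 0 ∨ y ≠ 0) (h' : x' ≠ 0 ∨ y' ≠ 0) (h0 : 0 < η) (h1 : η < Real.pi / 2) :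
    ∃ θ, |θ| ≤ η ∧ x * Real.cos θ + y * Real.sin θ ≠ 0 ∧ x' * Real.cos θ + y' * Real.sin θ ≠ 0 := by
  by_contra hc
  push Not at hc
  have a0 := hc 0 (by simp; exact h0.le)
  have a1 := hc (η) (by rw [abs_of_pos h0])
  have a2 := hc (-η) (by rw [abs_neg, abs_of_pos h0])
  have s1 : Real.sin (η - 0) ≠ 0 := (Real.sin_pos_of_pos_of_lt_pi (by linarith) (by linarith)).ne'
  have s2 : Real.sin (0 - -η) ≠ 0 := (Real.sin_pos_of_pos_of_lt_pi (by linarith) (by linarith)).ne'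
  have s3 : Real.sin (η - -η) ≠ 0 := (Real.sin_pos_of_pos_of_lt_pi (by linarith) (by linarith)).ne'
  by_cases b0 : x * Real.cos 0 + y * Real.sin 0 = 0
  · have b1 : x * Real.cos η + y * Real.sin η ≠ 0 := fun b => form_ne h b0 b s1
    have b2 : x * Real.cos (-η) + y * Real.sin (-η) ≠ 0 := fun b => form_ne h b b0 s2
    exact form_ne h' (a2 b2) (a1 b1) s3
  · have c0 := a0 b0
    by_cases b1 : x * Real.cos η + y * Real.sin η = 0
    · have b2 : x * Real.cos (-η) + y * Real.sin (-η) ≠ 0 := fun b => form_ne h b b1 s3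
      exact form_ne h' (a2 b2) c0 s2
    · exact form_ne h' c0 (a1 b1) s1

lemma form_nz {p q z w : ℝ} (h : ¬ (p = 0 ∧ q = 0)) (h' : ¬ (z = 0 ∧ w = 0)) : p * z + q * w ≠ 0 ∨ q * z - p * w ≠ 0 := by
  by_contra hc
  push Not at hc
  have : (p ^ 2 + q ^ 2) * (z ^ 2 + w ^ 2) = 0 := by
    have : (p ^ 2 + q ^ 2) * (z ^ 2 + w ^ 2) = (p * z + q * w) ^ 2 + (q * z - p * w) ^ 2 := by ring
    rw [this, hc.1, hc.2]; ring
  rcases mul_eq_zero.1 this with h1 | h1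
  · exact h ⟨by nlinarith [sq_nonneg p, sq_nonneg q], by nlinarith [sq_nonneg p, sq_nonneg q]⟩
  · exact h' ⟨by nlinarith [sq_nonneg z, sq_nonneg w], by nlinarith [sq_nonneg z, sq_nonneg w]⟩

lemma circle_sub {M : SL2} {u v : ℍ} (h : ∀ Y : SL2, Y • u = v → Cr M Y) : u = v := by
  by_contra hne
  obtain ⟨D, hD⟩ : ∃ D, D = dist u v := ⟨_, rfl⟩
  have hD0 : 0 < D := by rw [hD]; exact dist_pos.2 hne
  obtain ⟨A, hA1, hA2⟩ := exists_frame u v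
  rw [← hD] at hA2
  obtain ⟨κ, hκ⟩ : ∃ κ, κ = Real.exp (D / 2) + Real.exp (-D / 2) := ⟨_, rfl⟩
  have hκ2 : 2 < κ := by
    have := (Real.one_lt_cosh (x := D / 2)).2 (by positivity)
    rw [Real.cosh_eq, ← neg_div, ← hκ] at this
    linarith
  -- small angle
  obtain ⟨η, hη0, hη1, hη2⟩ : ∃ η, 0 < η ∧ η < Real.pi / 2 ∧ ∀ θ, |θ| ≤ η → 2 < κ * Real.cos θ := by
    have hc : Tendsto (fun θ => κ * Real.cos θ) (𝓝 0) (𝓝 (κ * Real.cos 0)) := (Real.continuous_cos.tendsto 0).const_mul κ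
    have := hc.eventually (lt_mem_nhds (by simpa using hκ2 : 2 < κ * Real.cos 0))
    obtain ⟨δ, hδ, hb⟩ := Metric.eventually_nhds_iff.1 this
    refine ⟨min (δ / 2) 1, lt_min (by positivity) one_pos, lt_of_le_of_lt (min_le_right _ _) (by linarith [Real.pi_gt_three]), fun θ hθ => hb ?_⟩
    rw [Real.dist_eq, sub_zero]
    have := min_le_left (δ / 2) 1
    linarith
  obtain ⟨P, hP⟩ : ∃ P, P = M⁻¹ * A := ⟨_, rfl⟩
  have hPd := det_eq P
  have ea := Real.exp_pos (D / 2)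
  have eb := Real.exp_pos (-D / 2)
  obtain ⟨ca, hca⟩ : ∃ t, t = Real.exp (D / 2) := ⟨_, rfl⟩
  obtain ⟨cb, hcb⟩ : ∃ t, t = Real.exp (-D / 2) := ⟨_, rfl⟩
  rw [← hca] at ea
  rw [← hcb] at eb
  have hab : ca * cb = 1 := by rw [hca, hcb, ← Real.exp_add]; ring_nf; simp
  have r0 : ¬ (P.1 0 0 * ca = 0 ∧ P.1 0 1 * cb = 0) := by
    rintro ⟨h1, h2⟩
    have h1' := (mul_eq_zero.1 h1).resolve_right ea.ne'
    have h2' := (mul_eq_zero.1 h2).resolve_right eb.ne'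
    rw [h1', h2'] at hPd; simp at hPd
  have r1 : ¬ (P.1 1 0 * ca = 0 ∧ P.1 1 1 * cb = 0) := by
    rintro ⟨h1, h2⟩
    have h1' := (mul_eq_zero.1 h1).resolve_right ea.ne'
    have h2' := (mul_eq_zero.1 h2).resolve_right eb.ne'
    rw [h1', h2'] at hPd; simp at hPd
  have q0 : ¬ (-P.1 0 1 = 0 ∧ P.1 0 0 = 0) := by
    rintro ⟨h1, h2⟩
    rw [neg_eq_zero] at h1
    rw [h1, h2] at hPd; simp at hPd
  have q1 : ¬ (P.1 1 1 = 0 ∧ -P.1 1 0 = 0) := by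
    rintro ⟨h1, h2⟩
    rw [neg_eq_zero] at h2
    rw [h1, h2] at hPd; simp at hPd
  obtain ⟨θ, hθ, f1, f2⟩ := avoid (form_nz r0 q0) (form_nz r1 q1) hη0 hη1
  have hY := h (A * aa D * rr θ * A⁻¹) (by
    rw [← hA1, mul_smul, inv_smul_smul, mul_smul, rr_I, mul_smul]; exact hA2)
  have hco : M⁻¹ * (A * aa D * rr θ * A⁻¹) * M = P * aa D * rr θ * P⁻¹ := by rw [hP]; group
  have hc := Cr_coords hY
  rw [hco] at hc
  simp only [mul00, mul01, mul10, mul11, inv00, inv01, inv10, inv11, aa00, aa01, aa10, aa11, rr00, rr01, rr10, rr11, ← hca, ← hcb, mul_zero, zero_add, add_zero] at hc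
  rcases hc with hc | hc | hc
  · have h1 := hη2 θ hθ
    rw [hκ, ← hca, ← hcb] at h1
    have h2 : (P.1 0 0 * ca * Real.cos θ + P.1 0 1 * cb * Real.sin θ) * P.1 1 1 +
          (P.1 0 0 * ca * -Real.sin θ + P.1 0 1 * cb * Real.cos θ) * -P.1 1 0 +
        ((P.1 1 0 * ca * Real.cos θ + P.1 1 1 * cb * Real.sin θ) * -P.1 0 1 +
          (P.1 1 0 * ca * -Real.sin θ + P.1 1 1 * cb * Real.cos θ) * P.1 0 0) = (ca + cb) * Real.cos θ := by
      linear_combination ((ca + cb) * Real.cos θ) * hPd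
    rw [h2] at hc
    nlinarith
  · exact f1 (by linear_combination hc)
  · exact f2 (by linear_combination hc)

lemma fix_line {M H : SL2} (h : ∀ s, H • M • pt s = M • pt s) : (QuotientGroup.mk H : PSL2) = 1 := by
  have h0 := (conj_smul M H _).1 (h 0)
  have h1 := (conj_smul M H _).1 (h 1)
  obtain ⟨B, hB⟩ : ∃ B, B = M⁻¹ * H * M := ⟨_, rfl⟩
  rw [← hB] at h0 h1
  have hH : H = M * B * M⁻¹ := by rw [hB]; group
  obtain ⟨a1, a2⟩ := fix_pt h0
  obtain ⟨_, b2⟩ := fix_pt h1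
  rw [neg_zero, Real.exp_zero, one_mul, one_mul] at a2
  have e1 : 1 < Real.exp 1 := Real.one_lt_exp_iff.2 (by norm_num)
  have e2 : Real.exp (-1) < 1 := Real.exp_lt_one_iff.2 (by norm_num)
  have hc : B.1 1 0 = 0 := by
    rw [a2] at b2
    have : (Real.exp 1 - Real.exp (-1)) * B.1 1 0 = 0 := by linarith
    exact (mul_eq_zero.1 this).resolve_left (by linarith)
  have hb : B.1 0 1 = 0 := by rw [a2, hc, neg_zero]
  have hd := det_eq B
  have : (QuotientGroup.mk B : PSL2) = 1 := by
    rw [QuotientGroup.eq_one_iff, mem_center]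
    exact ⟨B.1 0 0, by rw [← a1, hb] at hd; linarith, rfl, hb, hc, a1.symm⟩
  rw [hH, QuotientGroup.mk_mul, QuotientGroup.mk_mul, this, mul_one, ← QuotientGroup.mk_mul, mul_inv_cancel, QuotientGroup.mk_one]

lemma plane_eq {G M G' M' : SL2} (h : ∀ X, Cr M (G⁻¹ * X) ↔ Cr M' (G'⁻¹ * X)) : (QuotientGroup.mk G : PSL2) = QuotientGroup.mk G' := by
  have h1 : (QuotientGroup.mk (G'⁻¹ * G) : PSL2) = 1 := by
    apply fix_line (M := M)
    intro s
    symm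
    apply circle_sub (M := M')
    intro Y hY
    have := (h (G' * Y)).1 (Cr_stem (s := s) (by
      rw [mul_smul, hY, mul_smul, smul_inv_smul]))
    rwa [inv_mul_cancel_left] at this
  rw [QuotientGroup.mk_mul, QuotientGroup.mk_inv, inv_mul_eq_one] at h1
  exact h1.symm

end geom5
end CK

namespace CK
section top1
open UpperHalfPlane (I)

lemma top_eq : (instTopologicalSpaceSL2 : TopologicalSpace SL2) = Matrix.SpecialLinearGroup.instTopologicalSpace := rfl

instance : IsTopologicalGroup SL2 := @Matrix.SpecialLinearGroup.topologicalGroup (Fin 2) ℝ _ _ _ _ _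
instance : ContinuousSMul SL2 ℍ := UpperHalfPlane.instContinuousSMulSL2R

lemma cont_entry (i k : Fin 2) : Continuous (fun A : SL2 => A.1 i k) :=
  Continuous.matrix_elem continuous_induced_dom i k

lemma cont_of_entries {α : Type*} [TopologicalSpace α] {f : α → SL2} (h : ∀ i k, Continuous fun x => (f x).1 i k) : Continuous f :=
  continuous_induced_rng.2 (continuous_matrix h)

lemma isClosed_center : IsClosed ((Subgroup.center SL2 : Subgroup SL2) : Set SL2) := by
  have : ((Subgroup.center SL2 : Subgroup SL2) : Set SL2) = {Z : SL2 | Z.1 0 1 = 0 ∧ Z.1 1 0 = 0 ∧ Z.1 0 0 = Z.1 1 1} := by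
    ext Z
    rw [SetLike.mem_coe, mem_center, Set.mem_ofPred_eq]
    constructor
    · rintro ⟨ε, h1, h2, h3, h4, h5⟩
      exact ⟨h3, h4, by rw [h2, h5]⟩
    · rintro ⟨h1, h2, h3⟩
      have := det_eq Z
      exact ⟨Z.1 0 0, by rw [← h3, h1] at this; linarith, rfl, h1, h2, h3.symm⟩
  rw [this]
  exact (isClosed_eq (cont_entry 0 1) continuous_const).inter ((isClosed_eq (cont_entry 1 0) continuous_const).inter (isClosed_eq (cont_entry 0 0) (cont_entry 1 1)))

instance : T1Space PSL2 := by
  have := isClosed_center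
  exact QuotientGroup.instT1Space

instance : IsTopologicalGroup PSL2 := inferInstance

lemma cont_mk : Continuous (fun A : SL2 => (QuotientGroup.mk A : PSL2)) := QuotientGroup.continuous_mk

lemma cont_psl (z : ℍ) : Continuous (fun x : PSL2 => pslSMul x z) := by
  rw [(QuotientGroup.isQuotientMap_mk (N := Subgroup.center SL2)).continuous_iff]
  have : (fun x : PSL2 => pslSMul x z) ∘ (QuotientGroup.mk : SL2 → PSL2) = fun A => A • z := by
    funext A; exact psl_mk A z
  rw [this]
  exact continuous_id.smul continuous_const

lemma compact_SS (C : ℝ) : IsCompact {A : SL2 | SS A ≤ C} := by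
  have hce : IsClosedEmbedding (fun A : SL2 => A.1) := Matrix.SpecialLinearGroup.isClosedEmbedding_val
  have hK : IsCompact (Set.univ.pi fun _ : Fin 2 => Set.univ.pi fun _ : Fin 2 => Set.Icc (-(C + 1)) (C + 1)) :=
    isCompact_univ_pi fun _ => isCompact_univ_pi fun _ => isCompact_Icc
  have h1 := hce.isCompact_preimage (K := (Set.univ.pi fun _ : Fin 2 => Set.univ.pi fun _ : Fin 2 => Set.Icc (-(C + 1)) (C + 1))) hK
  refine h1.of_isClosed_subset ?_ ?_
  · refine isClosed_le ?_ continuous_const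
    unfold SS
    exact ((((cont_entry 0 0).pow 2).add ((cont_entry 0 1).pow 2)).add ((cont_entry 1 0).pow 2)).add ((cont_entry 1 1).pow 2)
  · intro A hA
    rw [Set.mem_ofPred_eq] at hA
    unfold SS at hA
    intro i _ k _
    have hb : A.1 i k ^ 2 ≤ C := by
      fin_cases i <;> fin_cases k
      · show A.1 0 0 ^ 2 ≤ C
        nlinarith [sq_nonneg (A.1 0 0), sq_nonneg (A.1 0 1), sq_nonneg (A.1 1 0), sq_nonneg (A.1 1 1)]
      · show A.1 0 1 ^ 2 ≤ C
        nlinarith [sq_nonneg (A.1 0 0), sq_nonneg (A.1 0 1), sq_nonneg (A.1 1 0), sq_nonneg (A.1 1 1)]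
      · show A.1 1 0 ^ 2 ≤ C
        nlinarith [sq_nonneg (A.1 0 0), sq_nonneg (A.1 0 1), sq_nonneg (A.1 1 0), sq_nonneg (A.1 1 1)]
      · show A.1 1 1 ^ 2 ≤ C
        nlinarith [sq_nonneg (A.1 0 0), sq_nonneg (A.1 0 1), sq_nonneg (A.1 1 0), sq_nonneg (A.1 1 1)]
    show -(C+1) ≤ A.1 i k ∧ A.1 i k ≤ C + 1
    constructor
    · nlinarith [sq_nonneg (A.1 i k + 1)]
    · nlinarith [sq_nonneg (A.1 i k - 1)]

lemma compact_psl (z p : ℍ) (C : ℝ) : IsCompact {x : PSL2 | dist (pslSMul x z) p ≤ C} := by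
  obtain ⟨B, rfl⟩ := exists_smul_I z
  obtain ⟨P, rfl⟩ := exists_smul_I p
  have hK := compact_SS (2 * Real.cosh C)
  have hK2 := hK.image (f := fun A : SL2 => (QuotientGroup.mk (P * A * B⁻¹) : PSL2))
    (cont_mk.comp ((continuous_const.mul continuous_id).mul continuous_const))
  refine hK2.of_isClosed_subset ?_ ?_
  · exact isClosed_le ((cont_psl _).dist continuous_const) continuous_const
  · intro x hx
    obtain ⟨X, rfl⟩ := exists_mk x
    rw [Set.mem_ofPred_eq, psl_mk, ← mul_smul, dist_comm] at hx
    refine ⟨P⁻¹ * X * B, ?_, by congr 1; group⟩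
    rw [Set.mem_ofPred_eq, mul_assoc, ← two_cosh]
    have : Real.cosh (dist (P • I) ((X * B) • I)) ≤ Real.cosh C := by
      rw [Real.cosh_le_cosh, abs_of_nonneg dist_nonneg]
      exact hx.trans (le_abs_self _)
    linarith

/-- unipotents -/
def uu (s : ℝ) : SL2 := ⟨!![1, s; 0, 1], by rw [Matrix.det_fin_two_of]; ring⟩
lemma uu00 (s) : (uu s).1 0 0 = 1 := rfl
lemma uu01 (s) : (uu s).1 0 1 = s := rfl
lemma uu10 (s) : (uu s).1 1 0 = 0 := rfl
lemma uu11 (s) : (uu s).1 1 1 = 1 := rfl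

lemma uu_pt_re (s τ : ℝ) : (uu s • pt τ).re = s := by
  rw [frame_re, uu00, uu01, uu10, uu11]; have := Real.exp_pos (-τ); field_simp; ring
lemma uu_pt_im (s τ : ℝ) : (uu s • pt τ).im = Real.exp τ := by
  rw [frame_im, uu10, uu11, Real.exp_neg]; field_simp; simp
lemma eq_uu_pt (w : ℍ) : uu w.re • pt (Real.log w.im) = w := by
  rw [ext_iff_re_im, uu_pt_re, uu_pt_im, Real.exp_log w.im_pos]; exact ⟨rfl, rfl⟩

lemma fix_rot {B : SL2} (h : B • I = I) : ∃ θ, B = rr θ := by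
  obtain ⟨h1, h2⟩ := fix_I h
  have h3 := det_eq B
  rw [← h1, h2] at h3
  obtain ⟨z, hz⟩ : ∃ z : ℂ, z = ⟨B.1 0 0, B.1 1 0⟩ := ⟨_, rfl⟩
  have hn : ‖z‖ = 1 := by
    rw [← sq_eq_sq₀ (norm_nonneg _) (by norm_num), ← Complex.normSq_eq_norm_sq, Complex.normSq_apply, hz]
    simp only; nlinarith
  have h4 := Complex.norm_mul_cos_arg z
  have h5 := Complex.norm_mul_sin_arg z
  rw [hn, one_mul, hz] at h4 h5
  simp only at h4 h5
  refine ⟨_, sl_ext (B := rr (Complex.arg ⟨B.1 0 0, B.1 1 0⟩)) ?_ ?_ ?_ ?_⟩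
  · rw [rr00, h4]
  · rw [rr01, h5, h2]
  · rw [rr10, h5]
  · rw [rr11, h4, h1]

def horo (k : SL2) (q : ℍ) (T : Set ℝ) : Set PSL2 := {x | Real.log (k⁻¹ • pslSMul x⁻¹ q).im ∈ T}

lemma horo_preconn (k : SL2) (q : ℍ) {T : Set ℝ} (hT : IsPreconnected T) : IsPreconnected (horo k q T) := by
  obtain ⟨Q, rfl⟩ := exists_smul_I q
  have hc : Continuous (fun p : ℝ × ℝ × ℝ => (QuotientGroup.mk (Q * rr p.1 * (k * (uu p.2.1 * aa p.2.2))⁻¹) : PSL2)) := by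
    have c_r : Continuous rr := cont_of_entries (fun i k => by
      fin_cases i <;> fin_cases k
      · exact Real.continuous_cos
      · exact Real.continuous_sin.neg
      · exact Real.continuous_sin
      · exact Real.continuous_cos)
    have c_u : Continuous uu := cont_of_entries (fun i k => by
      fin_cases i <;> fin_cases k
      · exact continuous_const
      · exact continuous_id
      · exact continuous_const
      · exact continuous_const)
    have c_a : Continuous aa := cont_of_entries (fun i k => by
      fin_cases i <;> fin_cases k
      · exact Real.continuous_exp.comp (continuous_id.div_const 2)
      · exact continuous_const
      · exact continuous_const
      · exact Real.continuous_exp.comp (continuous_id.neg.div_const 2))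
    apply cont_mk.comp
    exact (continuous_const.mul (c_r.comp continuous_fst)).mul
      (continuous_const.mul ((c_u.comp (continuous_fst.comp continuous_snd)).mul (c_a.comp (continuous_snd.comp continuous_snd)))).inv
  have hp : IsPreconnected ((Set.univ : Set ℝ) ×ˢ ((Set.univ : Set ℝ) ×ˢ T)) :=
    isPreconnected_univ.prod (isPreconnected_univ.prod hT)
  convert hp.image _ hc.continuousOn using 1
  ext x
  constructor
  · intro hx
    obtain ⟨X, rfl⟩ := exists_mk x
    unfold horo at hx
    rw [Set.mem_ofPred_eq, ← QuotientGroup.mk_inv, psl_mk] at hx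
    obtain ⟨w, hw⟩ : ∃ w, w = k⁻¹ • X⁻¹ • Q • I := ⟨_, rfl⟩
    rw [← hw] at hx
    have h1 := eq_uu_pt w
    obtain ⟨N, hN⟩ : ∃ N, N = uu w.re * aa (Real.log w.im) := ⟨_, rfl⟩
    have h2 : N • I = w := by rw [hN, mul_smul]; exact h1
    have h3 : (Q⁻¹ * X * k * N) • I = I := by
      rw [mul_smul, h2, hw, mul_smul, smul_inv_smul, mul_smul, smul_inv_smul, inv_smul_smul]
    obtain ⟨θ, hθ⟩ := fix_rot h3
    refine ⟨(θ, w.re, Real.log w.im), ⟨Set.mem_univ _, Set.mem_univ _, hx⟩, ?_⟩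
    simp only
    rw [← hN, ← hθ]
    congr 1; group
  · rintro ⟨⟨θ, s, τ⟩, ⟨_, _, h⟩, rfl⟩
    unfold horo
    simp only at h
    rw [Set.mem_ofPred_eq, ← QuotientGroup.mk_inv, psl_mk]
    have e : k⁻¹ • (Q * rr θ * (k * (uu s * aa τ))⁻¹)⁻¹ • Q • I = uu s • pt τ := by
      have : (Q * rr θ * (k * (uu s * aa τ))⁻¹)⁻¹ = k * (uu s * aa τ) * (rr θ)⁻¹ * Q⁻¹ := by group
      rw [this, mul_smul, inv_smul_smul, mul_smul, inv_smul_eq_iff.2 (rr_I θ).symm, mul_smul, inv_smul_smul, mul_smul]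
      rfl
    simp only [e, uu_pt_im, Real.log_exp]
    exact h

lemma horo_open (k : SL2) (q : ℍ) {T : Set ℝ} (hT : IsOpen T) : IsOpen (horo k q T) := by
  have : Continuous fun x : PSL2 => Real.log (k⁻¹ • pslSMul x⁻¹ q).im := by
    refine Continuous.log ?_ (fun x => (UpperHalfPlane.im_pos _).ne')
    exact UpperHalfPlane.continuous_im.comp (((cont_psl q).comp continuous_inv).const_smul k⁻¹)
  exact hT.preimage this

lemma horo_nonempty (k : SL2) (q : ℍ) {T : Set ℝ} (hT : T.Nonempty) : (horo k q T).Nonempty := by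
  obtain ⟨τ, hτ⟩ := hT
  obtain ⟨Q, rfl⟩ := exists_smul_I q
  refine ⟨QuotientGroup.mk (Q * (k * aa τ)⁻¹), ?_⟩
  unfold horo
  rw [Set.mem_ofPred_eq, ← QuotientGroup.mk_inv, psl_mk]
  have : k⁻¹ • (Q * (k * aa τ)⁻¹)⁻¹ • Q • I = pt τ := by
    have : (Q * (k * aa τ)⁻¹)⁻¹ = k * aa τ * Q⁻¹ := by group
    rw [this, mul_smul, inv_smul_smul, mul_smul, inv_smul_smul]; rfl
  rw [this, pt_im, Real.log_exp]; exact hτ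

end top1

section fd
variable {Γ : Type*} [Group Γ] (j ρ : Γ →* PSL2)

lemma actImg_eq_preimage (γ : Γ) (S : Set PSL2) : actImg j ρ γ S = (fun x => ρ γ⁻¹ * x * (j γ⁻¹)⁻¹) ⁻¹' S := by
  ext x
  constructor
  · rintro ⟨y, hy, rfl⟩
    show _ ∈ S
    convert hy using 1
    rw [map_inv, map_inv]; group
  · intro hx
    refine ⟨_, hx, ?_⟩
    simp only [map_inv]; group

lemma actImg_mul (γ γ' : Γ) (S : Set PSL2) : actImg j ρ (γ * γ') S = actImg j ρ γ (actImg j ρ γ' S) := by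
  unfold actImg
  rw [Set.image_image]
  congr 1; funext x; simp only [map_mul]; group

lemma actImg_one (S : Set PSL2) : actImg j ρ 1 S = S := by
  unfold actImg; simp

lemma actImg_open (γ : Γ) {S : Set PSL2} (h : IsOpen S) : IsOpen (actImg j ρ γ S) := by
  rw [actImg_eq_preimage]
  exact h.preimage ((continuous_const.mul continuous_id).mul continuous_const)

lemma actImg_preconn (γ : Γ) {S : Set PSL2} (h : IsPreconnected S) : IsPreconnected (actImg j ρ γ S) :=
  h.image _ ((continuous_const.mul continuous_id).mul continuous_const).continuousOn

lemma actImg_mono (γ : Γ) {S T : Set PSL2} (h : S ⊆ T) : actImg j ρ γ S ⊆ actImg j ρ γ T := Set.image_mono h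

lemma fd_lemma {m : ℕ} {D : Fin m → Set PSL2} {x : PSL2}
    (hfd : IsFundDom j ρ (closure (connectedComponentIn (⋃ (γ : Γ) (i : Fin m), actImg j ρ γ (D i))ᶜ x)))
    {P : Set PSL2} (ho : IsOpen P) (hne : P.Nonempty) (hc : IsPreconnected P)
    (hd : ∀ γ i, Disjoint P (actImg j ρ γ (D i))) {γ0 : Γ} (hγ : actImg j ρ γ0 P = P) : γ0 = 1 := by
  obtain ⟨_, h1, h2⟩ := hfd
  set U := (⋃ (γ : Γ) (i : Fin m), actImg j ρ γ (D i)) with hU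
  set C := connectedComponentIn Uᶜ x with hC
  obtain ⟨p, hp⟩ := hne
  have : p ∈ ⋃ γ : Γ, actImg j ρ γ (closure C) := by rw [h1]; trivial
  obtain ⟨γ, y, hy, hyp⟩ := Set.mem_iUnion.1 this
  have hP' : P = actImg j ρ γ (actImg j ρ γ⁻¹ P) := by rw [← actImg_mul, mul_inv_cancel, actImg_one]
  have hyP : y ∈ actImg j ρ γ⁻¹ P := by
    refine ⟨p, hp, ?_⟩
    rw [← hyp]; simp only [map_inv]; group
  obtain ⟨w, hw1, hw2⟩ := mem_closure_iff.1 hy _ (actImg_open j ρ γ⁻¹ ho) hyP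
  have hsub : actImg j ρ γ⁻¹ P ⊆ Uᶜ := by
    intro z hz hzU
    obtain ⟨δ, i, hz'⟩ : ∃ δ i, z ∈ actImg j ρ δ (D i) := by simpa [hU] using hzU
    have h3 : ρ γ * z * (j γ)⁻¹ ∈ actImg j ρ (γ * δ) (D i) := by rw [actImg_mul]; exact ⟨z, hz', rfl⟩
    have h4 : ρ γ * z * (j γ)⁻¹ ∈ P := by rw [hP']; exact ⟨z, hz, rfl⟩
    exact Set.disjoint_left.1 (hd _ _) h4 h3
  have hsub2 : actImg j ρ γ⁻¹ P ⊆ C := by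
    have := (actImg_preconn j ρ γ⁻¹ hc).subset_connectedComponentIn hw1 hsub
    rwa [← connectedComponentIn_eq hw2] at this
  have hPC : P ⊆ actImg j ρ γ (closure C) := by
    conv_lhs => rw [hP']
    exact actImg_mono j ρ γ (hsub2.trans subset_closure)
  have hPC2 : P ⊆ actImg j ρ (γ0 * γ) (closure C) := by
    conv_lhs => rw [← hγ]
    rw [actImg_mul]; exact actImg_mono j ρ γ0 hPC
  by_contra hne
  have hne' : γ ≠ γ0 * γ := fun h => hne (by simpa using h.symm)
  exact Set.disjoint_left.1 (h2 hne') (interior_maximal hPC ho hp) (interior_maximal hPC2 ho hp)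

end fd
end CK

namespace CK
section setup
open UpperHalfPlane (I)

lemma Cr_conj (J M Y : SL2) : Cr (J * M) (J * Y * J⁻¹) ↔ Cr M Y := by
  have hNA : ∀ v, NA (J * Y * J⁻¹) (act J v) ↔ NA Y v := by
    intro v
    unfold NA
    refine exists_congr fun μ => and_congr_right fun _ => ?_
    rw [act_mul, act_mul, act_inv_act]
    constructor
    · intro h
      have := congrArg (act J⁻¹) h
      rwa [act_inv_act, act_smul, act_inv_act] at this
    · intro h
      rw [h, act_smul]
  unfold Cr
  rw [c1_mul, c2_mul, hNA, hNA]
  apply or_congr_left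
  refine exists_congr fun s => ?_
  rw [mul_smul, mul_smul, mul_smul, inv_smul_smul]
  exact smul_left_cancel_iff J

variable {r : ℕ} {j ρ : FreeGroup (Fin r) →* PSL2}

lemma finite_pow {γ : FreeGroup (Fin r)} {S : Set (FreeGroup (Fin r))} (hS : S.Finite) (h : ∀ n : ℕ, γ ^ n ∈ S) : γ = 1 := by
  by_contra hne
  have := norm_pow_tendsto hne
  obtain ⟨B, hB⟩ := (hS.image FreeGroup.norm).bddAbove
  obtain ⟨n, hn⟩ := (this.eventually (eventually_gt_atTop B)).exists
  have := hB ⟨_, h n, rfl⟩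
  omega

structure Setup (j ρ : FreeGroup (Fin r) →* PSL2) (m : ℕ) (G M : Fin m → SL2) : Prop where
  pd : ProperlyDisc j ρ
  le : ∀ γ δ i k s s', dist (pslSMul (ρ γ) (G i • M i • pt s)) (pslSMul (ρ δ) (G k • M k • pt s'))
    ≤ dist (pslSMul (j γ) (M i • pt s)) (pslSMul (j δ) (M k • pt s'))
  dj : ∀ γ, γ ≠ 1 → ∀ i (R J : SL2), (QuotientGroup.mk R : PSL2) = ρ γ → (QuotientGroup.mk J : PSL2) = j γ →
    Dj (G i) (M i) (R * G i * J⁻¹) (J * M i)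
  dj' : ∀ γ, γ ≠ 1 → ∀ i (R J R0 J0 : SL2), (QuotientGroup.mk R : PSL2) = ρ γ → (QuotientGroup.mk J : PSL2) = j γ →
    ∀ δ, (QuotientGroup.mk R0 : PSL2) = ρ δ → (QuotientGroup.mk J0 : PSL2) = j δ →
    Dj (R0 * G i * J0⁻¹) (J0 * M i) (R * (R0 * G i * J0⁻¹) * J⁻¹) (J * (J0 * M i))
  fd : ∀ P : Set PSL2, IsOpen P → P.Nonempty → IsPreconnected P →
    (∀ X : SL2, (QuotientGroup.mk X : PSL2) ∈ P → ∀ γ i (R J : SL2), (QuotientGroup.mk R : PSL2) = ρ γ → (QuotientGroup.mk J : PSL2) = j γ →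
      ¬ Cr (J * M i) ((R * G i * J⁻¹)⁻¹ * X)) → ∀ γ0, actImg j ρ γ0 P = P → γ0 = 1

lemma exists_setup (hpd : ProperlyDisc j ρ) (hfd : AdmitsRightCrookedFD j ρ) : ∃ m G M, Setup j ρ m G M := by
  obtain ⟨m, D, hD, hdis, x, hx, hF⟩ := hfd
  choose G M hGM using fun i => plane_frame (hD i)
  have hmem : ∀ γ i (R J : SL2), (QuotientGroup.mk R : PSL2) = ρ γ → (QuotientGroup.mk J : PSL2) = j γ → ∀ X : SL2,
      (QuotientGroup.mk X : PSL2) ∈ actImg j ρ γ (D i) ↔ Cr (J * M i) ((R * G i * J⁻¹)⁻¹ * X) := by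
    intro γ i R J hR hJ X
    have e : (R * G i * J⁻¹)⁻¹ * X = J * ((G i)⁻¹ * (R⁻¹ * X * J)) * J⁻¹ := by group
    rw [e, Cr_conj, ← hGM, actImg_eq_preimage, Set.mem_preimage, map_inv, map_inv, inv_inv, ← hR, ← hJ, ← QuotientGroup.mk_inv, ← QuotientGroup.mk_mul, ← QuotientGroup.mk_mul]
  have hself : ∀ γ i, actImg j ρ γ (D i) = D i → γ = 1 := by
    intro γ i h
    have h1 : ρ γ * QuotientGroup.mk (G i) * (j γ)⁻¹ = QuotientGroup.mk (G i) := by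
      obtain ⟨R, hR⟩ := exists_mk (ρ γ)
      obtain ⟨J, hJ⟩ := exists_mk (j γ)
      rw [← hR, ← hJ, ← QuotientGroup.mk_inv, ← QuotientGroup.mk_mul, ← QuotientGroup.mk_mul]
      apply plane_eq (M := J * M i) (M' := M i)
      intro X
      rw [← hmem γ i R J hR hJ, ← hGM, h]
    have h2 : ∀ n : ℕ, ρ (γ ^ n) * QuotientGroup.mk (G i) * (j (γ ^ n))⁻¹ = QuotientGroup.mk (G i) := by
      intro n
      induction n with
      | zero => simp
      | succ n ih =>
        rw [pow_succ, map_mul, map_mul]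
        calc _ = ρ (γ ^ n) * (ρ γ * QuotientGroup.mk (G i) * (j γ)⁻¹) * (j (γ ^ n))⁻¹ := by group
          _ = _ := by rw [h1, ih]
    refine finite_pow (hpd {QuotientGroup.mk (G i)} isCompact_singleton) (fun n => ?_)
    exact ⟨QuotientGroup.mk (G i), ⟨_, rfl, h2 n⟩, rfl⟩
  have hdj : ∀ γ γ' i i' (R J R' J' : SL2), (QuotientGroup.mk R : PSL2) = ρ γ → (QuotientGroup.mk J : PSL2) = j γ →
      (QuotientGroup.mk R' : PSL2) = ρ γ' → (QuotientGroup.mk J' : PSL2) = j γ' →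
      Disjoint (actImg j ρ γ (D i)) (actImg j ρ γ' (D i')) →
      Dj (R * G i * J⁻¹) (J * M i) (R' * G i' * J'⁻¹) (J' * M i') := by
    intro γ γ' i i' R J R' J' hR hJ hR' hJ' hd X h1 h2
    rw [← hmem γ i R J hR hJ] at h1
    rw [← hmem γ' i' R' J' hR' hJ'] at h2
    exact Set.disjoint_left.1 hd h1 h2
  refine ⟨m, G, M, hpd, ?_, ?_, ?_, ?_⟩
  · intro γ δ i k s s'
    obtain ⟨R, hR⟩ := exists_mk (ρ γ)
    obtain ⟨J, hJ⟩ := exists_mk (j γ)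
    obtain ⟨R', hR'⟩ := exists_mk (ρ δ)
    obtain ⟨J', hJ'⟩ := exists_mk (j δ)
    rcases hdis γ δ i k with h | h
    · have he : (QuotientGroup.mk (R * G i * J⁻¹) : PSL2) = QuotientGroup.mk (R' * G k * J'⁻¹) := by
        apply plane_eq (M := J * M i) (M' := J' * M k)
        intro X
        rw [← hmem γ i R J hR hJ, ← hmem δ k R' J' hR' hJ', h]
      rw [← hR, ← hJ, ← hR', ← hJ', psl_mk, psl_mk, psl_mk, psl_mk]
      apply le_of_eq
      have e1 : R • G i • M i • pt s = (R * G i * J⁻¹) • (J • M i • pt s) := by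
        rw [mul_smul, mul_smul, inv_smul_smul]
      have e2 : R' • G k • M k • pt s' = (R * G i * J⁻¹) • (J' • M k • pt s') := by
        rw [smul_eq_of_mk he, mul_smul, mul_smul, inv_smul_smul]
      rw [e1, e2, dist_smul]
    · have := (hdj γ δ i k R J R' J' hR hJ hR' hJ' h).lt s s'
      rw [← hR, ← hJ, ← hR', ← hJ', psl_mk, psl_mk, psl_mk, psl_mk]
      simp only [mul_smul, inv_smul_smul] at this
      exact this.le
  · intro γ hγ i R J hR hJ
    have h := (hdis 1 γ i i).resolve_left (fun h => hγ (hself γ i (by rw [← h, actImg_one])))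
    have := hdj 1 γ i i 1 1 R J (by simp) (by simp) hR hJ h
    simpa using this
  · intro γ hγ i R J R0 J0 hR hJ δ hR0 hJ0
    have h := (hdis δ (γ * δ) i i).resolve_left (fun h => hγ (by
      have h1 : actImg j ρ (δ⁻¹ * (γ * δ)) (D i) = D i := by
        rw [actImg_mul, ← h, ← actImg_mul, inv_mul_cancel, actImg_one]
      have := hself _ i h1
      rw [inv_mul_eq_one] at this
      simpa using this.symm))
    have := hdj δ (γ * δ) i i R0 J0 (R * R0) (J * J0) hR0 hJ0 (by rw [QuotientGroup.mk_mul, hR, hR0, map_mul]) (by rw [QuotientGroup.mk_mul, hJ, hJ0, map_mul]) h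
    have e : R * (R0 * G i * J0⁻¹) * J⁻¹ = R * R0 * G i * (J * J0)⁻¹ := by group
    rw [e, ← mul_assoc]; exact this
  · intro P h1 h2 h3 h4 γ0 hγ
    refine fd_lemma j ρ hF h1 h2 h3 (fun γ i => ?_) hγ
    rw [Set.disjoint_left]
    intro y hy hy2
    obtain ⟨X, rfl⟩ := exists_mk y
    obtain ⟨R, hR⟩ := exists_mk (ρ γ)
    obtain ⟨J, hJ⟩ := exists_mk (j γ)
    exact h4 X hy γ i R J hR hJ ((hmem γ i R J hR hJ X).1 hy2)

variable {m : ℕ} {G M : Fin m → SL2}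

lemma Setup.m_pos (S : Setup j ρ m G M) {γ : FreeGroup (Fin r)} (hγ : γ ≠ 1) : 0 < m := by
  by_contra hm
  have hm0 : m = 0 := by omega
  subst hm0
  apply hγ
  have hu : horo 1 I (Set.univ) = Set.univ := by ext x; simp [horo]
  have hpre := horo_preconn 1 I (T := Set.univ) isPreconnected_univ
  rw [hu] at hpre
  refine S.fd Set.univ isOpen_univ Set.univ_nonempty hpre (fun X _ γ i => Fin.elim0 i) γ ?_
  rw [actImg_eq_preimage, Set.preimage_univ]

lemma Setup.p2 (S : Setup j ρ m G M) (i : Fin m) {C : ℝ} (hC : 0 ≤ C) :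
    {γ | ∃ s, dist (M i • I) (pslSMul (j γ) (M i • pt s)) ≤ C}.Finite := by
  refine (S.pd {x | dist (pslSMul x (M i • I)) (G i • M i • I) ≤ 2 * C} (compact_psl _ _ _)).subset ?_
  rintro γ ⟨s, hs⟩
  refine ⟨ρ γ * QuotientGroup.mk (G i) * (j γ)⁻¹, ⟨QuotientGroup.mk (G i), ?_, rfl⟩, ?_⟩
  · rw [Set.mem_ofPred_eq, psl_mk, dist_self]; linarith
  · rw [Set.mem_ofPred_eq]
    set x := ρ γ * QuotientGroup.mk (G i) * (j γ)⁻¹ with hx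
    have e : pslSMul x (pslSMul (j γ) (M i • pt s)) = pslSMul (ρ γ) (G i • M i • pt s) := by
      rw [hx, psl_mul, psl_inv_smul, psl_mul, psl_mk]
    have h1 : dist (pslSMul x (M i • I)) (pslSMul x (pslSMul (j γ) (M i • pt s))) ≤ C := by
      rw [psl_dist]; exact hs
    have h2 := S.le γ 1 i i s 0
    rw [map_one, map_one, psl_one, psl_one, pt_zero, ← e, dist_comm _ (M i • I)] at h2
    linarith [dist_triangle (pslSMul x (M i • I)) (pslSMul x (pslSMul (j γ) (M i • pt s))) (G i • M i • I)]

lemma Setup.p2' (S : Setup j ρ m G M) (i : Fin m) (C : ℝ) :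
    {γ | dist (M i • I) (pslSMul (j γ) (M i • I)) ≤ C}.Finite := by
  refine (S.p2 i (C := |C|) (abs_nonneg _)).subset ?_
  intro γ hγ
  exact ⟨0, by rw [pt_zero]; exact le_trans hγ (le_abs_self _)⟩

def NN (j ρ : FreeGroup (Fin r) →* PSL2) (G M : SL2) (γ : FreeGroup (Fin r)) : ℝ :=
  dist (M • I) (pslSMul (j γ) (M • I)) - dist (G • M • I) (pslSMul (ρ γ) (G • M • I))

lemma Setup.NN_nonneg (S : Setup j ρ m G M) (i : Fin m) (γ) : 0 ≤ NN j ρ (G i) (M i) γ := by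
  have := S.le 1 γ i i 0 0
  rw [map_one, map_one, psl_one, psl_one, pt_zero] at this
  unfold NN; linarith

lemma Setup.p3 (S : Setup j ρ m G M) (i : Fin m) (C : ℝ) : {γ | NN j ρ (G i) (M i) γ ≤ C}.Finite := by
  have hf := S.pd {x | dist (pslSMul x (M i • I)) (G i • M i • I) ≤ C} (compact_psl _ _ _)
  refine (hf.preimage (f := fun γ => γ⁻¹) inv_injective.injOn).subset ?_
  intro γ hγ
  rw [Set.mem_ofPred_eq] at hγ
  have h0 := S.NN_nonneg i γ
  rw [Set.mem_preimage, Set.mem_ofPred_eq]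
  obtain ⟨B, hB1, hB2⟩ := exists_frame (M i • I) (pslSMul (j γ) (M i • I))
  obtain ⟨B', hB1', hB2'⟩ := exists_frame (G i • M i • I) (pslSMul (ρ γ) (G i • M i • I))
  have hx0 : (B' * B⁻¹) • (M i • I) = G i • M i • I := by
    rw [← hB1, mul_smul, inv_smul_smul, hB1', hB1]
  refine ⟨ρ γ⁻¹ * QuotientGroup.mk (B' * B⁻¹) * (j γ⁻¹)⁻¹, ⟨QuotientGroup.mk (B' * B⁻¹), ?_, rfl⟩, ?_⟩
  · rw [Set.mem_ofPred_eq, psl_mk, hx0, dist_self]; linarith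
  · rw [Set.mem_ofPred_eq, map_inv, map_inv, inv_inv, psl_mul, psl_mul, psl_mk, ← psl_dist (ρ γ), psl_smul_inv]
    have e1 : (B' * B⁻¹) • pslSMul (j γ) (M i • I) = B' • pt (dist (M i • I) (pslSMul (j γ) (M i • I))) := by
      conv_lhs => rw [← hB2]
      rw [mul_smul, inv_smul_smul]
    rw [e1]
    conv_lhs => rw [← hB2']
    rw [dist_smul, dist_pt]
    unfold NN at hγ h0
    rw [abs_of_nonneg h0]; exact hγ

lemma Setup.fix_pt_one (S : Setup j ρ m G M) (i : Fin m) {γ : FreeGroup (Fin r)} {p : ℍ} (h : pslSMul (j γ) p = p) : γ = 1 := by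
  refine finite_pow (S.p2' i (2 * dist (M i • I) p)) (fun n => ?_)
  have hn : pslSMul (j (γ ^ n)) p = p := by
    induction n with
    | zero => rw [pow_zero, map_one, psl_one]
    | succ n ih => rw [pow_succ, map_mul, psl_mul, h, ih]
  rw [Set.mem_ofPred_eq]
  have h1 : dist p (pslSMul (j (γ ^ n)) (M i • I)) = dist (M i • I) p := by
    conv_lhs => rw [← hn]
    rw [psl_dist, dist_comm]
  linarith [dist_triangle (M i • I) p (pslSMul (j (γ ^ n)) (M i • I))]

lemma Setup.inj (S : Setup j ρ m G M) (i : Fin m) : Function.Injective j := by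
  rw [injective_iff_map_eq_one]
  intro γ hγ
  exact S.fix_pt_one i (p := I) (by rw [hγ, psl_one])

lemma Setup.discrete (S : Setup j ρ m G M) (i : Fin m) : DiscreteTopology j.range := by
  apply discreteTopology_of_isOpen_singleton_one
  have ho : IsOpen {x : PSL2 | dist (M i • I) (pslSMul x (M i • I)) < 1} :=
    isOpen_lt (continuous_const.dist (cont_psl _)) continuous_const
  have hfin : (j '' {γ | dist (M i • I) (pslSMul (j γ) (M i • I)) ≤ 1} \ {1}).Finite := ((S.p2' i 1).image j).subset Set.sdiff_subset
  have ho2 := ho.sdiff hfin.isClosed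
  refine isOpen_induced_iff.2 ⟨_, ho2, ?_⟩
  ext ⟨x, γ, rfl⟩
  rw [Set.mem_preimage]
  constructor
  · rintro ⟨h1, h2⟩
    rw [Set.mem_singleton_iff]
    by_contra hne
    apply h2
    have h1' : dist (M i • I) (pslSMul (j γ) (M i • I)) < 1 := h1
    refine ⟨⟨γ, by rw [Set.mem_ofPred_eq]; exact le_of_lt h1', rfl⟩, fun h => hne (Subtype.ext h)⟩
  · intro h
    have h' : j γ = 1 := congrArg Subtype.val h
    refine ⟨?_, fun h2 => h2.2 h'⟩
    have : dist (M i • I) (pslSMul (j γ) (M i • I)) < 1 := by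
      rw [h', psl_one, dist_self]; norm_num
    exact this

end setup
end CK

namespace CK
section para
open UpperHalfPlane (I)

lemma elliptic_fix {X : SL2} (h : (X.1 0 0 + X.1 1 1) ^ 2 < 4) : ∃ p : ℍ, X • p = p := by
  have hd := det_eq X
  have hc : X.1 1 0 ≠ 0 := by
    intro h0
    rw [h0] at hd
    nlinarith [sq_nonneg (X.1 0 0 - X.1 1 1)]
  have hs : 0 < 4 - (X.1 0 0 + X.1 1 1) ^ 2 := by linarith
  have hq : 0 < √ (4 - (X.1 0 0 + X.1 1 1) ^ 2) := Real.sqrt_pos.2 hs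
  have hq2 : √ (4 - (X.1 0 0 + X.1 1 1) ^ 2) ^ 2 = 4 - (X.1 0 0 + X.1 1 1) ^ 2 := Real.sq_sqrt hs.le
  set q := √ (4 - (X.1 0 0 + X.1 1 1) ^ 2) with hqdef
  have hab : 0 < |X.1 1 0| := abs_pos.2 hc
  have ha2 : |X.1 1 0| ^ 2 = X.1 1 0 ^ 2 := sq_abs _
  have hy : 0 < q / (2 * |X.1 1 0|) := by positivity
  let x : ℝ := (X.1 0 0 - X.1 1 1) / (2 * X.1 1 0)
  let y : ℝ := q / (2 * |X.1 1 0|)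
  have hx1 : 2 * X.1 1 0 * x = X.1 0 0 - X.1 1 1 := by simp only [x]; field_simp
  have hy1 : 4 * X.1 1 0 ^ 2 * y ^ 2 = q ^ 2 := by
    rw [← ha2]; simp only [y]; field_simp; norm_num
  refine ⟨⟨⟨x, y⟩, hy⟩, ?_⟩
  apply UpperHalfPlane.ext
  rw [UpperHalfPlane.coe_specialLinearGroup_apply]
  show ((X.1 0 0 : ℂ) * ⟨x, y⟩ + X.1 0 1) / ((X.1 1 0 : ℂ) * ⟨x, y⟩ + X.1 1 1) = ⟨x, y⟩
  have hne : (X.1 1 0 : ℂ) * ⟨x, y⟩ + X.1 1 1 ≠ 0 := by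
    intro h
    have h2 := congrArg Complex.im h
    simp at h2
    rcases h2 with h2 | h2
    · exact hc h2
    · exact hy.ne' h2
  rw [div_eq_iff hne]
  apply Complex.ext
  · simp
    have : 4 * X.1 1 0 * (X.1 0 0 * x + X.1 0 1 - (x * (X.1 1 0 * x + X.1 1 1) - y * (X.1 1 0 * y))) = 0 := by
      linear_combination (2 * X.1 0 0 - (2 * X.1 1 0 * x + X.1 0 0 - X.1 1 1) - 2 * X.1 1 1) * hx1 + hy1 + hq2 - 4 * hd
    have h4 : (4 : ℝ) * X.1 1 0 ≠ 0 := by positivity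
    have := (mul_eq_zero.1 this).resolve_left h4
    linarith
  · simp
    linear_combination (-y) * hx1

lemma exists_tri {X : SL2} (h : 4 ≤ (X.1 0 0 + X.1 1 1) ^ 2) : ∃ k : SL2, (k⁻¹ * X * k).1 1 0 = 0 := by
  have hd := det_eq X
  by_cases hc : X.1 1 0 = 0
  · exact ⟨1, by simpa using hc⟩
  have hs : 0 ≤ (X.1 0 0 + X.1 1 1) ^ 2 - 4 := by linarith
  have hq2 : √ ((X.1 0 0 + X.1 1 1) ^ 2 - 4) ^ 2 = (X.1 0 0 + X.1 1 1) ^ 2 - 4 := Real.sq_sqrt hs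
  set q := √ ((X.1 0 0 + X.1 1 1) ^ 2 - 4)
  let x : ℝ := (X.1 0 0 - X.1 1 1 + q) / (2 * X.1 1 0)
  have hx1 : 2 * X.1 1 0 * x = X.1 0 0 - X.1 1 1 + q := by simp only [x]; field_simp
  let k : SL2 := ⟨!![x, -1; 1, 0], by rw [Matrix.det_fin_two_of]; ring⟩
  have k00 : k.1 0 0 = x := rfl
  have k01 : k.1 0 1 = -1 := rfl
  have k10 : k.1 1 0 = 1 := rfl
  have k11 : k.1 1 1 = 0 := rfl
  refine ⟨k, ?_⟩
  rw [mul10, mul10, mul11, inv10, inv11, k00, k10]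
  have h4 : (4 : ℝ) * X.1 1 0 ≠ 0 := by positivity
  apply (mul_eq_zero.1 (?_ : 4 * X.1 1 0 * _ = 0)).resolve_left h4
  linear_combination (2 * X.1 1 0 * x + X.1 0 0 - X.1 1 1 + q - 2 * X.1 0 0 + 2 * X.1 1 1) * hx1 + hq2 + 4 * hd

lemma tri_cases {Y : SL2} (h : Y.1 1 0 = 0) (h2 : Y.1 0 0 ^ 2 = 1) :
    (QuotientGroup.mk Y : PSL2) = QuotientGroup.mk (uu (Y.1 0 0 * Y.1 0 1)) := by
  have hd := det_eq Y
  rw [h] at hd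
  rw [mk_eq_iff]
  refine ⟨Y.1 0 0, h2, ?_, ?_, ?_, ?_⟩
  · rw [uu00]; linarith
  · rw [uu01]
  · rw [uu10, h, mul_zero]
  · rw [uu11]; linarith

lemma tri_pow {Y : SL2} (h : Y.1 1 0 = 0) (n : ℕ) :
    (Y ^ n).1 1 0 = 0 ∧ (Y ^ n).1 0 0 = Y.1 0 0 ^ n ∧ (Y ^ n).1 1 1 = Y.1 1 1 ^ n := by
  induction n with
  | zero => simp
  | succ n ih =>
    obtain ⟨a, b, c⟩ := ih
    rw [pow_succ, mul10, mul00, mul11, a, b, c, h]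
    refine ⟨by ring, by ring, by ring⟩

lemma uu_mul (a b : ℝ) : uu a * uu b = uu (a + b) := by
  apply sl_ext
  · rw [mul00, uu00, uu00, uu10, uu00]; ring
  · rw [mul01, uu00, uu01, uu01, uu01, uu11]; ring
  · rw [mul10, uu10, uu11, uu10, uu10]; ring
  · rw [mul11, uu10, uu11, uu11, uu11]; ring

lemma uu_zero : uu 0 = 1 := by
  apply sl_ext <;> simp [uu00, uu01, uu10, uu11]

lemma uu_pow (a : ℝ) (n : ℕ) : uu a ^ n = uu (n * a) := by
  induction n with
  | zero => rw [pow_zero, Nat.cast_zero, zero_mul, uu_zero]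
  | succ n ih => rw [pow_succ, ih, uu_mul]; congr 1; push_cast; ring

lemma uu_inv (a : ℝ) : (uu a)⁻¹ = uu (-a) := by
  rw [inv_eq_iff_mul_eq_one, uu_mul, add_neg_cancel, uu_zero]

lemma uu_zpow (a : ℝ) (n : ℤ) : uu a ^ n = uu (n * a) := by
  obtain ⟨n, rfl | rfl⟩ := n.eq_nat_or_neg
  · rw [zpow_natCast, uu_pow, Int.cast_natCast]
  · rw [zpow_neg, zpow_natCast, uu_pow, uu_inv]; congr 1; push_cast; ring

lemma SS_uu (a : ℝ) : SS (uu a) = 2 + a ^ 2 := by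
  unfold SS; rw [uu00, uu01, uu10, uu11]; ring

/-- non elliptic elements move points at least quadratically (in `cosh`) -/
lemma growth {X : SL2} (h : ∀ p : ℍ, X • p ≠ p) : ∃ c > 0, ∀ n : ℕ, c * (1 + (n:ℝ) ^ 2) ≤ SS (X ^ n) := by
  have htr : 4 ≤ (X.1 0 0 + X.1 1 1) ^ 2 := by
    by_contra hc
    obtain ⟨p, hp⟩ := elliptic_fix (not_le.1 hc)
    exact h p hp
  obtain ⟨k, hk⟩ := exists_tri htr
  obtain ⟨Y, hY⟩ : ∃ Y, Y = k⁻¹ * X * k := ⟨_, rfl⟩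
  rw [← hY] at hk
  have hX : X = k * Y * k⁻¹ := by rw [hY]; group
  have hconj : ∀ n : ℕ, SS (Y ^ n) ≤ SS k * SS (X ^ n) * SS k := by
    intro n
    have e : Y ^ n = k⁻¹ * X ^ n * k := by
      have := conj_pow (a := k⁻¹) (b := X) (i := n)
      rw [inv_inv] at this
      rw [hY]; exact this
    rw [e]
    calc _ ≤ SS (k⁻¹ * X ^ n) * SS k := SS_mul _ _
      _ ≤ _ := by
        refine mul_le_mul_of_nonneg_right ?_ (by linarith [SS_pos k])
        calc _ ≤ _ := SS_mul _ _
          _ = _ := by rw [SS_inv]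
  have hfin : ∀ c > 0, (∀ n : ℕ, c * (1 + (n:ℝ) ^ 2) ≤ SS (Y ^ n)) → ∃ c > 0, ∀ n : ℕ, c * (1 + (n:ℝ) ^ 2) ≤ SS (X ^ n) := by
    intro c hc hh
    have hk0 : 0 < SS k := by linarith [SS_pos k]
    refine ⟨c / (SS k * SS k), by positivity, fun n => ?_⟩
    have h1 := (hh n).trans (hconj n)
    rw [div_mul_eq_mul_div, div_le_iff₀ (by positivity)]
    linarith
  have hd := det_eq Y
  rw [hk] at hd
  have ha0 : Y.1 0 0 ≠ 0 := by
    intro h0; rw [h0] at hd; norm_num at hd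
  by_cases ha : Y.1 0 0 ^ 2 = 1
  · have e := tri_cases hk ha
    obtain ⟨b, hbd⟩ : ∃ b, b = Y.1 0 0 * Y.1 0 1 := ⟨_, rfl⟩
    rw [← hbd] at e
    have hb : b ≠ 0 := by
      intro h0
      rw [h0, uu_zero] at e
      apply h (k • I)
      rw [hX, mul_smul, mul_smul, inv_smul_smul, smul_eq_of_mk e, one_smul]
    have hss : ∀ n : ℕ, SS (Y ^ n) = 2 + (n * b) ^ 2 := by
      intro n
      rw [← SS_uu, ← uu_pow]
      have : (QuotientGroup.mk (Y ^ n) : PSL2) = QuotientGroup.mk (uu b ^ n) := by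
        rw [QuotientGroup.mk_pow, e, ← QuotientGroup.mk_pow]
      obtain ⟨ε, h0, h1, h2, h3, h4⟩ := mk_eq_iff.1 this
      unfold SS
      rw [h1, h2, h3, h4]
      simp only [mul_pow, h0, one_mul]
    have hb2 : 0 < b ^ 2 := sq_pos_of_ne_zero hb
    refine hfin (min 2 (b ^ 2)) (lt_min (by norm_num) hb2) fun n => ?_
    rw [hss]
    have h1 := min_le_left 2 (b ^ 2)
    have h2 := min_le_right 2 (b ^ 2)
    nlinarith [sq_nonneg (n : ℝ)]
  · have hpos : 0 < Y.1 0 0 ^ 2 := by positivity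
    have hL : Real.log (Y.1 0 0 ^ 2) ≠ 0 := by
      intro h0
      rcases Real.log_eq_zero.1 h0 with h0 | h0 | h0
      · exact hpos.ne' h0
      · exact ha h0
      · linarith
    obtain ⟨L, hLd⟩ : ∃ L, L = Real.log (Y.1 0 0 ^ 2) := ⟨_, rfl⟩
    rw [← hLd] at hL
    have hL2 : 0 < L ^ 2 := sq_pos_of_ne_zero hL
    refine hfin (min 1 (L ^ 2 / 2)) (lt_min (by norm_num) (by linarith)) fun n => ?_
    obtain ⟨t1, t2, t3⟩ := tri_pow hk n
    have hinv : Y.1 1 1 = (Y.1 0 0)⁻¹ := by field_simp; linarith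
    have e1 : (Y.1 0 0 ^ n) ^ 2 = Real.exp (n * L) := by
      rw [← pow_mul, mul_comm n 2, pow_mul, Real.exp_nat_mul, hLd, Real.exp_log hpos]
    have e2 : (Y.1 1 1 ^ n) ^ 2 = Real.exp (-(n * L)) := by
      rw [Real.exp_neg, ← e1, hinv, inv_pow, inv_pow]
    have hq : 1 + (n * L) ^ 2 / 2 ≤ SS (Y ^ n) := by
      have : 1 + |n * L| + |n * L| ^ 2 / 2 ≤ Real.exp |n * L| := Real.quadratic_le_exp_of_nonneg (abs_nonneg _)
      have h3 : Real.exp |n * L| ≤ Real.exp (n * L) + Real.exp (-(n * L)) := by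
        rcases abs_choice (n * L) with h | h <;> rw [h] <;> linarith [Real.exp_pos (n * L), Real.exp_pos (-(n * L))]
      have h4 : Real.exp (n * L) + Real.exp (-(n * L)) ≤ SS (Y ^ n) := by
        unfold SS; rw [t2, t3, e1, e2]; nlinarith [sq_nonneg ((Y ^ n).1 0 1), sq_nonneg ((Y ^ n).1 1 0)]
      rw [sq_abs] at this
      linarith [abs_nonneg (n * L)]
    have h1 := min_le_left 1 (L ^ 2 / 2)
    have h2 := min_le_right 1 (L ^ 2 / 2)
    nlinarith [sq_nonneg (n : ℝ)]

lemma dt_det (M M' : SL2) : dt (c1 M) (c1 M') * dt (c2 M) (c2 M') - dt (c1 M) (c2 M') * dt (c2 M) (c1 M') = 1 := by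
  have h1 := det_eq M
  have h2 := det_eq M'
  unfold dt c1 c2
  simp only
  linear_combination (M'.1 0 0 * M'.1 1 1 - M'.1 0 1 * M'.1 1 0) * h1 + h2

lemma amgm {a b : ℝ} (ha : a ≠ 0) (hb : b ≠ 0) :
    ∃ t : ℝ, Real.exp t * a ^ 2 + Real.exp (-t) * b ^ 2 = 2 * |a * b| := by
  have ha' : 0 < |a| := abs_pos.2 ha
  have hb' : 0 < |b| := abs_pos.2 hb
  refine ⟨Real.log (|b| / |a|), ?_⟩
  rw [Real.exp_neg, Real.exp_log (by positivity), abs_mul, ← sq_abs a, ← sq_abs b]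
  field_simp
  ring

/-- disjoint crooked planes have disjoint geodesics -/
lemma Dj.cross {G M G' M' : SL2} (h : Dj G M G' M') :
    0 < dt (c1 M) (c1 M') * dt (c2 M) (c2 M') * (dt (c1 M) (c2 M') * dt (c2 M) (c1 M')) := by
  have h11 := h.dt11
  have h12 := h.dt12
  have h21 := h.dt21
  have h22 := h.dt22
  have hd := dt_det M M'
  by_contra hc
  have hc' : dt (c1 M) (c1 M') * dt (c2 M) (c2 M') * (dt (c1 M) (c2 M') * dt (c2 M) (c1 M')) < 0 := by
    refine lt_of_le_of_ne (not_lt.1 hc) ?_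
    exact mul_ne_zero (mul_ne_zero h11 h22) (mul_ne_zero h12 h21)
  have hp : 0 < dt (c1 M) (c1 M') * dt (c2 M) (c2 M') := by nlinarith
  have hn : dt (c1 M) (c2 M') * dt (c2 M) (c1 M') < 0 := by nlinarith
  obtain ⟨t, ht⟩ := amgm h11 h22
  obtain ⟨u, hu⟩ := amgm h12 h21
  have hcf := cosh_frames M M' ((t + u) / 2) ((t - u) / 2)
  rw [show (t + u) / 2 + (t - u) / 2 = t by ring, show (t + u) / 2 - (t - u) / 2 = u by ring,
    show -((t + u) / 2) + (t - u) / 2 = -u by ring, show -((t + u) / 2) - (t - u) / 2 = -t by ring] at hcf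
  rw [abs_of_pos hp] at ht
  rw [abs_of_neg hn] at hu
  have hlt := h.lt ((t + u) / 2) ((t - u) / 2)
  have hpos : 0 < dist (M • pt ((t + u) / 2)) (M' • pt ((t - u) / 2)) := lt_of_le_of_lt dist_nonneg hlt
  have := Real.one_lt_cosh.2 hpos.ne'
  linarith

lemma wing_contra {B H N : SL2} (hNA : NA H (c1 N))
    (h : ∀ s, dist (H • B • I) (N • pt s) ≤ dist (B • I) (N • pt s) - 1) : False := by
  obtain ⟨μ, hμ, he⟩ := hNA
  have hμ0 : μ ≠ 0 := by
    rintro rfl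
    rw [zero_smul] at he
    exact act_ne (c1_ne N) he
  have hmu2 : μ ^ 2 ≤ 1 := by rw [← sq_abs]; nlinarith [abs_nonneg μ]
  have key : ∀ v, dt v (c1 N) = μ * dt (act H v) (c1 N) := by
    intro v
    rw [← smul_right', ← he, dt_act]
  set p := dt (c1 B) (c1 N) ^ 2 + dt (c2 B) (c1 N) ^ 2 with hp
  set p2 := dt (c1 B) (c2 N) ^ 2 + dt (c2 B) (c2 N) ^ 2 with hp2
  have hp0 : 0 < p := by
    have h3 : dt (c1 N) (c1 B) ≠ 0 ∨ dt (c1 N) (c2 B) ≠ 0 := dt_ne_or (c1_ne N) B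
    have e1 := dt_swap (c1 B) (c1 N)
    have e2 := dt_swap (c2 B) (c1 N)
    rcases h3 with h3 | h3
    · have : dt (c1 B) (c1 N) ≠ 0 := by rw [e1]; simpa using h3
      positivity
    · have : dt (c2 B) (c1 N) ≠ 0 := by rw [e2]; simpa using h3
      positivity
  have hp20 : 0 ≤ p2 := by positivity
  set p' := dt (act H (c1 B)) (c1 N) ^ 2 + dt (act H (c2 B)) (c1 N) ^ 2 with hp'
  have hpp : p ≤ p' := by
    have : p = μ ^ 2 * p' := by rw [hp, hp', key (c1 B), key (c2 B)]; ring
    have h0 : 0 ≤ p' := by positivity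
    nlinarith
  have cf : ∀ s, 2 * Real.cosh (dist (B • I) (N • pt s)) = Real.exp s * p + Real.exp (-s) * p2 := by
    intro s
    have := cosh_frames B N 0 s
    rw [pt_zero] at this
    rw [this]
    simp only [zero_add, zero_sub, neg_zero, hp, hp2]; ring
  have cf' : ∀ s, Real.exp s * p' ≤ 2 * Real.cosh (dist (H • B • I) (N • pt s)) := by
    intro s
    have := cosh_frames (H * B) N 0 s
    rw [pt_zero, c1_mul, c2_mul, mul_smul] at this
    rw [this]
    simp only [zero_add, zero_sub, neg_zero, hp']
    have := Real.exp_pos (-s)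
    nlinarith [mul_nonneg this.le (sq_nonneg (dt (act H (c1 B)) (c2 N))), mul_nonneg this.le (sq_nonneg (dt (act H (c2 B)) (c2 N)))]
  have hE : Real.exp (-1) < 1 / 2 := by
    rw [Real.exp_neg, inv_lt_comm₀ (Real.exp_pos _) (by norm_num)]
    linarith [Real.exp_one_gt_d9]
  have main : ∀ s, 0 ≤ s → Real.exp s * p ≤ p2 + 6 := by
    intro s hs
    set d := dist (B • I) (N • pt s) with hd
    have h1 := h s
    have hd1 : 0 ≤ d - 1 := dist_nonneg.trans h1
    have hco : Real.cosh (dist (H • B • I) (N • pt s)) ≤ Real.cosh (d - 1) := by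
      rw [Real.cosh_le_cosh, abs_of_nonneg dist_nonneg, abs_of_nonneg hd1]; exact h1
    have e1 : 2 * Real.cosh (d - 1) = Real.exp (-1) * Real.exp d + Real.exp (-(d-1)) := by
      rw [Real.cosh_eq, ← Real.exp_add]
      rw [show -1 + d = d - 1 by ring]
      ring
    have e2 : Real.exp (-(d-1)) ≤ 1 := by rw [Real.exp_le_one_iff]; linarith
    have e3 : Real.exp d ≤ 2 * Real.cosh d := by rw [Real.cosh_eq]; linarith [Real.exp_pos (-d)]
    have e4 := cf s
    rw [← hd] at e4
    have e5 := cf' s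
    have e6 : Real.exp (-s) * p2 ≤ p2 := by
      have : Real.exp (-s) ≤ 1 := by rw [Real.exp_le_one_iff]; linarith
      nlinarith
    have e7 : Real.exp (-1) * Real.exp d ≤ 1 / 2 * Real.exp d := by
      have := Real.exp_pos d
      nlinarith
    have e8 : Real.exp s * p ≤ Real.exp s * p' := by
      have := Real.exp_pos s
      nlinarith
    linarith
  have hs0 : 0 ≤ (p2 + 6) / p := by positivity
  have := main _ hs0
  have h2 := Real.add_one_le_exp ((p2 + 6) / p)
  have h3 : ((p2 + 6) / p + 1) * p ≤ p2 + 6 := le_trans (mul_le_mul_of_nonneg_right h2 hp0.le) this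
  rw [add_mul, div_mul_cancel₀ _ hp0.ne'] at h3
  linarith

end para
end CK

namespace CK
section para2
open UpperHalfPlane (I)
variable {r : ℕ} {j ρ : FreeGroup (Fin r) →* PSL2} {m : ℕ} {G M : Fin m → SL2}

lemma exp_le_two_cosh (d : ℝ) : Real.exp d ≤ 2 * Real.cosh d := by
  rw [Real.cosh_eq]; linarith [Real.exp_pos (-d)]

lemma two_cosh_le {d : ℝ} (hd : 0 ≤ d) : 2 * Real.cosh d ≤ 2 * Real.exp d := by
  rw [Real.cosh_eq]
  have : Real.exp (-d) ≤ Real.exp d := Real.exp_le_exp.2 (by linarith)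
  linarith

lemma cosh_conj (A X : SL2) : 2 * Real.cosh (dist (A • I) (X • A • I)) = SS (A⁻¹ * X * A) := by
  rw [← mul_smul, two_cosh, mul_assoc]

lemma Setup.fix_of_para (S : Setup j ρ m G M) (i : Fin m) {γ0 : FreeGroup (Fin r)} (hγ : γ0 ≠ 1) {k : SL2} {τ : ℝ}
    (hj : j γ0 = QuotientGroup.mk (k * uu τ * k⁻¹)) : ∃ q0, pslSMul (ρ γ0) q0 = q0 := by
  by_contra hno
  push Not at hno
  obtain ⟨R, hR⟩ := exists_mk (ρ γ0)
  have hfix : ∀ p : ℍ, ((G i * M i)⁻¹ * R * (G i * M i)) • p ≠ p := by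
    intro p hp
    rw [← conj_smul] at hp
    apply hno ((G i * M i) • p)
    rw [← hR, psl_mk, hp]
  obtain ⟨c, hc, hg⟩ := growth hfix
  set K := SS ((M i)⁻¹ * k) * SS (k⁻¹ * M i) * (2 + τ ^ 2) with hK
  have hK0 : 0 < K := by
    have := SS_pos ((M i)⁻¹ * k)
    have := SS_pos (k⁻¹ * M i)
    positivity
  apply hγ
  refine finite_pow (S.p3 i (Real.log (2 * K / c))) (fun n => ?_)
  rw [Set.mem_ofPred_eq]
  unfold NN
  have hjn : j (γ0 ^ n) = QuotientGroup.mk (k * uu (n * τ) * k⁻¹) := by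
    rw [map_pow, hj, ← QuotientGroup.mk_pow, conj_pow, uu_pow]
  have hrn : ρ (γ0 ^ n) = QuotientGroup.mk (R ^ n) := by
    rw [map_pow, ← hR, ← QuotientGroup.mk_pow]
  rw [hjn, hrn, psl_mk, psl_mk]
  set d1 := dist (M i • I) ((k * uu (n * τ) * k⁻¹) • M i • I) with hd1
  set d2 := dist (G i • M i • I) (R ^ n • G i • M i • I) with hd2
  have u1 : Real.exp d1 ≤ K * (1 + (n:ℝ) ^ 2) := by
    refine (exp_le_two_cosh _).trans ?_
    rw [hd1, cosh_conj]
    have e : (M i)⁻¹ * (k * uu (n * τ) * k⁻¹) * M i = ((M i)⁻¹ * k) * uu (n * τ) * (k⁻¹ * M i) := by group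
    rw [e]
    have a0 := SS_pos ((M i)⁻¹ * k)
    have b0 := SS_pos (k⁻¹ * M i)
    calc _ ≤ SS ((M i)⁻¹ * k * uu (n * τ)) * SS (k⁻¹ * M i) := SS_mul _ _
      _ ≤ SS ((M i)⁻¹ * k) * SS (uu (n * τ)) * SS (k⁻¹ * M i) :=
        mul_le_mul_of_nonneg_right (SS_mul _ _) (by linarith)
      _ = SS ((M i)⁻¹ * k) * SS (k⁻¹ * M i) * (2 + (n * τ) ^ 2) := by rw [SS_uu]; ring
      _ ≤ SS ((M i)⁻¹ * k) * SS (k⁻¹ * M i) * ((2 + τ ^ 2) * (1 + (n:ℝ) ^ 2)) := by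
        apply mul_le_mul_of_nonneg_left _ (by positivity)
        nlinarith [sq_nonneg (n:ℝ), sq_nonneg τ]
      _ = _ := by rw [hK]; ring
  have u2 : c * (1 + (n:ℝ) ^ 2) ≤ 2 * Real.exp d2 := by
    refine le_trans ?_ (two_cosh_le dist_nonneg)
    rw [hd2, ← mul_smul (G i) (M i), cosh_conj]
    have := conj_pow (a := (G i * M i)⁻¹) (b := R) (i := n)
    rw [inv_inv] at this
    rw [← this]
    exact hg n
  have u3 : c * Real.exp d1 ≤ 2 * K * Real.exp d2 := by
    have h0 : 0 ≤ (1 + (n:ℝ) ^ 2) := by positivity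
    nlinarith
  have : Real.exp (d1 - d2) ≤ 2 * K / c := by
    rw [Real.exp_sub, div_le_div_iff₀ (Real.exp_pos _) hc]
    linarith
  exact (Real.le_log_iff_exp_le (by positivity)).2 this

/-- geodesics of the pattern do not reach high into the cusp -/
lemma Setup.height (S : Setup j ρ m G M) {γ0 : FreeGroup (Fin r)} (hγ : γ0 ≠ 1) {k : SL2} {τ : ℝ}
    (hj : j γ0 = QuotientGroup.mk (k * uu τ * k⁻¹)) (γ) (i : Fin m) (J : SL2) (hJ : (QuotientGroup.mk J : PSL2) = j γ) (s : ℝ) :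
    (k⁻¹ • J • M i • pt s).im ≤ |τ| := by
  obtain ⟨R, hR⟩ := exists_mk (ρ γ0)
  obtain ⟨R0, hR0⟩ := exists_mk (ρ γ)
  have D := S.dj' γ0 hγ i R (k * uu τ * k⁻¹) R0 J hR hj.symm γ hR0 hJ
  have hcr := D.cross
  have h11 := D.dt11
  have h22 := D.dt22
  set N := k⁻¹ * (J * M i) with hN
  have eN : J * M i = k * N := by rw [hN]; group
  have eN' : k * uu τ * k⁻¹ * (J * M i) = k * (uu τ * N) := by rw [hN]; group
  rw [eN', eN] at hcr
  rw [eN', eN] at h11 h22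
  simp only [c1_mul, c2_mul, dt_act] at hcr h11 h22
  have t11 : dt (c1 N) (act (uu τ) (c1 N)) = -(τ * N.1 1 0 ^ 2) := by
    unfold dt act c1; simp only [uu00, uu01, uu10, uu11]; ring
  have t22 : dt (c2 N) (act (uu τ) (c2 N)) = -(τ * N.1 1 1 ^ 2) := by
    unfold dt act c2; simp only [uu00, uu01, uu10, uu11]; ring
  have hd := det_eq N
  have t12 : dt (c1 N) (act (uu τ) (c2 N)) = 1 - τ * (N.1 1 0 * N.1 1 1) := by
    unfold dt act c1 c2; simp only [uu00, uu01, uu10, uu11]; linear_combination hd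
  have t21 : dt (c2 N) (act (uu τ) (c1 N)) = -1 - τ * (N.1 1 0 * N.1 1 1) := by
    unfold dt act c1 c2; simp only [uu00, uu01, uu10, uu11]; linear_combination -hd
  rw [t11, t22, t12, t21] at hcr
  rw [t11] at h11
  rw [t22] at h22
  have hc : N.1 1 0 ≠ 0 := fun h0 => h11 (by rw [h0]; ring)
  have hdd : N.1 1 1 ≠ 0 := fun h0 => h22 (by rw [h0]; ring)
  have hτ : τ ≠ 0 := fun h0 => h11 (by rw [h0]; ring)
  have hp : 1 < (τ * (N.1 1 0 * N.1 1 1)) ^ 2 := by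
    have e : -(τ * N.1 1 0 ^ 2) * -(τ * N.1 1 1 ^ 2) * ((1 - τ * (N.1 1 0 * N.1 1 1)) * (-1 - τ * (N.1 1 0 * N.1 1 1)))
      = (τ * (N.1 1 0 * N.1 1 1)) ^ 2 * ((τ * (N.1 1 0 * N.1 1 1)) ^ 2 - 1) := by ring
    rw [e] at hcr
    by_contra hle
    nlinarith [sq_nonneg (τ * (N.1 1 0 * N.1 1 1))]
  have hp1 : 1 < |τ * (N.1 1 0 * N.1 1 1)| := by
    rw [← sq_abs] at hp
    by_contra hle
    nlinarith [abs_nonneg (τ * (N.1 1 0 * N.1 1 1))]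
  rw [abs_mul, abs_mul] at hp1
  rw [← mul_smul, ← mul_smul, mul_assoc, frame_im]
  have e1 : 0 < Real.exp s := Real.exp_pos s
  have e2 : 0 < Real.exp (-s) := Real.exp_pos (-s)
  have hden : 0 < N.1 1 0 ^ 2 * Real.exp s + N.1 1 1 ^ 2 * Real.exp (-s) := by positivity
  rw [div_le_iff₀ hden]
  have hee : Real.exp s * Real.exp (-s) = 1 := by rw [← Real.exp_add]; simp
  have hamgm : |N.1 1 0| * |N.1 1 1| ≤ N.1 1 0 ^ 2 * Real.exp s + N.1 1 1 ^ 2 * Real.exp (-s) := by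
    refine abs_le_of_sq_le_sq' ?_ hden.le |>.2
    rw [mul_pow, sq_abs, sq_abs]
    nlinarith [sq_nonneg (N.1 1 0 ^ 2 * Real.exp s - N.1 1 1 ^ 2 * Real.exp (-s)), sq_nonneg (N.1 1 0 * N.1 1 1)]
  have := mul_le_mul_of_nonneg_left hamgm (abs_nonneg τ)
  linarith

lemma mod_tau {τ : ℝ} (hτ : τ ≠ 0) (x : ℝ) : ∃ n : ℤ, |n * τ + x| ≤ |τ| := by
  refine ⟨-⌊x / τ⌋, ?_⟩
  have h1 := Int.floor_le (x / τ)
  have h2 := (Int.lt_floor_add_one (x / τ)).le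
  have e : ((-⌊x / τ⌋ : ℤ) : ℝ) * τ + x = (x / τ - ⌊x / τ⌋) * τ := by
    push_cast; field_simp; ring
  rw [e, abs_mul]
  have : |x / τ - ⌊x / τ⌋| ≤ 1 := by rw [abs_le]; constructor <;> linarith
  nlinarith [abs_nonneg τ]

lemma uu_re (a : ℝ) (z : ℍ) : (uu a • z).re = a + z.re ∧ (uu a • z).im = z.im := by
  have h := eq_uu_pt z
  rw [← h, ← mul_smul, uu_mul, uu_pt_re, uu_pt_im, uu_pt_re, uu_pt_im]
  exact ⟨rfl, rfl⟩

lemma dist_cusp {τ : ℝ} (hτ : τ ≠ 0) {y : ℍ} (h1 : |y.re| ≤ |τ|) (h2 : y.im ≤ |τ|) :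
    dist (pt (Real.log |τ|)) y ≤ Real.log 3 + (Real.log |τ| - Real.log y.im) := by
  have ht : 0 < |τ| := abs_pos.2 hτ
  have e := eq_uu_pt y
  have a1 : dist (uu y.re • pt (Real.log |τ|)) y = Real.log |τ| - Real.log y.im := by
    conv_lhs => rw [← e]
    rw [uu_pt_re, dist_smul, dist_pt]
    rw [abs_of_nonneg]
    have := Real.log_le_log y.im_pos h2
    linarith
  have a2 : dist (pt (Real.log |τ|)) (uu y.re • pt (Real.log |τ|)) ≤ Real.log 3 := by
    rw [Real.le_log_iff_exp_le (by norm_num)]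
    refine (exp_le_two_cosh _).trans ?_
    unfold pt
    rw [cosh_conj]
    unfold SS
    rw [aa_inv]
    simp only [mul00, mul01, mul10, mul11, aa00, aa01, aa10, aa11, uu00, uu01, uu10, uu11]
    have ex : Real.exp (-Real.log |τ| / 2) * Real.exp (Real.log |τ| / 2) = 1 := by
      rw [← Real.exp_add]; ring_nf; exact Real.exp_zero
    have ey : Real.exp (-Real.log |τ| / 2) ^ 2 = |τ|⁻¹ := by
      rw [exp_half_sq, Real.exp_neg, Real.exp_log ht]
    have ez : (|τ|⁻¹ * y.re) ^ 2 ≤ 1 := by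
      rw [mul_pow, ← sq_abs y.re, ← mul_pow, sq_le_one_iff₀ (by positivity)]
      rw [inv_mul_le_iff₀ ht]; linarith
    rw [← ey] at ez
    have e5 : Real.exp (- -Real.log |τ| / 2) = Real.exp (Real.log |τ| / 2) := by rw [neg_neg]
    rw [e5]
    generalize Real.exp (-Real.log |τ| / 2) = A at *
    generalize Real.exp (Real.log |τ| / 2) = B at *
    ring_nf
    ring_nf at ez
    have : A ^ 2 * B ^ 2 = 1 := by rw [← mul_pow, ex]; norm_num
    nlinarith
  linarith [dist_triangle (pt (Real.log |τ|)) (uu y.re • pt (Real.log |τ|)) y]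

lemma Setup.no_para (S : Setup j ρ m G M) {γ0 : FreeGroup (Fin r)} (hγ : γ0 ≠ 1) {k : SL2} {τ : ℝ} (hτ : τ ≠ 0)
    (hj : j γ0 = QuotientGroup.mk (k * uu τ * k⁻¹)) : False := by
  have i0 : Fin m := ⟨0, S.m_pos hγ⟩
  obtain ⟨q0, hq⟩ := S.fix_of_para i0 hγ hj
  have hqz : ∀ n : ℤ, pslSMul (ρ (γ0 ^ n)) q0 = q0 := by
    have hn : ∀ n : ℕ, pslSMul (ρ (γ0 ^ n)) q0 = q0 := by
      intro n
      induction n with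
      | zero => rw [pow_zero, map_one, psl_one]
      | succ n ih => rw [pow_succ, map_mul, psl_mul, hq, ih]
    intro n
    obtain ⟨n, rfl | rfl⟩ := n.eq_nat_or_neg
    · rw [zpow_natCast, hn]
    · rw [zpow_neg, zpow_natCast, map_inv]
      conv_lhs => rw [← hn n]
      rw [psl_inv_smul]
  set C : ℝ := dist q0 (G i0 • M i0 • pt 0) + dist (k⁻¹ • M i0 • pt 0) (pt (Real.log |τ|)) + Real.log 3 + Real.log |τ| with hC
  -- the contraction bound
  have bound : ∀ γ i s, dist q0 (pslSMul (ρ γ) (G i • M i • pt s)) ≤ C - Real.log (k⁻¹ • pslSMul (j γ) (M i • pt s)).im := by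
    intro γ i s
    obtain ⟨J, hJ⟩ := exists_mk (j γ)
    have hh := S.height hγ hj γ i J hJ s
    set y := k⁻¹ • pslSMul (j γ) (M i • pt s) with hy
    rw [← psl_mk J, hJ, ← hy] at hh
    obtain ⟨n, hn⟩ := mod_tau hτ y.re
    have hjn : j (γ0 ^ n) = QuotientGroup.mk (k * uu (n * τ) * k⁻¹) := by
      rw [map_zpow, hj, ← QuotientGroup.mk_zpow, conj_zpow, uu_zpow]
    have h1 : dist q0 (pslSMul (ρ γ) (G i • M i • pt s)) = dist q0 (pslSMul (ρ (γ0 ^ n * γ)) (G i • M i • pt s)) := by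
      rw [map_mul, psl_mul]
      conv_rhs => rw [← hqz n]
      rw [psl_dist]
    have h2 := S.le 1 (γ0 ^ n * γ) i0 i 0 s
    rw [map_one, map_one, psl_one, psl_one, map_mul j, psl_mul, hjn, psl_mk] at h2
    have h3 : dist (M i0 • pt 0) ((k * uu (n * τ) * k⁻¹) • pslSMul (j γ) (M i • pt s)) = dist (k⁻¹ • M i0 • pt 0) (uu (n * τ) • y) := by
      rw [mul_smul, mul_smul, ← hy, ← dist_smul k⁻¹ (M i0 • pt 0), inv_smul_smul]
    rw [h3] at h2
    have hr := uu_re (n * τ) y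
    have h4 := dist_cusp hτ (y := uu (n * τ) • y) (by rw [hr.1]; exact hn) (by rw [hr.2]; exact hh)
    rw [hr.2] at h4
    rw [h1]
    have t1 := dist_triangle q0 (G i0 • M i0 • pt 0) (pslSMul (ρ (γ0 ^ n * γ)) (G i • M i • pt s))
    have t2 := dist_triangle (k⁻¹ • M i0 • pt 0) (pt (Real.log |τ|)) (uu (n * τ) • y)
    rw [hC]
    linarith
  apply hγ
  refine S.fd (horo k q0 (Set.Ioi (C + 1))) (horo_open _ _ isOpen_Ioi) (horo_nonempty _ _ ⟨C + 2, by rw [Set.mem_Ioi]; linarith⟩)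
    (horo_preconn _ _ isPreconnected_Ioi) ?_ γ0 ?_
  · intro X hX γ i R J hR hJ hcr
    have hX' : C + 1 < Real.log (k⁻¹ • X⁻¹ • q0).im := by
      have : Real.log (k⁻¹ • pslSMul (QuotientGroup.mk X)⁻¹ q0).im ∈ Set.Ioi (C + 1) := hX
      rw [← QuotientGroup.mk_inv, psl_mk, Set.mem_Ioi] at this
      exact this
    have key : ∀ s, dist (X⁻¹ • q0) ((J * M i) • pt s) - 1 ≥ dist ((R * G i * J⁻¹)⁻¹ • q0) ((J * M i) • pt s) := by
      intro s
      have b := bound γ i s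
      rw [← hR, ← hJ, psl_mk, psl_mk] at b
      have e1 : dist ((R * G i * J⁻¹)⁻¹ • q0) ((J * M i) • pt s) = dist q0 (R • G i • M i • pt s) := by
        rw [← dist_smul (R * G i * J⁻¹), smul_inv_smul, ← mul_smul, ← mul_smul, ← mul_smul]
        congr 2; group
      have e2 : dist (X⁻¹ • q0) ((J * M i) • pt s) = dist (k⁻¹ • X⁻¹ • q0) (k⁻¹ • J • M i • pt s) := by
        rw [dist_smul, mul_smul]
      have e3 := UpperHalfPlane.dist_log_im_le (k⁻¹ • X⁻¹ • q0) (k⁻¹ • J • M i • pt s)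
      rw [Real.dist_eq] at e3
      have e4 := le_abs_self (Real.log (k⁻¹ • X⁻¹ • q0).im - Real.log (k⁻¹ • J • M i • pt s).im)
      rw [e1, e2]
      linarith
    obtain ⟨B, hB⟩ := exists_smul_I (X⁻¹ • q0)
    have key2 : ∀ s, dist (((R * G i * J⁻¹)⁻¹ * X) • B • I) ((J * M i) • pt s) ≤ dist (B • I) ((J * M i) • pt s) - 1 := by
      intro s
      rw [hB, mul_smul, smul_inv_smul]
      exact key s
    rcases hcr with ⟨s, hs⟩ | h | h
    · have k2 := key2 s
      conv_lhs at k2 => rw [← hs, dist_smul]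
      linarith
    · exact wing_contra h key2
    · refine wing_contra (B := B) (N := J * M i * jj) (by rw [c1_jj]; exact h) (fun s => ?_)
      rw [mul_smul (J * M i) jj, jj_pt]
      exact key2 (-s)
  · ext x
    rw [actImg_eq_preimage, Set.mem_preimage]
    unfold horo
    rw [Set.mem_ofPred_eq, Set.mem_ofPred_eq]
    have e : (ρ γ0⁻¹ * x * (j γ0⁻¹)⁻¹)⁻¹ = j γ0⁻¹ * (x⁻¹ * ρ γ0) := by
      rw [map_inv ρ]; group
    have ej : j γ0⁻¹ = QuotientGroup.mk (k * uu (-τ) * k⁻¹) := by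
      rw [map_inv, hj, ← QuotientGroup.mk_inv, ← uu_inv]; congr 1; group
    rw [e, psl_mul, psl_mul, hq, ej, psl_mk, mul_smul, mul_smul, inv_smul_smul, (uu_re _ _).2]

/-- all nontrivial elements are hyperbolic -/
lemma Setup.hyper (S : Setup j ρ m G M) {γ : FreeGroup (Fin r)} (hγ : γ ≠ 1) {J : SL2} (hJ : (QuotientGroup.mk J : PSL2) = j γ) :
    4 < (J.1 0 0 + J.1 1 1) ^ 2 := by
  by_contra hle
  have i0 : Fin m := ⟨0, S.m_pos hγ⟩
  rcases lt_or_eq_of_le (not_lt.1 hle) with h | h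
  · obtain ⟨p, hp⟩ := elliptic_fix h
    exact hγ (S.fix_pt_one i0 (p := p) (by rw [← hJ, psl_mk, hp]))
  · obtain ⟨k, hk⟩ := exists_tri h.ge
    obtain ⟨Y, hY⟩ : ∃ Y, Y = k⁻¹ * J * k := ⟨_, rfl⟩
    rw [← hY] at hk
    have hJY : J = k * Y * k⁻¹ := by rw [hY]; group
    have hd := det_eq Y
    have htr : Y.1 0 0 + Y.1 1 1 = J.1 0 0 + J.1 1 1 := by
      rw [hY]
      simp only [mul00, mul01, mul10, mul11, inv00, inv01, inv10, inv11]
      linear_combination (J.1 0 0 + J.1 1 1) * det_eq k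
    rw [← htr] at h
    rw [hk] at hd
    have h1 : Y.1 0 0 = Y.1 1 1 := by
      have : (Y.1 0 0 - Y.1 1 1) ^ 2 = 0 := by nlinarith
      have := pow_eq_zero_iff (two_ne_zero) |>.1 this
      linarith
    have h2 : Y.1 0 0 ^ 2 = 1 := by rw [← h1] at hd; linarith
    have e := tri_cases hk h2
    have hj : j γ = QuotientGroup.mk (k * uu (Y.1 0 0 * Y.1 0 1) * k⁻¹) := by
      rw [← hJ, hJY, QuotientGroup.mk_mul, QuotientGroup.mk_mul, e, ← QuotientGroup.mk_mul, ← QuotientGroup.mk_mul]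
    by_cases hτ : Y.1 0 0 * Y.1 0 1 = 0
    · rw [hτ, uu_zero, mul_one, mul_inv_cancel, QuotientGroup.mk_one] at hj
      exact hγ (S.inj i0 (by rw [hj, map_one]))
    · exact S.no_para hγ hτ hj

end para2
end CK

namespace CK
section fin
open UpperHalfPlane (I)
variable {r : ℕ} {j ρ : FreeGroup (Fin r) →* PSL2} {m : ℕ} {G M : Fin m → SL2}

lemma exists_lift (j : FreeGroup (Fin r) →* PSL2) (M : SL2) :
    ∃ A : FreeGroup (Fin r) →* SL2, ∀ g, (QuotientGroup.mk (M * A g * M⁻¹) : PSL2) = j g := by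
  choose a ha using fun i => exists_mk (j (FreeGroup.of i))
  let A0 : FreeGroup (Fin r) →* SL2 := FreeGroup.lift a
  have h0 : (QuotientGroup.mk' (Subgroup.center SL2)).comp A0 = j := by
    apply FreeGroup.ext_hom
    intro i
    simp only [MonoidHom.comp_apply, A0, FreeGroup.lift_apply_of]
    exact ha i
  refine ⟨(MulAut.conj M⁻¹).toMonoidHom.comp A0, fun g => ?_⟩
  have e : M * ((MulAut.conj M⁻¹).toMonoidHom.comp A0) g * M⁻¹ = A0 g := by
    show M * (M⁻¹ * A0 g * M⁻¹⁻¹) * M⁻¹ = _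
    group
  rw [e]
  exact DFunLike.congr_fun h0 g

lemma trace_conj (k J : SL2) : (k * J * k⁻¹).1 0 0 + (k * J * k⁻¹).1 1 1 = J.1 0 0 + J.1 1 1 := by
  simp only [mul00, mul01, mul10, mul11, inv00, inv01, inv10, inv11]
  linear_combination (J.1 0 0 + J.1 1 1) * det_eq k

lemma Setup.hyp (S : Setup j ρ m G M) (i : Fin m) {A : FreeGroup (Fin r) →* SL2}
    (hA : ∀ g, (QuotientGroup.mk (M i * A g * (M i)⁻¹) : PSL2) = j g) : Hyp A := by
  constructor
  · intro g hg
    obtain ⟨R, hR⟩ := exists_mk (ρ g)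
    have D := (S.dj g hg i R _ hR (hA g)).cross
    rw [inv_mul_cancel_right] at D
    have e1 : c1 (M i) = act (M i) (1, 0) := by unfold c1 act; simp
    have e2 : c2 (M i) = act (M i) (0, 1) := by unfold c2 act; simp
    rw [c1_mul, c2_mul, e1, e2] at D
    simp only [dt_act] at D
    unfold dt c1 c2 at D
    simp only at D
    nlinarith
  · intro C
    have hK : 1 ≤ 2 * √ C + 1 := by linarith [Real.sqrt_nonneg C]
    refine (S.p2 i (Real.log_nonneg hK)).subset ?_
    intro g hg
    rw [Set.mem_ofPred_eq] at hg
    rw [Set.mem_ofPred_eq]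
    have hp : nr (pe A g) ≠ 0 := by
      intro h
      have := nr_sq (pe A g)
      rw [h] at this
      have h2 := nn_pos (act_ne (A := A g) (p := ((1, 0) : V)) (by simp))
      unfold pe at this
      linarith
    have hq : nr (qe A g) ≠ 0 := by
      intro h
      have := nr_sq (qe A g)
      rw [h] at this
      have h2 := nn_pos (act_ne (A := A g) (p := ((0, 1) : V)) (by simp))
      unfold qe at this
      linarith
    obtain ⟨t, ht⟩ := amgm hp hq
    refine ⟨t, ?_⟩
    rw [Real.le_log_iff_exp_le (by linarith)]
    refine (exp_le_two_cosh _).trans ?_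
    rw [← hA g, psl_mk]
    have e : (M i * A g * (M i)⁻¹) • M i • pt t = (M i * A g * aa t) • I := by
      unfold pt
      rw [← mul_smul, ← mul_smul]; congr 1; group
    rw [e, two_cosh, show (M i)⁻¹ * (M i * A g * aa t) = A g * aa t by group, SS_mul_aa]
    rw [nr_sq, nr_sq, pe_eq, qe_eq] at ht
    unfold nn at ht
    simp only at ht
    rw [ht, ← pe_eq, ← qe_eq]
    have : |nr (pe A g) * nr (qe A g)| ≤ √ C := by
      apply Real.abs_le_sqrt
      rw [mul_pow, nr_sq, nr_sq]; exact hg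
    linarith
  · intro g hg h
    have := S.hyper hg (hA g)
    rw [trace_conj] at this
    linarith

lemma split_norm (g : FreeGroup (Fin r)) {L : ℕ} (h : L ≤ g.norm) :
    ∃ u v, g = u * v ∧ u.norm = L ∧ v.norm + L = g.norm := by
  have e : g = FreeGroup.mk (g.toWord.take L) * FreeGroup.mk (g.toWord.drop L) := by
    rw [FreeGroup.mul_mk, List.take_append_drop, FreeGroup.mk_toWord]
  have h1 := FreeGroup.norm_mk_le (L₁ := g.toWord.take L)
  have h2 := FreeGroup.norm_mk_le (L₁ := g.toWord.drop L)
  have h3 := FreeGroup.norm_mul_le (FreeGroup.mk (g.toWord.take L)) (FreeGroup.mk (g.toWord.drop L))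
  rw [← e] at h3
  rw [List.length_take] at h1
  rw [List.length_drop] at h2
  have h4 : g.norm = g.toWord.length := rfl
  refine ⟨_, _, e, ?_, ?_⟩ <;> omega

lemma disp_mul (j : FreeGroup (Fin r) →* PSL2) (z : ℍ) (u v) :
    dist z (pslSMul (j (u * v)) z) ≤ dist z (pslSMul (j u) z) + dist z (pslSMul (j v) z) := by
  rw [map_mul, psl_mul]
  refine (dist_triangle _ (pslSMul (j u) z) _).trans ?_
  rw [psl_dist]

lemma disp_le_norm (j : FreeGroup (Fin r) →* PSL2) (z : ℍ) : ∃ κ : ℝ, 1 ≤ κ ∧ ∀ g, dist z (pslSMul (j g) z) ≤ κ * g.norm := by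
  obtain ⟨B, hB⟩ := (Set.finite_range (fun x : Fin r × Bool => dist z (pslSMul (j (FreeGroup.mk [x])) z))).bddAbove
  refine ⟨max 1 B, le_max_left _ _, fun g => ?_⟩
  have : ∀ L : List (Fin r × Bool), dist z (pslSMul (j (FreeGroup.mk L)) z) ≤ max 1 B * L.length := by
    intro L
    induction L with
    | nil => 
      rw [← FreeGroup.one_eq_mk, map_one, psl_one, dist_self]; simp
    | cons x L ih =>
      have e : FreeGroup.mk (x :: L) = FreeGroup.mk [x] * FreeGroup.mk L := by rw [FreeGroup.mul_mk]; rfl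
      rw [e]
      refine (disp_mul j z _ _).trans ?_
      have h1 : dist z (pslSMul (j (FreeGroup.mk [x])) z) ≤ max 1 B := (hB ⟨x, rfl⟩).trans (le_max_right _ _)
      rw [List.length_cons]
      push_cast
      linarith
  have h := this g.toWord
  rw [FreeGroup.mk_toWord] at h
  exact h

lemma Setup.lin (S : Setup j ρ m G M) (i : Fin m) : ∃ c : ℝ, 0 ≤ c ∧ c < 1 ∧ ∀ g,
    dist (G i • M i • I) (pslSMul (ρ g) (G i • M i • I)) ≤ c * dist (M i • I) (pslSMul (j g) (M i • I)) + 1 := by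
  obtain ⟨A, hA⟩ := exists_lift j (M i)
  obtain ⟨ε, hε, hmain⟩ := (S.hyp i hA).main
  have hSS : ∀ g, 2 * Real.cosh (dist (M i • I) (pslSMul (j g) (M i • I))) = SS (A g) := by
    intro g
    rw [← hA g, psl_mk, cosh_conj]
    congr 1; group
  set C := Real.log (2 / ε) with hC
  have hadd : ∀ u v : FreeGroup (Fin r), (u * v).norm = u.norm + v.norm →
      NN j ρ (G i) (M i) u + NN j ρ (G i) (M i) v - C ≤ NN j ρ (G i) (M i) (u * v) := by
    intro u v huv
    have h1 := hmain u v huv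
    have h2 := disp_mul ρ (G i • M i • I) u v
    rw [← hSS, ← hSS, ← hSS] at h1
    unfold NN
    generalize hdu : dist (M i • I) (pslSMul (j u) (M i • I)) = du at *
    generalize hdv : dist (M i • I) (pslSMul (j v) (M i • I)) = dv at *
    generalize hduv : dist (M i • I) (pslSMul (j (u * v)) (M i • I)) = duv at *
    have hn : 0 ≤ duv := by rw [← hduv]; exact dist_nonneg
    have h3 : ε * (Real.exp du * Real.exp dv) ≤ 2 * Real.exp duv := by
      refine le_trans ?_ (h1.trans (two_cosh_le hn))
      apply mul_le_mul_of_nonneg_left _ hε.le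
      exact mul_le_mul (exp_le_two_cosh _) (exp_le_two_cosh _) (Real.exp_pos _).le (by have := Real.cosh_pos du; linarith)
    have h4 : du + dv - duv ≤ C := by
      rw [hC, Real.le_log_iff_exp_le (by positivity), Real.exp_sub, Real.exp_add, div_le_div_iff₀ (Real.exp_pos _) hε]
      linarith
    linarith
  obtain ⟨L0, hL0⟩ := ((S.p3 i (C + 1)).image FreeGroup.norm).bddAbove
  have hbig : ∀ g : FreeGroup (Fin r), L0 + 1 ≤ g.norm → C + 1 < NN j ρ (G i) (M i) g := by
    intro g hg
    by_contra hle
    have := hL0 ⟨g, by rw [Set.mem_ofPred_eq]; exact not_lt.1 hle, rfl⟩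
    omega
  have hind : ∀ n : ℕ, ∀ g : FreeGroup (Fin r), g.norm = n → (g.norm : ℝ) ≤ (L0 + 1) * (NN j ρ (G i) (M i) g + 1) := by
    intro n
    induction n using Nat.strong_induction_on with
    | _ n ih =>
      intro g hg
      by_cases hlt : g.norm < L0 + 1
      · have h1 := S.NN_nonneg i g
        have h2 : (g.norm : ℝ) < L0 + 1 := by exact_mod_cast hlt
        have h3 : (0:ℝ) ≤ L0 := Nat.cast_nonneg _
        nlinarith
      · obtain ⟨u, v, e, hu, hv⟩ := split_norm g (not_lt.1 hlt)
        have h1 := ih v.norm (by omega) v rfl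
        have h2 := hbig u hu.ge
        have h3 := hadd u v (by rw [← e]; omega)
        rw [← e] at h3
        have h4 : (g.norm : ℝ) = v.norm + (L0 + 1) := by rw [← hv]; push_cast; ring
        have h5 : (0:ℝ) ≤ L0 := Nat.cast_nonneg _
        rw [h4]
        nlinarith
  obtain ⟨κ, hκ, hκ'⟩ := disp_le_norm j (M i • I)
  have hL : (1:ℝ) ≤ L0 + 1 := by have : (0:ℝ) ≤ L0 := Nat.cast_nonneg _; linarith
  have hkL : 1 ≤ κ * (L0 + 1) := by nlinarith
  refine ⟨1 - 1 / (κ * (L0 + 1)), ?_, ?_, fun g => ?_⟩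
  · have : 1 / (κ * (L0 + 1)) ≤ 1 := by rw [div_le_one (by linarith)]; exact hkL
    linarith
  · have : 0 < 1 / (κ * (L0 + 1)) := by positivity
    linarith
  · have h1 := hκ' g
    have h2 := hind _ g rfl
    unfold NN at h2
    set d1 := dist (M i • I) (pslSMul (j g) (M i • I))
    set d2 := dist (G i • M i • I) (pslSMul (ρ g) (G i • M i • I))
    have h3 : d1 ≤ κ * (L0 + 1) * (d1 - d2 + 1) := by
      have := mul_le_mul_of_nonneg_left h2 (by linarith : 0 ≤ κ)
      linarith
    have h4 : d1 / (κ * (L0 + 1)) ≤ d1 - d2 + 1 := by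
      rw [div_le_iff₀ (by linarith)]; linarith
    rw [sub_mul, one_mul, one_div_mul_eq_div]
    linarith

lemma trans_bdd (g : PSL2) : BddBelow (Set.range fun p : ℍ => dist p (pslSMul g p)) :=
  ⟨0, by rintro _ ⟨p, rfl⟩; exact dist_nonneg⟩

lemma trans_le (g : PSL2) (p : ℍ) : transLength g ≤ dist p (pslSMul g p) := ciInf_le (trans_bdd g) p

lemma trans_nonneg (g : PSL2) : 0 ≤ transLength g := Real.iInf_nonneg fun _ => dist_nonneg

lemma trans_one : transLength 1 = 0 := by
  apply le_antisymm _ (trans_nonneg _)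
  have := trans_le 1 I
  rwa [psl_one, dist_self] at this

lemma trans_pos {J : SL2} (h : 4 < (J.1 0 0 + J.1 1 1) ^ 2) : 0 < transLength (QuotientGroup.mk J) := by
  set t := ((J.1 0 0 + J.1 1 1) ^ 2 - 2) / 2 with ht
  have ht1 : 1 < t := by rw [ht]; linarith
  refine lt_of_lt_of_le (Real.log_pos ht1) (le_ciInf fun p => ?_)
  obtain ⟨B, rfl⟩ := exists_smul_I p
  rw [psl_mk, Real.log_le_iff_le_exp (by linarith)]
  have h1 := cosh_conj B J
  have h2 := two_cosh_le (dist_nonneg (x := B • I) (y := J • B • I))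
  have h3 := trace_conj B⁻¹ J
  rw [inv_inv] at h3
  have hd := det_eq (B⁻¹ * J * B)
  have h4 : (J.1 0 0 + J.1 1 1) ^ 2 - 2 ≤ SS (B⁻¹ * J * B) := by
    rw [← h3]
    unfold SS
    nlinarith [sq_nonneg ((B⁻¹ * J * B).1 0 1 - (B⁻¹ * J * B).1 1 0)]
  rw [ht]
  linarith

/-- translation length is bounded by the growth rate of orbits -/
lemma stable (X : SL2) (q : ℍ) : ∃ C : ℝ, ∀ n : ℕ, n * transLength (QuotientGroup.mk X) ≤ dist q (X ^ n • q) + C := by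
  by_cases htr : (X.1 0 0 + X.1 1 1) ^ 2 < 4
  · obtain ⟨p, hp⟩ := elliptic_fix htr
    have h0 : transLength (QuotientGroup.mk X) ≤ 0 := by
      have := trans_le (QuotientGroup.mk X) p
      rwa [psl_mk, hp, dist_self] at this
    refine ⟨0, fun n => ?_⟩
    have : (n:ℝ) * transLength (QuotientGroup.mk X) ≤ 0 := mul_nonpos_of_nonneg_of_nonpos (Nat.cast_nonneg _) h0
    linarith [dist_nonneg (x := q) (y := X ^ n • q)]
  obtain ⟨k, hk⟩ := exists_tri (not_lt.1 htr)
  obtain ⟨Y, hY⟩ : ∃ Y, Y = k⁻¹ * X * k := ⟨_, rfl⟩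
  rw [← hY] at hk
  have hd := det_eq Y
  rw [hk] at hd
  have ha0 : Y.1 0 0 ≠ 0 := by
    intro h0; rw [h0] at hd; norm_num at hd
  have hpos : 0 < Y.1 0 0 ^ 2 := sq_pos_of_ne_zero ha0
  have hinv : Y.1 1 1 = (Y.1 0 0)⁻¹ := by field_simp; linarith
  obtain ⟨L, hL⟩ : ∃ L, L = Real.log (Y.1 0 0 ^ 2) := ⟨_, rfl⟩
  have e1 : Y.1 0 0 ^ 2 = Real.exp L := by rw [hL, Real.exp_log hpos]
  have e2 : Y.1 1 1 ^ 2 = Real.exp (-L) := by rw [Real.exp_neg, ← e1, hinv, inv_pow]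
  have hlen : transLength (QuotientGroup.mk X) ≤ |L| := by
    by_contra hlt
    rw [not_le] at hlt
    have hco : Real.cosh |L| < Real.cosh (transLength (QuotientGroup.mk X)) := by
      rw [Real.cosh_lt_cosh, abs_abs, abs_of_nonneg (trans_nonneg _)]; exact hlt
    set δ := 2 * (Real.cosh (transLength (QuotientGroup.mk X)) - Real.cosh |L|) with hδ
    have hδ0 : 0 < δ := by rw [hδ]; linarith
    have hall : ∀ s : ℝ, δ ≤ Y.1 0 1 ^ 2 * Real.exp (-(2 * s)) := by
      intro s
      have h1 := trans_le (QuotientGroup.mk X) ((k * aa s) • I)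
      rw [psl_mk] at h1
      have h2 : Real.cosh (transLength (QuotientGroup.mk X)) ≤ Real.cosh (dist ((k * aa s) • I) (X • (k * aa s) • I)) := by
        rw [Real.cosh_le_cosh, abs_of_nonneg (trans_nonneg _), abs_of_nonneg dist_nonneg]; exact h1
      have h3 := cosh_conj (k * aa s) X
      have h4 : (k * aa s)⁻¹ * X * (k * aa s) = (aa s)⁻¹ * (Y * aa s) := by rw [hY]; group
      rw [h4, aa_inv, SS_aa_mul] at h3
      simp only [mul00, mul01, mul10, mul11, aa00, aa01, aa10, aa11, hk] at h3
      have hs1 : Real.exp (-s / 2) ^ 2 = Real.exp (-s) := by rw [exp_half_sq]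
      have hs2 : Real.exp (s / 2) ^ 2 = Real.exp s := exp_half_sq s
      have hs3 : Real.exp (-s) * Real.exp s = 1 := by rw [← Real.exp_add]; simp
      have hs4 : Real.exp (-(2 * s)) = Real.exp (-s) ^ 2 := by rw [← Real.exp_nat_mul]; congr 1; push_cast; ring
      rw [neg_neg] at h3
      have hs5 : 2 * Real.cosh |L| = Y.1 0 0 ^ 2 + Y.1 1 1 ^ 2 := by
        rw [Real.cosh_abs, Real.cosh_eq, e1, e2]; ring
      have h5 : 2 * Real.cosh (dist ((k * aa s) • I) (X • (k * aa s) • I)) = Y.1 0 0 ^ 2 + Y.1 1 1 ^ 2 + Y.1 0 1 ^ 2 * Real.exp (-(2 * s)) := by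
        rw [h3, hs4]
        linear_combination (Real.exp (-s) * Y.1 0 0 ^ 2) * hs2 + (Real.exp (-s) * Y.1 0 1 ^ 2 + Real.exp s * Y.1 1 1 ^ 2) * hs1 + (Y.1 0 0 ^ 2 + Y.1 1 1 ^ 2) * hs3
      rw [hδ]
      linarith
    have h6 := hall (Y.1 0 1 ^ 2 / δ)
    have h7 := Real.add_one_le_exp (2 * (Y.1 0 1 ^ 2 / δ))
    rw [Real.exp_neg, ← div_eq_mul_inv, le_div_iff₀ (Real.exp_pos _)] at h6
    have h8 := mul_le_mul_of_nonneg_left h7 hδ0.le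
    have h9 : δ * (2 * (Y.1 0 1 ^ 2 / δ) + 1) = 2 * Y.1 0 1 ^ 2 + δ := by field_simp
    nlinarith [sq_nonneg (Y.1 0 1)]
  obtain ⟨B, rfl⟩ := exists_smul_I q
  obtain ⟨K, hK⟩ : ∃ K, K = 2 * SS (k⁻¹ * B) * SS (B⁻¹ * k) := ⟨_, rfl⟩
  have hK0 : 0 < K := by
    have := SS_pos (k⁻¹ * B)
    have := SS_pos (B⁻¹ * k)
    rw [hK]; positivity
  refine ⟨Real.log K, fun n => ?_⟩
  have hn1 : (n:ℝ) * transLength (QuotientGroup.mk X) ≤ |n * L| := by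
    rw [abs_mul, Nat.abs_cast]
    exact mul_le_mul_of_nonneg_left hlen (Nat.cast_nonneg _)
  obtain ⟨t1, t2, t3⟩ := tri_pow hk n
  have h1 : Real.exp |n * L| ≤ SS (Y ^ n) := by
    have f1 : (Y.1 0 0 ^ n) ^ 2 = Real.exp (n * L) := by
      rw [← pow_mul, mul_comm n 2, pow_mul, Real.exp_nat_mul, e1]
    have f2 : (Y.1 1 1 ^ n) ^ 2 = Real.exp (-(n * L)) := by
      rw [← pow_mul, mul_comm n 2, pow_mul, e2, ← Real.exp_nat_mul]; congr 1; ring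
    have h3 : Real.exp |n * L| ≤ Real.exp (n * L) + Real.exp (-(n * L)) := by
      rcases abs_choice (n * L) with h | h <;> rw [h] <;> linarith [Real.exp_pos (n * L), Real.exp_pos (-(n * L))]
    refine h3.trans ?_
    unfold SS; rw [t2, t3, f1, f2]; nlinarith [sq_nonneg ((Y ^ n).1 0 1), sq_nonneg ((Y ^ n).1 1 0)]
  have h2 : SS (Y ^ n) ≤ SS (k⁻¹ * B) * SS (B⁻¹ * X ^ n * B) * SS (B⁻¹ * k) := by
    have e : Y ^ n = k⁻¹ * X ^ n * k := by
      have := conj_pow (a := k⁻¹) (b := X) (i := n)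
      rw [inv_inv] at this
      rw [hY]; exact this
    have e' : k⁻¹ * X ^ n * k = (k⁻¹ * B) * (B⁻¹ * X ^ n * B) * (B⁻¹ * k) := by group
    rw [e, e']
    refine (SS_mul _ _).trans ?_
    exact mul_le_mul_of_nonneg_right (SS_mul _ _) (by linarith [SS_pos (B⁻¹ * k)])
  have h3 := cosh_conj B (X ^ n)
  have h4 := two_cosh_le (dist_nonneg (x := B • I) (y := X ^ n • B • I))
  rw [h3] at h4
  have h5 : Real.exp |n * L| ≤ K * Real.exp (dist (B • I) (X ^ n • B • I)) := by
    refine h1.trans (h2.trans ?_)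
    have := SS_pos (k⁻¹ * B)
    have := SS_pos (B⁻¹ * k)
    have := mul_le_mul_of_nonneg_left h4 (by positivity : 0 ≤ SS (k⁻¹ * B) * SS (B⁻¹ * k))
    rw [hK]
    linarith
  have h6 : |n * L| ≤ Real.log K + dist (B • I) (X ^ n • B • I) := by
    rw [← Real.exp_le_exp, Real.exp_add, Real.exp_log hK0]; exact h5
  linarith

lemma le_of_lin {a b C : ℝ} (h : ∀ n : ℕ, n * a ≤ n * b + C) : a ≤ b := by
  by_contra hlt
  rw [not_le] at hlt
  obtain ⟨n, hn⟩ := exists_nat_gt (C / (a - b))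
  have := h n
  rw [div_lt_iff₀ (by linarith)] at hn
  linarith

lemma disp_pow (j : FreeGroup (Fin r) →* PSL2) (p : ℍ) (γ) (n : ℕ) :
    dist p (pslSMul (j (γ ^ n)) p) ≤ n * dist p (pslSMul (j γ) p) := by
  induction n with
  | zero => rw [pow_zero, map_one, psl_one, dist_self]; simp
  | succ n ih =>
    rw [pow_succ]
    refine (disp_mul j p _ _).trans ?_
    push_cast
    linarith

lemma Setup.final (S : Setup j ρ m G M) (i : Fin m) : ∃ c < 1, ∀ γ, transLength (ρ γ) ≤ c * transLength (j γ) := by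
  obtain ⟨c, hc0, hc1, hlin⟩ := S.lin i
  refine ⟨c, hc1, fun γ => ?_⟩
  unfold transLength
  rw [Real.mul_iInf_of_nonneg hc0]
  refine le_ciInf fun p => ?_
  obtain ⟨R, hR⟩ := exists_mk (ρ γ)
  obtain ⟨C, hC⟩ := stable R (G i • M i • I)
  apply le_of_lin (C := c * (2 * dist (M i • I) p) + 1 + C)
  intro n
  have h1 := hC n
  have h2 := hlin (γ ^ n)
  have h3 : ρ (γ ^ n) = QuotientGroup.mk (R ^ n) := by rw [map_pow, ← hR, ← QuotientGroup.mk_pow]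
  rw [h3, psl_mk] at h2
  rw [hR] at h1
  have h4 := disp_pow j p γ n
  have h5 : dist (M i • I) (pslSMul (j (γ ^ n)) (M i • I)) ≤ n * dist p (pslSMul (j γ) p) + 2 * dist (M i • I) p := by
    have t1 := dist_triangle4 (M i • I) p (pslSMul (j (γ ^ n)) p) (pslSMul (j (γ ^ n)) (M i • I))
    rw [psl_dist, dist_comm p (M i • I)] at t1
    linarith
  have h6 := mul_le_mul_of_nonneg_left h5 hc0
  unfold transLength at h1
  linarith

theorem main_thm (hpd : ProperlyDisc j ρ) (hfd : AdmitsRightCrookedFD j ρ) :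
    Function.Injective j ∧ DiscreteTopology j.range ∧
      (∀ γ : FreeGroup (Fin r), γ ≠ 1 → 0 < transLength (j γ)) ∧
      ∃ c < 1, ∀ γ : FreeGroup (Fin r), transLength (ρ γ) ≤ c * transLength (j γ) := by
  by_cases h : ∃ γ : FreeGroup (Fin r), γ ≠ 1
  · obtain ⟨γ, hγ⟩ := h
    obtain ⟨m, G, M, S⟩ := exists_setup hpd hfd
    have i : Fin m := ⟨0, S.m_pos hγ⟩
    refine ⟨S.inj i, S.discrete i, fun γ hγ => ?_, S.final i⟩
    obtain ⟨J, hJ⟩ := exists_mk (j γ)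
    rw [← hJ]
    exact trans_pos (S.hyper hγ hJ)
  · push Not at h
    refine ⟨fun a b _ => by rw [h a, h b], ?_, fun γ hγ => absurd (h γ) hγ, 0, by norm_num, fun γ => ?_⟩
    · have : Subsingleton j.range := by
        constructor
        rintro ⟨_, a, rfl⟩ ⟨_, b, rfl⟩
        simp only [h a, h b]
      infer_instance
    · rw [h γ, map_one, map_one, trans_one]; simp

end fin
end CK

theorem stmt10 (r : ℕ) (j ρ : FreeGroup (Fin r) →* PSL2)
    (hpd : ProperlyDisc j ρ) (hfd : AdmitsRightCrookedFD j ρ) :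
    Function.Injective j ∧ DiscreteTopology j.range ∧
      (∀ γ : FreeGroup (Fin r), γ ≠ 1 → 0 < transLength (j γ)) ∧
      ∃ c < 1, ∀ γ : FreeGroup (Fin r), transLength (ρ γ) ≤ c * transLength (j γ) := by
  exact CK.main_thm hpd hfd

end
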